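/- arXiv:math/0503367 — 2 statements merged into one kernel-verified Lean document; each statement's English description precedes it below -/
import Mathlib

section
/- For every integer k ≥ 2 there exists a set S ⊆ ℕ that is (k−1)-intersective but not k-intersective. -/
open Classical

/-- `Λ ⊆ ℤ` has positive upper Banach density:
`limsup_{N-M→∞} |Λ ∩ [M, N)| / (N - M) > 0`, i.e. there is `δ > 0` such that there are
arbitrarily long integer intervals `[M, N)` with `|Λ ∩ [M, N)| ≥ δ (N - M)`. -/
def HasPosUpperBanachDensity (Λ : Set ℤ) : Prop :=
  ∃ δ : ℝ, 0 < δ ∧ ∀ K : ℕ, ∃ M N : ℤ, M + K ≤ N ∧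
    δ * ((N : ℝ) - M) ≤ ((Finset.Ico M N).filter (fun x => x ∈ Λ)).card

/-- `S` is `k`-intersective: every `Λ ⊆ ℤ` of positive upper Banach density contains an
arithmetic progression of length `k+1` whose common difference belongs to `S`. -/
def IsKIntersective (k : ℕ) (S : Set ℕ) : Prop :=
  ∀ Λ : Set ℤ, HasPosUpperBanachDensity Λ →
    ∃ (a : ℤ) (n : ℕ), n ∈ S ∧ ∀ i : ℕ, i ≤ k → a + (i : ℤ) * n ∈ Λ

open Combinatorics
open scoped BigOperators ComplexConjugate fwdDiff

/-- The real number `1` or `0` according to whether `p` holds. -/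
noncomputable def ind (p : Prop) : ℝ := if p then 1 else 0

theorem ind_of_true {p : Prop} (h : p) : ind p = 1 := if_pos h

theorem ind_of_false {p : Prop} (h : ¬p) : ind p = 0 := if_neg h

theorem ind_nonneg (p : Prop) : 0 ≤ ind p := by
  unfold ind; split_ifs <;> norm_num

theorem ind_le_one (p : Prop) : ind p ≤ 1 := by
  unfold ind; split_ifs <;> norm_num

theorem ind_mono {p q : Prop} (h : p → q) : ind p ≤ ind q := by
  unfold ind; split_ifs <;> first | tauto | norm_num

theorem ind_and (p q : Prop) : ind (p ∧ q) = ind p * ind q := by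
  unfold ind; split_ifs <;> simp_all

theorem ind_not (p : Prop) : ind (¬p) = 1 - ind p := by
  unfold ind; split_ifs <;> simp_all

/-- The average of a real function on a finite type. -/
noncomputable def avg {X : Type} [Finite X] (f : X → ℝ) : ℝ :=
  letI := Fintype.ofFinite X
  𝔼 x, f x

section avg

variable {X Y : Type} [Finite X] [Finite Y]

theorem avg_eq_expect [Fintype X] (f : X → ℝ) : avg f = 𝔼 x, f x := by
  unfold avg
  congr!

theorem avg_mono {f g : X → ℝ} (h : ∀ x, f x ≤ g x) : avg f ≤ avg g :=
  Finset.expect_le_expect fun x _ ↦ h x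

theorem avg_nonneg {f : X → ℝ} (h : ∀ x, 0 ≤ f x) : 0 ≤ avg f :=
  Finset.expect_nonneg fun x _ ↦ h x

theorem avg_const [Nonempty X] (c : ℝ) : avg (fun _ : X ↦ c) = c :=
  letI := Fintype.ofFinite X
  Fintype.expect_const c

theorem avg_le {f : X → ℝ} {c : ℝ} (hc : 0 ≤ c) (h : ∀ x, f x ≤ c) : avg f ≤ c := by
  rcases isEmpty_or_nonempty X with hX | hX
  · simpa [avg] using hc
  · exact (avg_mono h).trans (avg_const c).le

theorem avg_add (f g : X → ℝ) : avg (fun x ↦ f x + g x) = avg f + avg g :=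
  Finset.expect_add_distrib _ _ _

theorem avg_sub (f g : X → ℝ) : avg (fun x ↦ f x - g x) = avg f - avg g :=
  Finset.expect_sub_distrib _ _ _

theorem avg_const_mul (c : ℝ) (f : X → ℝ) : avg (fun x ↦ c * f x) = c * avg f :=
  (Finset.mul_expect _ _ _).symm

theorem avg_sum {J : Type} (s : Finset J) (f : J → X → ℝ) :
    avg (fun x ↦ ∑ j ∈ s, f j x) = ∑ j ∈ s, avg (f j) :=
  Finset.expect_sum_comm _ _ _

theorem avg_comm (f : X → Y → ℝ) :
    avg (fun x ↦ avg fun y ↦ f x y) = avg (fun y ↦ avg fun x ↦ f x y) :=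
  Finset.expect_comm _ _ _

theorem avg_comp_equiv (e : X ≃ Y) (f : Y → ℝ) : avg (fun x ↦ f (e x)) = avg f :=
  let := Fintype.ofFinite X
  let := Fintype.ofFinite Y
  Fintype.expect_equiv e _ _ fun _ ↦ rfl

theorem avg_prod (f : X × Y → ℝ) : avg f = avg fun x ↦ avg fun y ↦ f (x, y) := by
  let := Fintype.ofFinite X
  let := Fintype.ofFinite Y
  rw [avg_eq_expect f, ← Finset.univ_product_univ, Finset.expect_product]
  rfl

theorem avg_sum_arrow {ι κ α : Type} [Finite ι] [Finite κ] [Finite α]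
    (f : (ι ⊕ κ → α) → ℝ) :
    avg f = avg fun x : ι → α ↦ avg fun y : κ → α ↦ f (Sum.elim x y) := by
  rw [← avg_comp_equiv (Equiv.sumArrowEquivProdArrow ι κ α).symm, avg_prod]
  rfl

theorem card_mul_avg (f : X → ℝ) [Fintype X] : Fintype.card X * avg f = ∑ x, f x := by
  rw [avg_eq_expect, Fintype.card_mul_expect]

theorem le_of_avg_le {f : X → ℝ} {c : ℝ} [Fintype X] (hf : ∀ x, 0 ≤ f x) (h : avg f ≤ c) (x : X) :
    f x ≤ Fintype.card X * c := by
  calc f x ≤ ∑ x, f x := Finset.single_le_sum (fun x _ ↦ hf x) (Finset.mem_univ x)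
    _ = Fintype.card X * avg f := (card_mul_avg f).symm
    _ ≤ _ := by gcongr

end avg

namespace Combinatorics.Subspace

variable {η θ α ι κ : Type}

/-- The composition of two combinatorial subspaces. -/
def comp (V : Subspace η α ι) (W : Subspace θ α η) : Subspace θ α ι where
  idxFun i := (V.idxFun i).elim Sum.inl W.idxFun
  proper e := by
    obtain ⟨j, hj⟩ := W.proper e
    obtain ⟨i, hi⟩ := V.proper j
    exact ⟨i, by simp [hi, hj]⟩

theorem comp_apply (V : Subspace η α ι) (W : Subspace θ α η) (x : θ → α) :
    V.comp W x = V (W x) := by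
  funext i
  cases h : V.idxFun i <;> simp [comp, coe_apply, h]

/-- The subspace with one more letter and the same coordinates. -/
def lift (V : Subspace η α ι) : Subspace η (Option α) ι where
  idxFun i := (V.idxFun i).map some id
  proper e := by
    obtain ⟨i, hi⟩ := V.proper e
    exact ⟨i, by simp [hi]⟩

theorem getD_lift (V : Subspace η α ι) (w : η → Option α) (a : α) (i : ι) :
    (V.lift w i).getD a = V (fun j ↦ (w j).getD a) i := by
  cases h : V.idxFun i <;> simp [lift, coe_apply, h]

theorem comp_lift (V : Subspace η α ι) (W : Subspace θ α η) (x : θ → Option α) :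
    (V.comp W).lift x = V.lift (W.lift x) := by
  funext i
  cases h : V.idxFun i <;> simp [comp, lift, coe_apply, h]

/-- The product of a point with a subspace. -/
def consLeft (x : κ → α) (V : Subspace η α ι) : Subspace η α (κ ⊕ ι) where
  idxFun := Sum.elim (fun k ↦ Sum.inl (x k)) V.idxFun
  proper e := by
    obtain ⟨i, hi⟩ := V.proper e
    exact ⟨Sum.inr i, hi⟩

theorem consLeft_apply (x : κ → α) (V : Subspace η α ι) (y : η → α) :
    consLeft x V y = Sum.elim x (V y) := by
  funext i
  cases i <;> simp [consLeft, coe_apply]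

/-- The product of a subspace with a point. -/
def consRight (V : Subspace η α ι) (x : κ → α) : Subspace η α (ι ⊕ κ) where
  idxFun := Sum.elim V.idxFun (fun k ↦ Sum.inl (x k))
  proper e := by
    obtain ⟨i, hi⟩ := V.proper e
    exact ⟨Sum.inl i, hi⟩

theorem consRight_apply (x : κ → α) (V : Subspace η α ι) (y : η → α) :
    consRight V x y = Sum.elim (V y) x := by
  funext i
  cases i <;> simp [consRight, coe_apply]

theorem injective_toFun (V : Subspace η α ι) : Function.Injective V.toFun := by
  intro x y h
  funext e
  obtain ⟨i, hi⟩ := V.proper e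
  simpa [toFun, hi] using congrFun h i

instance [Finite η] [Finite α] [Finite ι] : Finite (Subspace η α ι) :=
  Finite.of_injective (fun V ↦ V.idxFun) fun V W h ↦ by cases V; cases W; simpa using h

end Combinatorics.Subspace

namespace Combinatorics.Line

variable {η α ι κ : Type}

instance [Finite α] [Finite ι] : Finite (Line α ι) :=
  Finite.of_injective (fun l ↦ l.idxFun) fun l m h ↦ by cases l; cases m; simpa using h

/-- The image of a line under a combinatorial subspace. -/
def mapSubspace (V : Subspace η α ι) (l : Line α η) : Line α ι where
  idxFun := V.lift l.idxFun
  proper := by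
    obtain ⟨j, hj⟩ := l.proper
    obtain ⟨i, hi⟩ := V.proper j
    exact ⟨i, by simp [Subspace.lift, Subspace.coe_apply, hi, hj]⟩

theorem mapSubspace_apply (V : Subspace η α ι) (l : Line α η) (a : α) :
    mapSubspace V l a = V (l a) := by
  funext i
  exact Subspace.getD_lift V l.idxFun a i

end Combinatorics.Line

theorem exists_le_of_le_sum {J : Type} [Fintype J] {f : J → ℝ} {c : ℝ} (hc : 0 < c)
    (h : c ≤ ∑ j, f j) : ∃ j, c / (Fintype.card J + 1) ≤ f j := by
  by_contra! hf
  have h1 : ∑ j, f j ≤ ∑ _j : J, c / (Fintype.card J + 1) :=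
    Finset.sum_le_sum fun j _ ↦ (hf j).le
  have h2 : (Fintype.card J : ℝ) * (c / (Fintype.card J + 1)) < c := by
    rw [mul_div_assoc', div_lt_iff₀ (by positivity)]
    nlinarith
  simp only [Finset.sum_const, Finset.card_univ, nsmul_eq_mul] at h1
  linarith

theorem avg_eval {ι B : Type} [Finite ι] [Finite B] [Nonempty B] (j : ι) (g : B → ℝ) :
    avg (fun x : ι → B ↦ g (x j)) = avg g := by
  rw [← avg_comp_equiv (Equiv.funSplitAt j B).symm, avg_prod]
  simp [avg_const]

theorem avg_ind_eq {B : Type} [Fintype B] (y : B) :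
    avg (fun x : B ↦ ind (x = y)) = 1 / Fintype.card B := by
  rw [avg_eq_expect, Fintype.expect_eq_sum_div_card]
  simp [ind]

theorem avg_ind_le_one {X : Type} [Finite X] (p : X → Prop) : avg (fun x ↦ ind (p x)) ≤ 1 :=
  avg_le zero_le_one fun _ ↦ ind_le_one _

theorem exists_of_avg_ind_pos {X : Type} [Finite X] {p : X → Prop}
    (h : 0 < avg (fun x ↦ ind (p x))) : ∃ x, p x := by
  by_contra! hp
  refine h.not_ge (avg_le le_rfl fun x ↦ (ind_of_false (hp x)).le)

/-- The density Hales-Jewett property of an alphabet: in sufficiently high dimension every dense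
set of words contains a combinatorial line. -/
def DensityHalesJewett (α : Type) [Finite α] : Prop :=
  ∀ δ : ℝ, 0 < δ → ∃ (ι : Type) (_ : Finite ι), ∀ A : Set (ι → α),
    δ ≤ avg (fun x ↦ ind (x ∈ A)) → ∃ l : Line α ι, ∀ a, l a ∈ A

/-- A set of words over `Option α` is insensitive if the letters `none` and `some a` may be
exchanged freely. -/
def Insensitive {α ι : Type} (a : α) (D : Set (ι → Option α)) : Prop :=
  ∀ x y : ι → Option α, (∀ i, (x i).getD a = (y i).getD a) → x ∈ D → y ∈ D

namespace Insensitive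

variable {α ι κ η : Type} {a : α}

theorem univ : Insensitive a (Set.univ : Set (ι → Option α)) := fun _ _ _ _ ↦ trivial

theorem compl {D : Set (ι → Option α)} (hD : Insensitive a D) : Insensitive a Dᶜ :=
  fun x y h hx hy ↦ hx (hD y x (fun i ↦ (h i).symm) hy)

theorem preimage_elim_left {D : Set (ι ⊕ κ → Option α)} (hD : Insensitive a D)
    (y : κ → Option α) : Insensitive a {x | Sum.elim x y ∈ D} :=
  fun x x' h hx ↦ hD _ _ (by rintro (i | i) <;> simp [h]) hx

theorem preimage_elim_right {D : Set (ι ⊕ κ → Option α)} (hD : Insensitive a D)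
    (x : ι → Option α) : Insensitive a {y | Sum.elim x y ∈ D} :=
  fun y y' h hy ↦ hD _ _ (by rintro (i | i) <;> simp [h]) hy

theorem preimage_subspace {D : Set (ι → Option α)} (hD : Insensitive a D)
    (V : Subspace η (Option α) ι) : Insensitive a {x | V x ∈ D} := by
  intro x y h hx
  refine hD _ _ (fun i ↦ ?_) hx
  cases hi : V.idxFun i <;> simp [Subspace.coe_apply, hi, h]

theorem forall_mem {J : Type} {D : J → Set (ι → Option α)} (hD : ∀ j, Insensitive a (D j)) :
    Insensitive a {x | ∀ j, x ∈ D j} :=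
  fun x y h hx j ↦ hD j x y h (hx j)

theorem inter_imp {D : Set (ι → Option α)} {E : Set (ι → Option α)} (hD : Insensitive a D)
    (hE : Insensitive a E) (p : Prop) : Insensitive a {x | x ∈ D ∧ ¬(x ∈ E ∧ p)} :=
  fun x y h hx ↦ ⟨hD x y h hx.1, fun hy ↦ hx.2 ⟨hE y x (fun i ↦ (h i).symm) hy.1, hy.2⟩⟩

end Insensitive

section blocks

variable {α L : Type}

/-- A chosen coordinate of a block whose letter is not `none`, if there is one. It depends only on
the set of such coordinates. -/
noncomputable def markedCoord (y : L → Option α) : Option L :=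
  if h : ∃ l, y l ≠ none then some h.choose else none

theorem markedCoord_eq_none {y : L → Option α} (h : markedCoord y = none) :
    y = fun _ ↦ none := by
  unfold markedCoord at h
  split_ifs at h with h'
  funext l
  by_contra hl
  exact h' ⟨l, hl⟩

theorem ne_none_of_markedCoord {y : L → Option α} {l : L} (h : markedCoord y = some l) :
    y l ≠ none := by
  unfold markedCoord at h
  split_ifs at h with h'
  rw [← Option.some.inj h]
  exact h'.choose_spec

theorem markedCoord_congr {y z : L → Option α} (h : ∀ l, y l ≠ none ↔ z l ≠ none) :
    markedCoord y = markedCoord z := by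
  have : (fun l ↦ y l ≠ none) = fun l ↦ z l ≠ none := funext fun l ↦ propext (h l)
  have key : ∀ P Q : L → Prop, P = Q → (if h : ∃ l, P l then some h.choose else none) =
      if h : ∃ l, Q l then some h.choose else none := by
    rintro P _ rfl
    rfl
  exact key _ _ this

/-- Replace the letter at the marked coordinate of a block. -/
noncomputable def replaceMarked (y : L → Option α) (b : α) (l : L) : Option α :=
  if markedCoord y = some l then some b else y l

theorem markedCoord_replaceMarked (y : L → Option α) (b : α) :
    markedCoord (replaceMarked y b) = markedCoord y := by
  refine markedCoord_congr fun l ↦ ?_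
  unfold replaceMarked
  split_ifs with h
  · simpa using ne_none_of_markedCoord h
  · rfl

/-- The letter at the marked coordinate of a block, with a default value. -/
noncomputable def markedLetter (y : L → Option α) (b : α) : α :=
  (markedCoord y).elim b fun l ↦ (y l).getD b

theorem replaceMarked_replaceMarked (y : L → Option α) (b : α) :
    replaceMarked (replaceMarked y b) (markedLetter y b) = y := by
  funext l
  rw [replaceMarked, markedCoord_replaceMarked]
  split_ifs with h
  · obtain ⟨c, hc⟩ := Option.ne_none_iff_exists'.1 (ne_none_of_markedCoord h)
    simp [markedLetter, h, hc]
  · simp [replaceMarked, h]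

theorem markedLetter_replaceMarked (y : L → Option α) (b : α) :
    markedLetter (replaceMarked y b) (markedLetter y b) = b := by
  rw [markedLetter, markedCoord_replaceMarked]
  cases h : markedCoord y <;> simp [markedLetter, replaceMarked, h]

/-- Exchanging the letters at the marked coordinates with a given word is a permutation. -/
noncomputable def exchangeMarked (ι : Type) :
    Equiv.Perm ((ι → L → Option α) × (ι → α)) :=
  Function.Involutive.toPerm
    (fun p ↦ (fun j ↦ replaceMarked (p.1 j) (p.2 j), fun j ↦ markedLetter (p.1 j) (p.2 j)))
    fun p ↦ by
      ext1 <;> funext j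
      · exact replaceMarked_replaceMarked _ _
      · exact markedLetter_replaceMarked _ _

theorem avg_replaceMarked {ι : Type} [Finite ι] [Finite L] [Finite α] [Nonempty α]
    (f : (ι → L → Option α) → ℝ) :
    avg (fun x : ι → L → Option α ↦ avg fun u : ι → α ↦ f fun j ↦ replaceMarked (x j) (u j)) =
      avg f := by
  have h1 := avg_prod fun p : (ι → L → Option α) × (ι → α) ↦ f (exchangeMarked ι p).1
  have h2 := avg_prod fun p : (ι → L → Option α) × (ι → α) ↦ f p.1
  rw [avg_comp_equiv (exchangeMarked ι) fun p ↦ f p.1, h2] at h1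
  simp only [avg_const] at h1
  exact h1.symm

end blocks

theorem Insensitive.exists_line {α : Type} [Finite α] (hα : DensityHalesJewett α) (a : α) {ε : ℝ}
    (hε : 0 < ε) : ∃ (ι : Type) (_ : Finite ι), ∀ D : Set (ι → Option α), Insensitive a D →
      ε ≤ avg (fun x ↦ ind (x ∈ D)) → ∃ l : Line (Option α) ι, ∀ b, l b ∈ D := by
  obtain ⟨ι, hι, H⟩ := hα (ε / 2) (by positivity)
  let := Fintype.ofFinite ι
  let := Fintype.ofFinite α
  have : Nonempty α := ⟨a⟩
  obtain ⟨n, hn⟩ : ∃ n : ℕ, (Fintype.card ι : ℝ) / 2 ^ n < ε / 2 := by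
    obtain ⟨n, hn⟩ := pow_unbounded_of_one_lt ((Fintype.card ι : ℝ) / (ε / 2)) one_lt_two
    refine ⟨n, ?_⟩
    rw [div_lt_iff₀ (by positivity)] at hn ⊢
    linarith
  refine ⟨ι × Fin n, inferInstance, fun D hD hdens ↦ ?_⟩
  have hcurry : avg (fun x ↦ ind (x ∈ D)) =
      avg fun x : ι → Fin n → Option α ↦ ind ((fun p : ι × Fin n ↦ x p.1 p.2) ∈ D) :=
    (avg_comp_equiv (Equiv.curry ι (Fin n) (Option α)).symm _).symm
  rw [hcurry, ← avg_replaceMarked] at hdens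
  have hbad : avg (fun x : ι → Fin n → Option α ↦ ind (∃ j, markedCoord (x j) = none)) < ε / 2 := by
    refine lt_of_le_of_lt ?_ hn
    calc _ ≤ avg (fun x : ι → Fin n → Option α ↦ ∑ j, ind (x j = fun _ ↦ none)) := by
          refine avg_mono fun x ↦ ?_
          by_cases h : ∃ j, markedCoord (x j) = none
          · obtain ⟨j, hj⟩ := h
            refine (ind_le_one _).trans ?_
            rw [← ind_of_true (markedCoord_eq_none hj)]
            exact Finset.single_le_sum (f := fun j ↦ ind (x j = fun _ ↦ none))
              (fun _ _ ↦ ind_nonneg _) (Finset.mem_univ j)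
          · rw [ind_of_false h]
            exact Finset.sum_nonneg fun _ _ ↦ ind_nonneg _
      _ = ∑ _j : ι, 1 / (Fintype.card (Fin n → Option α) : ℝ) := by
          rw [avg_sum]
          refine Finset.sum_congr rfl fun j _ ↦ ?_
          rw [avg_eval j (fun y : Fin n → Option α ↦ ind (y = fun _ ↦ none)), avg_ind_eq]
      _ ≤ _ := by
          simp only [Finset.sum_const, Finset.card_univ, nsmul_eq_mul, mul_one_div]
          gcongr
          simp only [Fintype.card_pi, Finset.prod_const, Finset.card_univ, Fintype.card_fin,
            Fintype.card_option, Nat.cast_pow]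
          gcongr
          have : 0 < Fintype.card α := Fintype.card_pos
          exact_mod_cast Nat.succ_le_succ this
  obtain ⟨x, hx, hxD⟩ : ∃ x : ι → Fin n → Option α, (∀ j, markedCoord (x j) ≠ none) ∧
      ε / 2 ≤ avg fun u : ι → α ↦
        ind ((fun p : ι × Fin n ↦ replaceMarked (x p.1) (u p.1) p.2) ∈ D) := by
    by_contra! h
    have := avg_mono (f := fun x : ι → Fin n → Option α ↦ avg fun u : ι → α ↦
        ind ((fun p : ι × Fin n ↦ replaceMarked (x p.1) (u p.1) p.2) ∈ D))
        (g := fun x ↦ ind (∃ j, markedCoord (x j) = none) + ε / 2) fun x ↦ by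
      by_cases hx : ∃ j, markedCoord (x j) = none
      · rw [ind_of_true hx]
        have := avg_ind_le_one fun u : ι → α ↦
          (fun p : ι × Fin n ↦ replaceMarked (x p.1) (u p.1) p.2) ∈ D
        linarith
      · rw [ind_of_false hx, zero_add]
        exact (h x (not_exists.1 hx)).le
    rw [avg_add, avg_const] at this
    linarith
  obtain ⟨l, hl⟩ := H {u | (fun p : ι × Fin n ↦ replaceMarked (x p.1) (u p.1) p.2) ∈ D} hxD
  let l' : Line (Option α) (ι × Fin n) :=
    { idxFun := fun p ↦ if markedCoord (x p.1) = some p.2 then (l.idxFun p.1).map some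
        else some (x p.1 p.2)
      proper := by
        obtain ⟨j, hj⟩ := l.proper
        obtain ⟨t, ht⟩ := Option.ne_none_iff_exists'.1 (hx j)
        exact ⟨(j, t), by simp [ht, hj]⟩ }
  have hsome : ∀ b, l' (some b) ∈ D := by
    intro b
    have h : (fun p : ι × Fin n ↦ replaceMarked (x p.1) (l b p.1) p.2) ∈ D := hl b
    convert! h using 1
    funext p
    by_cases hp : markedCoord (x p.1) = some p.2
    · cases h : l.idxFun p.1 <;> simp [l', replaceMarked, hp, h]
    · simp [l', replaceMarked, hp]
  refine ⟨l', fun b ↦ ?_⟩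
  cases b with
  | some b => exact hsome b
  | none =>
    refine hD _ _ (fun p ↦ ?_) (hsome a)
    by_cases hp : markedCoord (x p.1) = some p.2
    · cases h : l.idxFun p.1 <;> simp [l', hp, h]
    · simp [l', hp]

theorem Insensitive.exists_subspace {α : Type} [Finite α] (hα : DensityHalesJewett α) (a : α)
    (κ : Type) [Finite κ] : ∀ {ε : ℝ}, 0 < ε → ∃ (ι : Type) (_ : Finite ι),
      ∀ D : Set (ι → Option α), Insensitive a D → ε ≤ avg (fun x ↦ ind (x ∈ D)) →
        ∃ V : Subspace κ (Option α) ι, ∀ x, V x ∈ D := by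
  induction κ using Finite.induction_empty_option with
  | of_equiv e ih =>
    intro ε hε
    obtain ⟨ι, hι, H⟩ := ih hε
    refine ⟨ι, hι, fun D hD h ↦ ?_⟩
    obtain ⟨V, hV⟩ := H D hD h
    refine ⟨V.reindex e (Equiv.refl _) (Equiv.refl _), fun x ↦ ?_⟩
    convert! hV (x ∘ e) using 1
    funext i
    simp
  | h_empty =>
    intro ε hε
    refine ⟨PEmpty, inferInstance, fun D _ h ↦ ?_⟩
    obtain ⟨x, hx⟩ := exists_of_avg_ind_pos (hε.trans_le h)
    exact ⟨⟨fun i ↦ i.elim, fun e ↦ e.elim⟩, fun y ↦ by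
      convert! hx using 1
      exact funext fun i ↦ i.elim⟩
  | h_option ih =>
    rename_i κ _
    intro ε hε
    obtain ⟨ι₁, hι₁, H₁⟩ := Insensitive.exists_line hα a (half_pos hε)
    let := Fintype.ofFinite (Line (Option α) ι₁)
    obtain ⟨ι₂, hι₂, H₂⟩ := ih
      (show 0 < ε / 2 / (Fintype.card (Line (Option α) ι₁) + 1) by positivity)
    refine ⟨ι₂ ⊕ ι₁, inferInstance, fun D hD h ↦ ?_⟩
    obtain ⟨l, hl⟩ : ∃ l : Line (Option α) ι₁, ε / 2 / (Fintype.card (Line (Option α) ι₁) + 1) ≤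
        avg fun x : ι₂ → Option α ↦ ind (x ∈ {x | ∀ b, Sum.elim x (l b) ∈ D}) := by
      refine exists_le_of_le_sum (half_pos hε) ?_
      rw [← avg_sum]
      rw [avg_sum_arrow] at h
      have := avg_mono (f := fun x : ι₂ → Option α ↦
        avg fun y : ι₁ → Option α ↦ ind (Sum.elim x y ∈ D))
        (g := fun x ↦ ∑ l : Line (Option α) ι₁, ind (x ∈ {x | ∀ b, Sum.elim x (l b) ∈ D}) + ε / 2)
        fun x ↦ by
          rcases lt_or_ge (avg fun y : ι₁ → Option α ↦ ind (Sum.elim x y ∈ D)) (ε / 2) with h' | h'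
          · have : 0 ≤ ∑ l : Line (Option α) ι₁, ind (x ∈ {x | ∀ b, Sum.elim x (l b) ∈ D}) :=
              Finset.sum_nonneg fun _ _ ↦ ind_nonneg _
            linarith
          · obtain ⟨l, hl⟩ := H₁ _ (hD.preimage_elim_right x) h'
            have h1 := Finset.single_le_sum (s := Finset.univ)
              (f := fun l : Line (Option α) ι₁ ↦ ind (x ∈ {x | ∀ b, Sum.elim x (l b) ∈ D}))
              (fun _ _ ↦ ind_nonneg _) (Finset.mem_univ l)
            have h2 : x ∈ {x | ∀ b, Sum.elim x (l b) ∈ D} := hl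
            have h3 := avg_ind_le_one fun y : ι₁ → Option α ↦ Sum.elim x y ∈ D
            simp only [ind_of_true h2] at h1
            linarith
      rw [avg_add, avg_const] at this
      linarith
    obtain ⟨V, hV⟩ := H₂ _ (Insensitive.forall_mem fun b ↦ hD.preimage_elim_left (l b)) hl
    refine ⟨⟨Sum.elim (fun i ↦ (V.idxFun i).map id some)
      fun i ↦ (l.idxFun i).elim (Sum.inr none) Sum.inl, ?_⟩, fun x ↦ ?_⟩
    · rintro (_ | e)
      · obtain ⟨i, hi⟩ := l.proper
        exact ⟨Sum.inr i, by simp [hi]⟩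
      · obtain ⟨i, hi⟩ := V.proper e
        exact ⟨Sum.inl i, by simp [hi]⟩
    · have h : Sum.elim (V fun e ↦ x (some e)) (l (x none)) ∈ D :=
        hV (fun e ↦ x (some e)) (x none)
      convert! h using 1
      funext i
      rcases i with i | i
      · cases h : V.idxFun i <;> simp [Subspace.coe_apply, h]
      · cases h : l.idxFun i <;> simp [Subspace.coe_apply, h]

theorem avg_mul_ind_range_eq {X Y : Type} [Fintype X] [Fintype Y] [Nonempty X] [Nonempty Y]
    {φ : X → Y} (hφ : Function.Injective φ) (g : Y → ℝ) :
    avg (fun y ↦ g y * ind (y ∈ Set.range φ)) =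
      Fintype.card X / Fintype.card Y * avg (fun x ↦ g (φ x)) := by
  rw [div_mul_eq_mul_div, card_mul_avg, eq_div_iff (by positivity), mul_comm, card_mul_avg]
  simp only [ind, mul_ite, mul_one, mul_zero]
  rw [← Finset.sum_filter, ← Finset.sum_image (s := Finset.univ) (g := φ) hφ.injOn]
  refine Finset.sum_congr ?_ fun _ _ ↦ rfl
  ext y
  simp

theorem avg_mul_ind_le {X : Type} [Finite X] {f : X → ℝ} (hf : ∀ x, f x ≤ 1) (p : X → Prop) :
    avg (fun x ↦ f x * ind (p x)) ≤ avg (fun x ↦ ind (p x)) :=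
  avg_mono fun x ↦ mul_le_of_le_one_left (ind_nonneg _) (hf x)

/-- A dense insensitive set in a product contains many product sets of points with a fixed
subspace. -/
theorem Insensitive.exists_subspace_dense {α ι ι₀ κ : Type} [Finite α] [Finite ι] [Finite ι₀]
    [Fintype (Subspace κ (Option α) ι₀)] {a : α} {ε : ℝ} (hε : 0 < ε)
    (H : ∀ D : Set (ι₀ → Option α), Insensitive a D → ε / 2 ≤ avg (fun x ↦ ind (x ∈ D)) →
        ∃ V : Subspace κ (Option α) ι₀, ∀ x, V x ∈ D)
    {D : Set (ι ⊕ ι₀ → Option α)} (hD : Insensitive a D) (h : ε ≤ avg (fun x ↦ ind (x ∈ D))) :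
    ∃ V : Subspace κ (Option α) ι₀, ε / 2 / (Fintype.card (Subspace κ (Option α) ι₀) + 1) ≤
      avg fun x : ι → Option α ↦ ind (∀ p, Sum.elim x (V p) ∈ D) := by
  refine exists_le_of_le_sum (half_pos hε) ?_
  rw [← avg_sum]
  rw [avg_sum_arrow] at h
  have := avg_mono (f := fun x : ι → Option α ↦
    avg fun y : ι₀ → Option α ↦ ind (Sum.elim x y ∈ D))
    (g := fun x ↦ ∑ V : Subspace κ (Option α) ι₀, ind (∀ p, Sum.elim x (V p) ∈ D) + ε / 2)
    fun x ↦ by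
      rcases lt_or_ge (avg fun y : ι₀ → Option α ↦ ind (Sum.elim x y ∈ D)) (ε / 2) with h' | h'
      · have : 0 ≤ ∑ V : Subspace κ (Option α) ι₀, ind (∀ p, Sum.elim x (V p) ∈ D) :=
          Finset.sum_nonneg fun _ _ ↦ ind_nonneg _
        linarith
      · obtain ⟨V, hV⟩ := H _ (hD.preimage_elim_right x) h'
        have h1 := Finset.single_le_sum (s := Finset.univ)
          (f := fun V : Subspace κ (Option α) ι₀ ↦ ind (∀ p, Sum.elim x (V p) ∈ D))
          (fun _ _ ↦ ind_nonneg _) (Finset.mem_univ V)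
        have h2 : ∀ p, Sum.elim x (V p) ∈ D := hV
        have h3 := avg_ind_le_one fun y : ι₀ → Option α ↦ Sum.elim x y ∈ D
        simp only [ind_of_true h2] at h1
        linarith
  rw [avg_add, avg_const] at this
  linarith

/-- If the averages of `f` over all subspaces are nonpositive, then `f` has almost nonpositive
correlation with every insensitive set. -/
theorem Insensitive.exists_avg_mul_le {α : Type} [Finite α] (hα : DensityHalesJewett α) (a : α)
    (κ : Type) [Finite κ] {ε : ℝ} (hε : 0 < ε) : ∃ (ι : Type) (_ : Finite ι),
      ∀ f : (ι → Option α) → ℝ, (∀ x, f x ≤ 1) →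
        (∀ V : Subspace κ (Option α) ι, avg (fun x ↦ f (V x)) ≤ 0) →
        ∀ D, Insensitive a D → avg (fun x ↦ f x * ind (x ∈ D)) ≤ ε := by
  obtain ⟨ι₀, hι₀, H⟩ := Insensitive.exists_subspace hα a κ (half_pos (half_pos hε))
  let := Fintype.ofFinite (Subspace κ (Option α) ι₀)
  let := Fintype.ofFinite (ι₀ → Option α)
  let := Fintype.ofFinite (κ → Option α)
  set b : ℝ := ε / 2 / 2 / (Fintype.card (Subspace κ (Option α) ι₀) + 1) with hb
  have hb0 : 0 < b := by positivity
  set c : ℝ := min (b * (1 / Fintype.card (ι₀ → Option α))) 1 with hc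
  have hc0 : 0 < c := lt_min (by positivity) one_pos
  have hc1 : c ≤ 1 := min_le_right _ _
  have key : ∀ t : ℕ, ∃ (ι : Type) (_ : Finite ι),
      ∀ f : (ι → Option α) → ℝ, (∀ x, f x ≤ 1) →
        (∀ V : Subspace κ (Option α) ι, avg (fun x ↦ f (V x)) ≤ 0) →
        ∀ D, Insensitive a D → avg (fun x ↦ f x * ind (x ∈ D)) ≤
          ε / 2 + (1 - c) ^ t * avg (fun x ↦ ind (x ∈ D)) := by
    intro t
    induction t with
    | zero =>
      refine ⟨PEmpty, inferInstance, fun f hf _ D _ ↦ ?_⟩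
      have := avg_mul_ind_le hf fun x ↦ x ∈ D
      rw [pow_zero, one_mul]
      linarith
    | succ t ih =>
      obtain ⟨ι, hι, ih⟩ := ih
      refine ⟨ι ⊕ ι₀, inferInstance, fun f hf hV D hD ↦ ?_⟩
      have hd0 : 0 ≤ avg fun x ↦ ind (x ∈ D) := avg_nonneg fun _ ↦ ind_nonneg _
      have hd1 := avg_ind_le_one fun x ↦ x ∈ D
      have hpow : 0 ≤ (1 - c) ^ t := pow_nonneg (by linarith) t
      rcases lt_or_ge (avg fun x ↦ ind (x ∈ D)) (ε / 2) with hdens | hdens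
      · have h1 := avg_mul_ind_le hf fun x ↦ x ∈ D
        have h2 : 0 ≤ (1 - c) ^ (t + 1) * avg fun x ↦ ind (x ∈ D) :=
          mul_nonneg (pow_nonneg (by linarith) _) hd0
        linarith
      obtain ⟨V, hVD⟩ := Insensitive.exists_subspace_dense (half_pos hε) H hD hdens
      set E : Set (ι → Option α) := {x | ∀ p, Sum.elim x (V p) ∈ D} with hE
      have hEins : Insensitive a E := Insensitive.forall_mem fun p ↦ hD.preimage_elim_left (V p)
      let D' : (ι₀ → Option α) → Set (ι → Option α) := fun y ↦
        {x | x ∈ {x | Sum.elim x y ∈ D} ∧ ¬(x ∈ E ∧ y ∈ Set.range V)}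
      have hsplit : ∀ x y, ind (Sum.elim x y ∈ D) =
          ind (x ∈ E) * ind (y ∈ Set.range V) + ind (x ∈ D' y) := by
        intro x y
        by_cases hxy : x ∈ E ∧ y ∈ Set.range V
        · have h1 : Sum.elim x y ∈ D := by
            obtain ⟨p, rfl⟩ := hxy.2
            exact hxy.1 p
          have h2 : x ∉ D' y := fun h ↦ h.2 hxy
          rw [ind_of_true h1, ind_of_false h2, ind_of_true hxy.1, ind_of_true hxy.2]
          norm_num
        · have h2 : x ∈ D' y ↔ Sum.elim x y ∈ D := ⟨fun h ↦ h.1, fun h ↦ ⟨h, hxy⟩⟩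
          rw [← ind_and, ind_of_false hxy, h2, zero_add]
      have hrange : ∀ x, avg (fun y ↦ f (Sum.elim x y) * ind (y ∈ Set.range V)) ≤ 0 := by
        intro x
        rw [avg_mul_ind_range_eq V.injective_toFun]
        refine mul_nonpos_of_nonneg_of_nonpos (by positivity) ?_
        simpa only [Subspace.consLeft_apply] using hV (Subspace.consLeft x V)
      have hfst : avg (fun x ↦ avg fun y ↦
          ind (x ∈ E) * (f (Sum.elim x y) * ind (y ∈ Set.range V))) ≤ 0 := by
        refine avg_le le_rfl fun x ↦ ?_
        rw [avg_const_mul]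
        exact mul_nonpos_of_nonneg_of_nonpos (ind_nonneg _) (hrange x)
      have hsnd : avg (fun y ↦ avg fun x ↦ f (Sum.elim x y) * ind (x ∈ D' y)) ≤
          ε / 2 + (1 - c) ^ t * avg fun y ↦ avg fun x ↦ ind (x ∈ D' y) := by
        rw [← avg_const_mul, ← avg_const (X := ι₀ → Option α) (ε / 2), ← avg_add]
        refine avg_mono fun y ↦ ?_
        refine ih (fun x ↦ f (Sum.elim x y)) (fun _ ↦ hf _) (fun W ↦ ?_) (D' y)
          (Insensitive.inter_imp (hD.preimage_elim_left y) hEins _)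
        simpa only [Subspace.consRight_apply] using hV (Subspace.consRight W y)
      have hcard : (1 : ℝ) / Fintype.card (ι₀ → Option α) ≤ avg fun y ↦ ind (y ∈ Set.range V) := by
        have := avg_mul_ind_range_eq V.injective_toFun fun _ ↦ 1
        simp only [one_mul, avg_const, mul_one] at this
        refine le_of_le_of_eq ?_ this.symm
        gcongr
        exact_mod_cast Fintype.card_pos (α := κ → Option α)
      have hdensD' : avg (fun y ↦ avg fun x ↦ ind (x ∈ D' y)) ≤
          (1 - c) * avg fun x ↦ ind (x ∈ D) := by
        have h1 : avg (fun x ↦ ind (x ∈ D)) = avg (fun x ↦ ind (x ∈ E)) *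
            avg (fun y ↦ ind (y ∈ Set.range V)) + avg (fun y ↦ avg fun x ↦ ind (x ∈ D' y)) := by
          rw [avg_comm fun y x ↦ ind (x ∈ D' y), avg_sum_arrow, mul_comm, ← avg_const_mul,
            ← avg_add]
          congr 1
          funext x
          rw [mul_comm, ← avg_const_mul, ← avg_add]
          simp only [hsplit]
        have h2 : c ≤ avg (fun x ↦ ind (x ∈ E)) * avg (fun y ↦ ind (y ∈ Set.range V)) := by
          refine (min_le_left _ _).trans ?_
          gcongr
          · exact avg_nonneg fun _ ↦ ind_nonneg _
          · exact hVD
        nlinarith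
      have htotal : avg (fun x ↦ f x * ind (x ∈ D)) =
          avg (fun x ↦ avg fun y ↦ ind (x ∈ E) * (f (Sum.elim x y) * ind (y ∈ Set.range V))) +
          avg (fun y ↦ avg fun x ↦ f (Sum.elim x y) * ind (x ∈ D' y)) := by
        rw [avg_comm fun y x ↦ f (Sum.elim x y) * ind (x ∈ D' y), avg_sum_arrow, ← avg_add]
        congr 1
        funext x
        rw [← avg_add]
        congr 1
        funext y
        rw [hsplit]
        ring
      rw [htotal, pow_succ, mul_assoc]
      have := mul_le_mul_of_nonneg_left hdensD' hpow
      linarith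
  obtain ⟨t, ht⟩ := exists_pow_lt_of_lt_one (half_pos hε) (show 1 - c < 1 by linarith)
  obtain ⟨ι, hι, h⟩ := key t
  refine ⟨ι, hι, fun f hf hV D hD ↦ (h f hf hV D hD).trans ?_⟩
  have hd0 : 0 ≤ avg fun x ↦ ind (x ∈ D) := avg_nonneg fun _ ↦ ind_nonneg _
  have hd1 := avg_ind_le_one fun x ↦ x ∈ D
  nlinarith

/-- If the averages of `f` over all subspaces are nonpositive, then `f` has almost nonpositive
correlation with every intersection of insensitive sets. -/
theorem Insensitive.exists_avg_mul_forall_le {α : Type} [Finite α] (hα : DensityHalesJewett α)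
    (s : Finset α) : ∀ (κ : Type) [Finite κ] {ε : ℝ}, 0 < ε → ∃ (ι : Type) (_ : Finite ι),
      ∀ f : (ι → Option α) → ℝ, (∀ x, f x ≤ 1) →
        (∀ V : Subspace κ (Option α) ι, avg (fun x ↦ f (V x)) ≤ 0) →
        ∀ D : α → Set (ι → Option α), (∀ a, Insensitive a (D a)) →
          avg (fun x ↦ f x * ind (∀ a ∈ s, x ∈ D a)) ≤ ε := by
  induction s using Finset.induction_on with
  | empty =>
    intro κ _ ε hε
    refine ⟨κ, inferInstance, fun f _ hV D _ ↦ le_trans ?_ hε.le⟩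
    have hid : ∀ x, (⟨Sum.inr, fun e ↦ ⟨e, rfl⟩⟩ : Subspace κ (Option α) κ) x = x := fun x ↦ by
      funext i; simp [Subspace.coe_apply]
    have := hV ⟨Sum.inr, fun e ↦ ⟨e, rfl⟩⟩
    simpa [hid, ind] using this
  | insert a s _ ih =>
    intro κ _ ε hε
    obtain ⟨ι', hι', H'⟩ := ih κ (half_pos hε)
    obtain ⟨ι, hι, H⟩ := Insensitive.exists_avg_mul_le hα a ι' (half_pos hε)
    refine ⟨ι, hι, fun f hf hV D hD ↦ ?_⟩
    have h := H (fun x ↦ f x * ind (∀ a ∈ s, x ∈ D a) - ε / 2) (fun x ↦ ?_) (fun W ↦ ?_) (D a)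
      (hD a)
    · have h1 : avg (fun x ↦ f x * ind (∀ b ∈ insert a s, x ∈ D b)) =
          avg (fun x ↦ (f x * ind (∀ a ∈ s, x ∈ D a) - ε / 2) * ind (x ∈ D a)) +
            ε / 2 * avg (fun x ↦ ind (x ∈ D a)) := by
        rw [← avg_const_mul, ← avg_add]
        congr 1
        funext x
        rw [Finset.forall_mem_insert, ind_and]
        ring
      have := avg_ind_le_one fun x ↦ x ∈ D a
      rw [h1]
      nlinarith
    · have h1 : f x * ind (∀ a ∈ s, x ∈ D a) ≤ 1 :=
        (mul_le_of_le_one_left (ind_nonneg _) (hf x)).trans (ind_le_one _)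
      linarith
    · rw [avg_sub, avg_const]
      refine sub_nonpos.2 (H' (fun x ↦ f (W x)) (fun _ ↦ hf _) (fun V ↦ ?_)
        (fun a ↦ {x | W x ∈ D a}) fun a ↦ (hD a).preimage_subspace W)
      simpa only [Subspace.comp_apply] using hV (W.comp V)

namespace Combinatorics.Subspace

variable {α η θ ι : Type}

/-- The word of length one more with the given first letter. -/
def consWord {β : Type} (b : β) (x : ι → β) : Option ι → β := fun o ↦ o.elim b x

/-- Turn a subspace over `Option α` into a subspace over `α` with an additional direction which
replaces the letter `none` and all directions not in the range of `g`. -/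
def absorb (V : Subspace η (Option α) ι) (g : η → Option θ) (hg : ∀ e, ∃ d, g d = some e) :
    Subspace (Option θ) α (Option ι) where
  idxFun := consWord (Sum.inr none) fun i ↦
    (V.idxFun i).elim (fun b ↦ b.elim (Sum.inr none) Sum.inl) fun d ↦ Sum.inr (g d)
  proper := by
    rintro (_ | e)
    · exact ⟨none, rfl⟩
    · obtain ⟨d, hd⟩ := hg e
      obtain ⟨i, hi⟩ := V.proper d
      exact ⟨some i, by simp [consWord, hi, hd]⟩

theorem absorb_lift (V : Subspace η (Option α) ι) (g : η → Option θ)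
    (hg : ∀ e, ∃ d, g d = some e) (c : θ → Option α) :
    (V.absorb g hg).lift (consWord none c) = consWord none (V fun d ↦ (g d).elim none c) := by
  funext i
  rcases i with _ | i
  · simp [absorb, lift, coe_apply, consWord]
  · cases h : V.idxFun i with
    | inl b => cases b <;> simp [absorb, lift, coe_apply, consWord, h]
    | inr d => simp [absorb, lift, coe_apply, consWord, h]

/-- The product of the full one-dimensional space with a subspace. -/
def consFree (V : Subspace η α ι) : Subspace (Option η) α (Option ι) where
  idxFun := consWord (Sum.inr none) fun i ↦ (V.idxFun i).map id some
  proper := by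
    rintro (_ | e)
    · exact ⟨none, rfl⟩
    · obtain ⟨i, hi⟩ := V.proper e
      exact ⟨some i, by simp [consWord, hi]⟩

theorem consFree_lift (V : Subspace η α ι) (w : Option η → Option α) :
    V.consFree.lift w = consWord (w none) (V.lift fun e ↦ w (some e)) := by
  funext i
  rcases i with _ | i
  · simp [consFree, lift, coe_apply, consWord]
  · cases h : V.idxFun i <;> simp [consFree, lift, coe_apply, consWord, h]

/-- The product of a letter with a subspace. -/
def consLetter (b : α) (V : Subspace η α ι) : Subspace η α (Option ι) where
  idxFun := consWord (Sum.inl b) V.idxFun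
  proper e := by
    obtain ⟨i, hi⟩ := V.proper e
    exact ⟨some i, hi⟩

theorem consLetter_lift (b : α) (V : Subspace η α ι) (w : η → Option α) :
    (V.consLetter b).lift w = consWord (some b) (V.lift w) := by
  funext i
  rcases i with _ | i
  · simp [consLetter, lift, coe_apply, consWord]
  · cases h : V.idxFun i <;> simp [consLetter, lift, coe_apply, consWord, h]

/-- In high dimension, given finitely many sets of words over `Option α`, there is a subspace of
dimension `μ` no word of which containing `none` belongs to any of these sets, or else one of these
sets contains a subspace whose marked direction is set to `none`. -/
theorem exists_avoiding_or_contained (α : Type) [Finite α] (μ : Type) [Finite μ] :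
    ∀ (J κ : Type) [Finite J] [Finite κ], ∃ (ι : Type) (_ : Finite ι),
      ∀ G : J → Set (ι → Option α),
        (∃ W : Subspace μ α ι, ∀ w, (∃ e, w e = none) → ∀ j, W.lift w ∉ G j) ∨
        (∃ j, ∃ U : Subspace (Option κ) α ι, ∀ c, U.lift (consWord none c) ∈ G j) := by
  induction μ using Finite.induction_empty_option with
  | of_equiv e ih =>
    intro J κ _ _
    obtain ⟨ι, hι, H⟩ := ih J κ
    refine ⟨ι, hι, fun G ↦ (H G).imp_left ?_⟩
    rintro ⟨W, hW⟩
    refine ⟨W.reindex e (Equiv.refl _) (Equiv.refl _), fun w ⟨d, hd⟩ j ↦ ?_⟩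
    have h := hW (w ∘ e) ⟨e.symm d, by simpa using hd⟩ j
    convert! h using 2
    funext i
    cases hi : W.idxFun i <;> simp [lift, coe_apply, reindex, hi]
  | h_empty =>
    intro J κ _ _
    exact ⟨PEmpty, inferInstance, fun G ↦
      Or.inl ⟨⟨fun i ↦ i.elim, fun e ↦ e.elim⟩, fun w ⟨e, _⟩ ↦ e.elim⟩⟩
  | h_option ih =>
    intro J κ _ _
    obtain ⟨ι', hι', H'⟩ := ih (J × α) κ
    obtain ⟨ι, hι, H⟩ := exists_mono_in_high_dimension (Option α) (Set J) (ι' ⊕ κ)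
    refine ⟨Option ι, inferInstance, fun G ↦ ?_⟩
    obtain ⟨V, C, hV⟩ := H fun x ↦ {j | consWord none x ∈ G j}
    rcases C.eq_empty_or_nonempty with rfl | ⟨j, hj⟩
    · let V' := V.absorb (Sum.elim some fun _ ↦ none) fun e ↦ ⟨Sum.inl e, rfl⟩
      have hV' : ∀ c j, V'.lift (consWord none c) ∉ G j := by
        intro c j h
        have hj : j ∈ (∅ : Set J) := by
          rw [← hV]
          rw [absorb_lift] at h
          exact h
        exact hj
      rcases H' fun p ↦ {c | V'.lift (consWord (some p.2) c) ∈ G p.1} with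
        ⟨W, hW⟩ | ⟨⟨j, b⟩, U, hU⟩
      · refine Or.inl ⟨V'.comp W.consFree, fun w hw j ↦ ?_⟩
        rw [comp_lift, consFree_lift]
        cases hn : w none with
        | none => exact hV' _ j
        | some b =>
          refine hW (fun e ↦ w (some e)) ?_ (j, b)
          obtain ⟨_ | e, he⟩ := hw
          · simp [hn] at he
          · exact ⟨e, he⟩
      · refine Or.inr ⟨j, V'.comp (U.consLetter b), fun c ↦ ?_⟩
        rw [comp_lift, consLetter_lift]
        exact hU c
    · refine Or.inr ⟨j, V.absorb (Sum.elim (fun _ ↦ none) some) fun e ↦ ⟨Sum.inr e, rfl⟩,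
        fun c ↦ ?_⟩
      rw [absorb_lift]
      rw [← hV] at hj
      exact hj

end Combinatorics.Subspace

namespace Combinatorics.Subspace

variable {α η ι κ : Type}

theorem consLetter_apply (b : α) (V : Subspace η α ι) (x : η → α) :
    V.consLetter b x = consWord b (V x) := by
  funext i
  rcases i with _ | i <;> simp [consLetter, coe_apply, consWord]

/-- Replace all letters `none` in a word by `some a`. -/
def fill (a : α) (v : ι → Option α) : ι → Option α := fun i ↦ some ((v i).getD a)

theorem exists_none_lift_consWord (U : Subspace (Option κ) α ι) (c : κ → Option α) :
    ∃ i, U.lift (consWord none c) i = none := by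
  obtain ⟨i, hi⟩ := U.proper none
  exact ⟨i, by simp [lift, coe_apply, hi, consWord]⟩

theorem fill_lift (U : Subspace η α ι) (a : α) (c : η → Option α) :
    fill a (U.lift c) = fun i ↦ some (U (fun e ↦ (c e).getD a) i) :=
  funext fun i ↦ congrArg some (getD_lift U c a i)

end Combinatorics.Subspace

open Combinatorics.Subspace

/-- A set of words containing no combinatorial line. -/
def LineFree {α ι : Type} (A : Set (ι → α)) : Prop := ∀ l : Line α ι, ∃ a, l a ∉ A

theorem LineFree.preimage_subspace {α η ι : Type} {A : Set (ι → α)} (hA : LineFree A)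
    (V : Subspace η α ι) : LineFree {x | V x ∈ A} := fun l ↦ by
  obtain ⟨a, ha⟩ := hA (l.mapSubspace V)
  rw [Line.mapSubspace_apply] at ha
  exact ⟨a, ha⟩

theorem LineFree.preimage_elim {α ι κ : Type} {A : Set (ι ⊕ κ → α)} (hA : LineFree A)
    (x : ι → α) : LineFree {y | Sum.elim x y ∈ A} := fun l ↦ by
  obtain ⟨a, ha⟩ := hA (l.vertical x)
  rw [Line.vertical_apply] at ha
  exact ⟨a, ha⟩

theorem LineFree.notMem_of_fill_mem {α ι κ : Type} {A : Set (ι ⊕ κ → Option α)} (hA : LineFree A)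
    {v : ι → Option α} (hv : ∃ i, v i = none) {y : κ → Option α}
    (h : ∀ a, Sum.elim (fill a v) y ∈ A) : Sum.elim v y ∉ A := by
  intro hvA
  obtain ⟨i, hi⟩ := hv
  obtain ⟨b, hb⟩ := hA ⟨Sum.elim (fun i ↦ (v i).map some) fun j ↦ some (y j),
    ⟨Sum.inl i, by simp [hi]⟩⟩
  refine hb ?_
  cases b with
  | none =>
    convert! hvA using 1
    funext j
    rcases j with j | j
    · cases hj : v j <;> simp [hj]
    · simp
  | some a =>
    convert! h a using 1
    funext j
    rcases j with j | j
    · cases hj : v j <;> simp [hj, fill]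
    · simp

/-- If `f` has small correlation with all intersections of insensitive sets, then it has small
correlation with the complement of such an intersection. -/
theorem avg_mul_one_sub_ind_le {α κ : Type} [Fintype α] [Finite κ] {f : (κ → Option α) → ℝ} {ε : ℝ}
    (h : ∀ D : α → Set (κ → Option α), (∀ a, Insensitive a (D a)) →
      avg (fun x ↦ f x * ind (∀ a ∈ Finset.univ, x ∈ D a)) ≤ ε)
    {C : α → Set (κ → Option α)} (hC : ∀ a, Insensitive a (C a)) (s : Finset α) :
    avg (fun x ↦ f x * (1 - ind (∀ a ∈ s, x ∈ C a))) ≤ s.card * ε := by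
  induction s using Finset.induction_on with
  | empty => simp [ind, avg]
  | insert a s ha ih =>
    have h1 := h (fun b ↦ if b = a then (C a)ᶜ else if b ∈ s then C b else Set.univ) fun b ↦ by
      split_ifs with h1
      · exact h1 ▸ (hC a).compl
      · exact hC b
      · exact Insensitive.univ
    have h2 : ∀ x, ind (∀ b ∈ s, x ∈ C b) - ind (∀ b ∈ insert a s, x ∈ C b) =
        ind (∀ b ∈ Finset.univ,
          x ∈ (if b = a then (C a)ᶜ else if b ∈ s then C b else Set.univ)) := by
      intro x
      have h3 : (∀ b ∈ Finset.univ,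
          x ∈ (if b = a then (C a)ᶜ else if b ∈ s then C b else Set.univ)) ↔
          (∀ b ∈ s, x ∈ C b) ∧ ¬ x ∈ C a := by
        constructor
        · intro hx
          refine ⟨fun b hb ↦ ?_, by simpa using hx a (Finset.mem_univ a)⟩
          have hba : b ≠ a := fun h ↦ ha (h ▸ hb)
          simpa [hba, hb] using hx b (Finset.mem_univ b)
        · rintro ⟨hx, hxa⟩ b -
          split_ifs with h1 h2
          · exact hxa
          · exact hx b h2
          · trivial
      rw [h3, Finset.forall_mem_insert, ind_and, ind_and, ind_not]
      ring
    have h4 : avg (fun x ↦ f x * (1 - ind (∀ b ∈ insert a s, x ∈ C b))) =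
        avg (fun x ↦ f x * (1 - ind (∀ b ∈ s, x ∈ C b))) +
          avg (fun x ↦ f x * ind (∀ b ∈ Finset.univ,
          x ∈ (if b = a then (C a)ᶜ else if b ∈ s then C b else Set.univ))) := by
      rw [← avg_add]
      congr 1
      funext x
      rw [← h2]
      ring
    rw [h4, Finset.card_insert_of_notMem ha]
    push_cast
    linarith

/-- A line-free set all of whose fibres are dense cannot avoid, for all words `w` containing
`none`, that many fibres contain all fillings of `W.lift w`. -/
theorem exists_le_avg_fill {α μ ι κ : Type} [Finite α] [Nonempty α] [Finite ι] [Finite κ]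
    [Fintype (μ → Option α)] {δ : ℝ} [Finite μ] (hδ : 0 < δ)
    (H : ∀ B : Set (μ → α), δ / 2 ≤ avg (fun x ↦ ind (x ∈ B)) → ∃ l : Line α μ, ∀ a, l a ∈ B)
    {A : Set (ι ⊕ κ → Option α)}
    (hA : ∀ x : ι → Option α, 7 * δ / 8 ≤ avg fun y ↦ ind (Sum.elim x y ∈ A))
    (W : Subspace μ α ι) : ∃ w, (∃ e, w e = none) ∧ δ / (8 * Fintype.card (μ → Option α)) ≤
      avg fun y ↦ ind (∀ a, Sum.elim (fill a (W.lift w)) y ∈ A) := by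
  by_contra! hw
  set K : ℝ := (Fintype.card (μ → Option α) : ℝ) with hK
  have hK0 : 0 < K := by rw [hK]; exact_mod_cast Fintype.card_pos
  let point : (μ → α) → ι → Option α := fun u i ↦ some (W u i)
  have h1 : 7 * δ / 8 ≤ avg fun y : κ → Option α ↦ avg fun u ↦ ind (Sum.elim (point u) y ∈ A) := by
    rw [avg_comm]
    exact (avg_const (X := μ → α) (7 * δ / 8)).symm.le.trans (avg_mono fun u ↦ hA _)
  have h2 : ∀ y : κ → Option α, avg (fun u ↦ ind (Sum.elim (point u) y ∈ A)) ≤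
      δ / 2 + ∑ w with ∃ e, w e = none, ind (∀ a, Sum.elim (fill a (W.lift w)) y ∈ A) := by
    intro y
    have h0 : 0 ≤ ∑ w with ∃ e, w e = none, ind (∀ a, Sum.elim (fill a (W.lift w)) y ∈ A) :=
      Finset.sum_nonneg fun _ _ ↦ ind_nonneg _
    rcases lt_or_ge (avg fun u ↦ ind (Sum.elim (point u) y ∈ A)) (δ / 2) with h | h
    · linarith
    obtain ⟨l, hl⟩ := H {u | Sum.elim (point u) y ∈ A} h
    have h3 : ∀ a, Sum.elim (fill a (W.lift l.idxFun)) y ∈ A := by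
      intro a
      rw [fill_lift]
      exact hl a
    have h4 := Finset.single_le_sum
      (f := fun w ↦ ind (∀ a, Sum.elim (fill a (W.lift w)) y ∈ A))
      (fun _ _ ↦ ind_nonneg _)
      (show l.idxFun ∈ Finset.univ.filter fun w : μ → Option α ↦ ∃ e, w e = none by
        simpa using l.proper)
    have h5 := avg_ind_le_one fun u ↦ Sum.elim (point u) y ∈ A
    simp only [ind_of_true h3] at h4
    linarith
  have h3 := h1.trans (avg_mono h2)
  rw [avg_add, avg_const, avg_sum] at h3
  have h4 : ∑ w with ∃ e, w e = none,
      avg (fun y : κ → Option α ↦ ind (∀ a, Sum.elim (fill a (W.lift w)) y ∈ A)) ≤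
      K * (δ / (8 * K)) := by
    refine (Finset.sum_le_card_nsmul _ _ (δ / (8 * K)) fun w hw' ↦
      (hw w (by simpa using hw')).le).trans ?_
    rw [nsmul_eq_mul]
    gcongr
    rw [hK]
    exact_mod_cast Finset.card_le_univ (α := μ → Option α) _
  have h5 : K * (δ / (8 * K)) = δ / 8 := by field_simp
  linarith

theorem le_avg_fibre {α ι κ : Type} [Finite α] [Finite ι] [Finite κ] [Fintype (ι → Option α)]
    {A : Set (ι ⊕ κ → Option α)} {δ η : ℝ}
    (hdens : δ - η ≤ avg fun x ↦ ind (x ∈ A))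
    (hle : ∀ x : ι → Option α, avg (fun y ↦ ind (Sum.elim x y ∈ A)) ≤ δ + η) (x : ι → Option α) :
    δ + η - Fintype.card (ι → Option α) * (2 * η) ≤ avg fun y ↦ ind (Sum.elim x y ∈ A) := by
  have h1 : avg (fun x : ι → Option α ↦ δ + η - avg fun y ↦ ind (Sum.elim x y ∈ A)) ≤ 2 * η := by
    rw [avg_sum_arrow] at hdens
    rw [avg_sub, avg_const]
    linarith
  have := le_of_avg_le (fun x ↦ sub_nonneg.2 (hle x)) h1 x
  linarith

theorem DensityHalesJewett.option {α : Type} [Finite α] [Nonempty α]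
    (hα : DensityHalesJewett α) : DensityHalesJewett (Option α) := by
  let Good : Set ℝ := {δ | ∃ (ι : Type) (_ : Finite ι), ∀ A : Set (ι → Option α), LineFree A →
    avg (fun x ↦ ind (x ∈ A)) < δ}
  suffices hgood : ∀ δ, 0 < δ → δ ∈ Good by
    intro δ hδ
    obtain ⟨ι, hι, H⟩ := hgood δ hδ
    refine ⟨ι, hι, fun A hA ↦ ?_⟩
    by_contra! h
    exact hA.not_gt (H A h)
  have hmono : ∀ δ ∈ Good, ∀ δ', δ ≤ δ' → δ' ∈ Good := by
    rintro δ ⟨ι, hι, H⟩ δ' h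
    exact ⟨ι, hι, fun A hA ↦ (H A hA).trans_le h⟩
  have htwo : (2 : ℝ) ∈ Good := ⟨PEmpty, inferInstance, fun A _ ↦ by
    have := avg_ind_le_one fun x ↦ x ∈ A
    linarith⟩
  by_contra! ⟨δ', hδ', hbad⟩
  set δ := sInf Good with hδdef
  have hbdd : BddBelow Good := ⟨δ', fun δ'' h ↦ by
    by_contra! hlt
    exact hbad (hmono _ h _ hlt.le)⟩
  have hδ : 0 < δ := hδ'.trans_le (le_csInf ⟨2, htwo⟩ fun δ'' h ↦ by
    by_contra! hlt
    exact hbad (hmono _ h _ hlt.le))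
  have hδ2 : δ ≤ 2 := csInf_le hbdd htwo
  have habove : ∀ η, 0 < η → δ + η ∈ Good := fun η hη ↦ by
    obtain ⟨δ'', h, hlt⟩ := exists_lt_of_csInf_lt ⟨2, htwo⟩ (show sInf Good < δ + η by linarith)
    exact hmono _ h _ hlt.le
  have hbelow : ∀ η, 0 < η → ∀ (ι : Type) [Finite ι], ∃ A : Set (ι → Option α), LineFree A ∧
      δ - η ≤ avg fun x ↦ ind (x ∈ A) := fun η hη ι hι ↦ by
    by_contra! h
    exact notMem_of_lt_csInf (show δ - η < sInf Good by linarith) hbdd ⟨ι, hι, h⟩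
  obtain ⟨μ, hμ, Hμ⟩ := hα (δ / 2) (half_pos hδ)
  let := Fintype.ofFinite α
  let := Fintype.ofFinite (μ → Option α)
  set K : ℝ := (Fintype.card (μ → Option α) : ℝ) with hK
  have hK1 : 1 ≤ K := by rw [hK]; exact_mod_cast Fintype.card_pos
  set θ : ℝ := δ / (8 * K) with hθdef
  have hθ : 0 < θ := by positivity
  have hθ1 : θ ≤ 1 := by
    rw [hθdef, div_le_one (by positivity)]
    linarith
  set η : ℝ := δ * θ / 8 with hηdef
  have hη : 0 < η := by positivity
  have hηδ : η ≤ δ / 8 := by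
    rw [hηdef]
    gcongr
    exact mul_le_of_le_one_right hδ.le hθ1
  set ε : ℝ := δ * θ / (4 * (Fintype.card α + 1)) with hεdef
  have hε : 0 < ε := by positivity
  obtain ⟨ι₁, hι₁, H₁⟩ := habove η hη
  obtain ⟨κ, hκ, Hκ⟩ := Insensitive.exists_avg_mul_forall_le hα Finset.univ ι₁ hε
  obtain ⟨m, hm, Hm⟩ := exists_avoiding_or_contained α μ Unit κ
  let := Fintype.ofFinite (m → Option α)
  set M : ℝ := (Fintype.card (m → Option α) : ℝ) with hM
  have hM1 : 1 ≤ M := by rw [hM]; exact_mod_cast Fintype.card_pos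
  have hη' : 0 < η / (2 * M) := by positivity
  obtain ⟨ι₃, hι₃, H₃⟩ := habove (η / (2 * M)) hη'
  obtain ⟨A, hA, hAdens⟩ := hbelow (η / (2 * M)) hη' (m ⊕ ι₃)
  have hfib : ∀ x : m → Option α, δ - η ≤ avg fun y ↦ ind (Sum.elim x y ∈ A) := by
    intro x
    have h1 := le_avg_fibre hAdens (fun x ↦ (H₃ _ (hA.preimage_elim x)).le) x
    have h2 : M * (2 * (η / (2 * M))) = η := by field_simp
    rw [← hM, h2] at h1
    linarith
  rcases Hm fun _ ↦ {w | θ ≤ avg fun y ↦ ind (∀ a, Sum.elim (fill a w) y ∈ A)} with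
    ⟨W, hW⟩ | ⟨-, U, hU⟩
  · obtain ⟨w, hw, hwA⟩ := exists_le_avg_fill hδ Hμ
      (fun x ↦ le_trans (by linarith) (hfib x)) W
    exact hW w hw () hwA
  let f : (ι₃ → Option α) → (κ → Option α) → ℝ := fun y c ↦
    ind (Sum.elim (U.lift (consWord none c)) y ∈ A)
  let C : (ι₃ → Option α) → α → Set (κ → Option α) := fun y a ↦
    {c | Sum.elim (fill a (U.lift (consWord none c))) y ∈ A}
  have hC : ∀ y a, Insensitive a (C y a) := by
    intro y a c c' h hc
    have hcc' : fill a (U.lift (consWord none c)) = fill a (U.lift (consWord none c')) := by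
      rw [fill_lift, fill_lift]
      have : (fun e ↦ (consWord none c e).getD a) = fun e ↦ (consWord none c' e).getD a := by
        funext e
        cases e with
        | none => rfl
        | some e => exact h e
      rw [this]
    have hc1 : Sum.elim (fill a (U.lift (consWord none c))) y ∈ A := hc
    rw [hcc'] at hc1
    exact hc1
  have hzero : ∀ y c, f y c * ind (∀ a ∈ Finset.univ, c ∈ C y a) = 0 := by
    intro y c
    by_cases h : ∀ a ∈ Finset.univ, c ∈ C y a
    · have : Sum.elim (U.lift (consWord none c)) y ∉ A :=
        hA.notMem_of_fill_mem (exists_none_lift_consWord U c) fun a ↦ h a (Finset.mem_univ a)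
      simp only [f, ind_of_false this, zero_mul]
    · rw [ind_of_false h, mul_zero]
  have hcorr : ∀ y, avg (fun c ↦ (f y c - (δ + η)) * (1 - ind (∀ a ∈ Finset.univ, c ∈ C y a))) ≤
      Fintype.card α * ε := by
    intro y
    refine avg_mul_one_sub_ind_le (fun D hD ↦ Hκ _ (fun c ↦ ?_) (fun V ↦ ?_) D hD) (hC y) _
    · have : f y c ≤ 1 := ind_le_one _
      linarith
    · rw [avg_sub, avg_const]
      have h := H₁ _ (hA.preimage_subspace (consRight (U.lift.comp (V.consLetter none)) y))
      simp only [Set.mem_ofPred_eq, consRight_apply, comp_apply, consLetter_apply] at h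
      exact sub_nonpos.2 h.le
  have hmean : δ - η ≤ avg fun y ↦ avg fun c ↦ f y c := by
    rw [avg_comm]
    exact (avg_const (X := κ → Option α) (δ - η)).symm.le.trans (avg_mono fun c ↦ hfib _)
  have hfill : θ ≤ avg fun y ↦ avg fun c ↦ ind (∀ a ∈ Finset.univ, c ∈ C y a) := by
    rw [avg_comm]
    refine (avg_const (X := κ → Option α) θ).symm.le.trans (avg_mono fun c ↦ (hU c).trans ?_)
    exact avg_mono fun y ↦ ind_mono fun h a _ ↦ h a
  have hsum : avg (fun y ↦ avg fun c ↦ f y c) - (δ + η) +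
      (δ + η) * avg (fun y ↦ avg fun c ↦ ind (∀ a ∈ Finset.univ, c ∈ C y a)) ≤
      Fintype.card α * ε := by
    rw [← avg_const_mul, ← avg_const (X := ι₃ → Option α) (δ + η), ← avg_sub, ← avg_add]
    refine avg_le (by positivity) fun y ↦ le_of_eq_of_le ?_ (hcorr y)
    rw [avg_const, ← avg_const_mul, ← avg_const (X := κ → Option α) (δ + η), ← avg_sub, ← avg_add]
    congr 1
    funext c
    rw [avg_const]
    linear_combination hzero y c
  have hkε : Fintype.card α * ε ≤ δ * θ / 4 := by
    rw [hεdef, mul_div_assoc', div_le_div_iff₀ (by positivity) (by positivity)]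
    have : 0 < δ * θ := by positivity
    nlinarith
  have := mul_le_mul_of_nonneg_left hfill (show 0 ≤ δ + η by positivity)
  nlinarith [mul_pos hη hθ, mul_pos hδ hθ]

theorem densityHalesJewett (α : Type) [Finite α] : DensityHalesJewett α := by
  refine Finite.induction_empty_option (P := fun α ↦ ∀ [Finite α], DensityHalesJewett α)
    (fun {α β} e ih hβ δ hδ ↦ ?_) (fun {_} δ _ ↦ ?_) (fun {α} _ ih {_} ↦ ?_) α
  · have := Finite.of_equiv β e.symm
    obtain ⟨ι, hι, H⟩ := ih δ hδ
    refine ⟨ι, hι, fun A hA ↦ ?_⟩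
    obtain ⟨l, hl⟩ := H {x | e ∘ x ∈ A} (hA.trans_eq
      (avg_comp_equiv (Equiv.arrowCongr (Equiv.refl ι) e) fun x ↦ ind (x ∈ A)).symm)
    refine ⟨l.map e, fun b ↦ ?_⟩
    obtain ⟨a, rfl⟩ := e.surjective b
    rw [Line.map_apply]
    exact hl a
  · exact ⟨Unit, inferInstance, fun A _ ↦ ⟨⟨fun _ ↦ none, (), rfl⟩, fun a ↦ a.elim⟩⟩
  · rcases isEmpty_or_nonempty α with hα | hα
    · intro δ hδ
      refine ⟨Unit, inferInstance, fun A h ↦ ⟨⟨fun _ ↦ none, (), rfl⟩, fun a ↦ ?_⟩⟩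
      obtain ⟨x, hx⟩ := exists_of_avg_ind_pos (hδ.trans_le h)
      convert! hx using 1
      exact Subsingleton.elim _ _
    · exact DensityHalesJewett.option ih

theorem norm_sum_range_shift_sub_le {w : ℕ → ℂ} (hw : ∀ d, ‖w d‖ ≤ 1) (L h : ℕ) :
    ‖∑ d ∈ Finset.range L, w (d + h) - ∑ d ∈ Finset.range L, w d‖ ≤ 2 * h := by
  have h1 : ∑ d ∈ Finset.range L, w (d + h) - ∑ d ∈ Finset.range L, w d =
      ∑ d ∈ Finset.range h, w (L + d) - ∑ d ∈ Finset.range h, w d := by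
    have h2 := Finset.sum_range_add w L h
    have h3 := Finset.sum_range_add w h L
    rw [add_comm h L] at h3
    simp only [add_comm h] at h3
    linear_combination h2 - h3
  rw [h1]
  refine (norm_sub_le _ _).trans ?_
  have h4 : ∀ v : ℕ → ℂ, (∀ d, ‖v d‖ ≤ 1) → ‖∑ d ∈ Finset.range h, v d‖ ≤ h := fun v hv ↦ by
    simpa using norm_sum_le_of_le (Finset.range h) (f := v) (n := fun _ ↦ 1) fun d _ ↦ hv d
  linarith [h4 (fun d ↦ w (L + d)) fun d ↦ hw _, h4 w hw]

theorem mul_norm_sum_range_le {w : ℕ → ℂ} (hw : ∀ d, ‖w d‖ ≤ 1) (L H : ℕ) :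
    H * ‖∑ d ∈ Finset.range L, w d‖ ≤
      ∑ d ∈ Finset.range L, ‖∑ h ∈ Finset.range H, w (d + h)‖ + 2 * H ^ 2 := by
  have h1 : (H : ℂ) * ∑ d ∈ Finset.range L, w d =
      ∑ d ∈ Finset.range L, ∑ h ∈ Finset.range H, w (d + h) - ∑ h ∈ Finset.range H,
        (∑ d ∈ Finset.range L, w (d + h) - ∑ d ∈ Finset.range L, w d) := by
    rw [Finset.sum_sub_distrib, Finset.sum_comm]
    simp
  have h2 : (H : ℝ) * ‖∑ d ∈ Finset.range L, w d‖ = ‖(H : ℂ) * ∑ d ∈ Finset.range L, w d‖ := by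
    simp
  rw [h2, h1]
  refine (norm_sub_le _ _).trans (add_le_add (norm_sum_le _ _) ?_)
  refine (norm_sum_le_of_le (n := fun _ ↦ 2 * (H : ℝ)) _ fun h hh ↦
    (norm_sum_range_shift_sub_le hw L h).trans ?_).trans ?_
  · have : (h : ℝ) ≤ H := by exact_mod_cast (Finset.mem_range.1 hh).le
    linarith
  · simp only [Finset.sum_const, Finset.card_range, nsmul_eq_mul]
    exact le_of_eq (by ring)

theorem norm_sq_sum_eq {J : Type} (s : Finset J) (z : J → ℂ) :
    ((‖∑ h ∈ s, z h‖ ^ 2 : ℝ) : ℂ) = ∑ h ∈ s, ∑ h' ∈ s, z h * conj (z h') := by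
  rw [Complex.ofReal_pow, ← Complex.mul_conj', map_sum, Finset.sum_mul_sum]

/-- The van der Corput inequality for a finite family of bounded sequences. -/
theorem sum_norm_sum_range_le {G : Type} [Fintype G] {w : G → ℕ → ℂ} (hw : ∀ a d, ‖w a d‖ ≤ 1)
    {L H : ℕ} (hH : 0 < H) {ε σ : ℝ} (hε : 0 ≤ ε) (hσ : 0 ≤ σ) (hεσ : 1 / H + ε ≤ σ ^ 2)
    (hcorr : ∀ h < H, ∀ h' < H, h ≠ h' →
      ‖∑ d ∈ Finset.range L, ∑ a, w a (d + h) * conj (w a (d + h'))‖ ≤ ε * (L * Fintype.card G)) :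
    ∑ a, ‖∑ d ∈ Finset.range L, w a d‖ ≤ Fintype.card G * (L * σ + 2 * H) := by
  set g : ℝ := (Fintype.card G : ℝ) with hg
  set B : ℝ := ∑ a, ∑ d ∈ Finset.range L, ‖∑ h ∈ Finset.range H, w a (d + h)‖ with hB
  have hH' : (0 : ℝ) < H := by exact_mod_cast hH
  have h1 : H * ∑ a, ‖∑ d ∈ Finset.range L, w a d‖ ≤ B + g * (2 * H ^ 2) := by
    rw [Finset.mul_sum]
    refine (Finset.sum_le_sum fun a _ ↦ mul_norm_sum_range_le (hw a) L H).trans_eq ?_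
    rw [Finset.sum_add_distrib]
    simp [hg, hB]
  have h2 : B ^ 2 ≤ g * L * ∑ a, ∑ d ∈ Finset.range L,
      ‖∑ h ∈ Finset.range H, w a (d + h)‖ ^ 2 := by
    have := sq_sum_le_card_mul_sum_sq (s := (Finset.univ : Finset G) ×ˢ Finset.range L)
      (f := fun p ↦ ‖∑ h ∈ Finset.range H, w p.1 (p.2 + h)‖)
    rw [Finset.sum_product, Finset.sum_product] at this
    simpa [hg, hB] using this
  have h3 : ∑ a, ∑ d ∈ Finset.range L, ‖∑ h ∈ Finset.range H, w a (d + h)‖ ^ 2 ≤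
      H ^ 2 * (1 / H + ε) * (L * g) := by
    have h4 : ((∑ a, ∑ d ∈ Finset.range L, ‖∑ h ∈ Finset.range H, w a (d + h)‖ ^ 2 : ℝ) : ℂ) =
        ∑ h ∈ Finset.range H, ∑ h' ∈ Finset.range H,
          ∑ d ∈ Finset.range L, ∑ a, w a (d + h) * conj (w a (d + h')) := by
      push_cast
      simp only [← Complex.ofReal_pow, norm_sq_sum_eq]
      rw [Finset.sum_comm]
      simp only [Finset.sum_comm (s := (Finset.univ : Finset G)) (t := Finset.range H)]
      rw [Finset.sum_comm]
      refine Finset.sum_congr rfl fun h _ ↦ ?_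
      rw [Finset.sum_comm]
    have h5 : ∑ a, ∑ d ∈ Finset.range L, ‖∑ h ∈ Finset.range H, w a (d + h)‖ ^ 2 ≤
        ∑ h ∈ Finset.range H, ∑ h' ∈ Finset.range H,
          ((if h = h' then L * g else 0) + ε * (L * g)) := by
      refine (le_abs_self _).trans ?_
      rw [← Real.norm_eq_abs, ← Complex.norm_real, h4]
      refine norm_sum_le_of_le _ fun h hh ↦ norm_sum_le_of_le _ fun h' hh' ↦ ?_
      have hpos : 0 ≤ ε * (L * g) := by positivity
      split_ifs with hhh
      · refine le_trans ?_ (le_add_of_nonneg_right hpos)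
        refine (norm_sum_le_of_le (n := fun _ ↦ g) _ fun d _ ↦
          (norm_sum_le_of_le (n := fun _ ↦ 1) _ fun a _ ↦ ?_).trans ?_).trans ?_
        · rw [norm_mul, RCLike.norm_conj]
          exact mul_le_one₀ (hw _ _) (norm_nonneg _) (hw _ _)
        · simp [hg]
        · simp
      · rw [zero_add]
        exact hcorr _ (Finset.mem_range.1 hh) _ (Finset.mem_range.1 hh') hhh
    refine h5.trans_eq ?_
    simp only [Finset.sum_add_distrib, Finset.sum_const, Finset.card_range, nsmul_eq_mul]
    rw [Finset.sum_congr rfl fun h hh ↦ by rw [Finset.sum_ite_eq, if_pos hh]]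
    simp only [Finset.sum_const, Finset.card_range, nsmul_eq_mul]
    field_simp
  have h6 : B ≤ g * L * H * σ := by
    refine le_of_sq_le_sq ?_ (by positivity)
    refine h2.trans ?_
    calc g * L * _ ≤ g * L * (H ^ 2 * (1 / H + ε) * (L * g)) := by gcongr
      _ = (g * L * H) ^ 2 * (1 / H + ε) := by ring
      _ ≤ (g * L * H) ^ 2 * σ ^ 2 := by gcongr
      _ = _ := by ring
  refine le_of_mul_le_mul_left (h1.trans ?_) hH'
  nlinarith

/-- A sequence all of whose `k`-fold multiplicative derivatives have averages tending to zero. -/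
def VanishingAverages : ℕ → (ℕ → ℂ) → Prop
  | 0, u => ∀ ε : ℝ, 0 < ε → ∃ L₀ : ℕ, ∀ L ≥ L₀, ‖∑ d ∈ Finset.range L, u d‖ ≤ ε * L
  | k + 1, u => ∀ h h', h ≠ h' → VanishingAverages k fun d ↦ u (d + h) * conj (u (d + h'))

theorem VanishingAverages.norm_sum_le (k : ℕ) : ∀ {u : ℕ → ℂ}, VanishingAverages k u →
    (∀ d, ‖u d‖ ≤ 1) → ∀ {ε : ℝ}, 0 < ε → ∃ L₀ : ℕ, ∀ L ≥ L₀,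
      ∀ (G : Type) [AddCommGroup G] [Fintype G] (r : G) (f : ℕ → G → ℂ), (∀ i a, ‖f i a‖ ≤ 1) →
        ‖∑ d ∈ Finset.range L, ∑ a, u d * ∏ i ∈ Finset.range (k + 1), f i (a + (i * d) • r)‖ ≤
          ε * (L * Fintype.card G) := by
  induction k with
  | zero =>
    intro u hu _ ε hε
    obtain ⟨L₀, h⟩ := hu ε hε
    refine ⟨L₀, fun L hL G _ _ r f hf ↦ ?_⟩
    have h1 : ∑ d ∈ Finset.range L, ∑ a, u d * ∏ i ∈ Finset.range (0 + 1), f i (a + (i * d) • r) =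
        (∑ d ∈ Finset.range L, u d) * ∑ a, f 0 a := by
      rw [Finset.sum_mul_sum]
      simp
    rw [h1, norm_mul, ← mul_assoc]
    refine mul_le_mul (h L hL) ?_ (norm_nonneg _) (by positivity)
    simpa using norm_sum_le_of_le Finset.univ (f := f 0) (n := fun _ ↦ 1) fun a _ ↦ hf 0 a
  | succ k ih =>
    intro u hu hu1 ε hε
    obtain ⟨H, hH⟩ := exists_nat_gt (8 / ε ^ 2)
    have hH0 : 0 < H := by
      have : (0 : ℝ) < H := lt_trans (by positivity) hH
      exact_mod_cast this
    have hstep : ∀ p : ℕ × ℕ, p.1 ≠ p.2 → ∃ L₀ : ℕ, ∀ L ≥ L₀,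
        ∀ (G : Type) [AddCommGroup G] [Fintype G] (r : G) (f : ℕ → G → ℂ), (∀ i a, ‖f i a‖ ≤ 1) →
          ‖∑ d ∈ Finset.range L, ∑ a, (u (d + p.1) * conj (u (d + p.2))) *
            ∏ i ∈ Finset.range (k + 1), f i (a + (i * d) • r)‖ ≤
            ε ^ 2 / 8 * (L * Fintype.card G) := fun p hp ↦
      ih (hu p.1 p.2 hp) (fun d ↦ by
        rw [norm_mul, RCLike.norm_conj]
        exact mul_le_one₀ (hu1 _) (norm_nonneg _) (hu1 _)) (by positivity)
    choose! L₀ hL₀ using hstep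
    obtain ⟨L₁, hL₁⟩ := exists_nat_gt (4 * H / ε)
    refine ⟨max L₁ ((Finset.range H ×ˢ Finset.range H).sup L₀), fun L hL G _ _ r f hf ↦ ?_⟩
    let w : G → ℕ → ℂ := fun a d ↦
      u d * ∏ i ∈ Finset.range (k + 1), f (i + 1) (a + ((i + 1) * d) • r)
    have hprod : ∀ (s : Finset ℕ) (v : ℕ → ℂ), (∀ i, ‖v i‖ ≤ 1) → ‖∏ i ∈ s, v i‖ ≤ 1 :=
      fun s v hv ↦ (Finset.norm_prod_le _ _).trans
        (Finset.prod_le_one (fun _ _ ↦ norm_nonneg _) fun i _ ↦ hv i)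
    have hw : ∀ a d, ‖w a d‖ ≤ 1 := fun a d ↦ by
      rw [norm_mul]
      exact mul_le_one₀ (hu1 _) (norm_nonneg _) (hprod _ _ fun i ↦ hf _ _)
    have hvdc := sum_norm_sum_range_le hw (L := L) hH0 (ε := ε ^ 2 / 8) (σ := ε / 2)
      (by positivity) (by positivity) ?_ fun h hh h' hh' hne ↦ ?_
    · have h1 : ∑ d ∈ Finset.range L, ∑ a, u d *
          ∏ i ∈ Finset.range (k + 1 + 1), f i (a + (i * d) • r) =
          ∑ a, f 0 a * ∑ d ∈ Finset.range L, w a d := by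
        rw [Finset.sum_comm]
        refine Finset.sum_congr rfl fun a _ ↦ ?_
        rw [Finset.mul_sum]
        refine Finset.sum_congr rfl fun d _ ↦ ?_
        rw [Finset.prod_range_succ']
        simp only [w, zero_mul, zero_smul, add_zero]
        ring
      rw [h1]
      have h2 : ‖∑ a, f 0 a * ∑ d ∈ Finset.range L, w a d‖ ≤
          ∑ a, ‖∑ d ∈ Finset.range L, w a d‖ := norm_sum_le_of_le _ fun a _ ↦ by
        rw [norm_mul]
        exact mul_le_of_le_one_left (norm_nonneg _) (hf 0 a)
      refine h2.trans (hvdc.trans ?_)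
      have h3 : 4 * H / ε < L := hL₁.trans_le (by exact_mod_cast (le_max_left _ _).trans hL)
      rw [div_lt_iff₀ hε] at h3
      have h4 : (0 : ℝ) ≤ Fintype.card G := by positivity
      nlinarith
    · have h1 : 1 / (H : ℝ) ≤ ε ^ 2 / 8 := by
        rw [div_lt_iff₀ (by positivity)] at hH
        rw [div_le_iff₀ (by exact_mod_cast hH0)]
        linarith
      nlinarith
    · have h1 := hL₀ (h, h') hne L
        ((Finset.le_sup (f := L₀) (b := (h, h')) (by simp [hh, hh'])).trans
        ((le_max_right _ _).trans hL)) G r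
        (fun i b ↦ f (i + 1) (b + ((i + 1) * h) • r) * conj (f (i + 1) (b + ((i + 1) * h') • r)))
        fun i b ↦ by
          rw [norm_mul, RCLike.norm_conj]
          exact mul_le_one₀ (hf _ _) (norm_nonneg _) (hf _ _)
      refine le_of_eq_of_le ?_ h1
      congr 1
      refine Finset.sum_congr rfl fun d _ ↦ ?_
      refine Fintype.sum_equiv (Equiv.addRight (d • r)) _ _ fun a ↦ ?_
      simp only [w, map_mul, map_prod, Equiv.coe_addRight, Finset.prod_mul_distrib]
      have h2 : ∀ i t : ℕ, a + ((i + 1) * (d + t)) • r =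
          a + d • r + (i * d) • r + ((i + 1) * t) • r := fun i t ↦ by
        simp only [add_smul, mul_add, add_mul, one_mul]
        abel
      simp only [h2]
      ring

/-- The character `x ↦ exp (2 π i x)`. -/
noncomputable def phase (x : ℝ) : ℂ := Complex.exp ((2 * Real.pi * x : ℝ) * Complex.I)

theorem norm_phase (x : ℝ) : ‖phase x‖ = 1 := Complex.norm_exp_ofReal_mul_I _

theorem phase_add (x y : ℝ) : phase (x + y) = phase x * phase y := by
  rw [phase, phase, phase, ← Complex.exp_add]
  push_cast
  ring_nf

theorem phase_mul_conj_phase (x y : ℝ) : phase x * conj (phase y) = phase (x - y) := by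
  rw [phase, phase, phase, ← Complex.exp_conj, ← Complex.exp_add]
  simp only [map_mul, Complex.conj_ofReal, Complex.conj_I]
  push_cast
  ring_nf

theorem phase_re (x : ℝ) : (phase x).re = Real.cos (2 * Real.pi * x) :=
  Complex.exp_ofReal_mul_I_re _

theorem phase_natCast_mul (d : ℕ) (x : ℝ) : phase (d * x) = phase x ^ d := by
  rw [phase, phase, ← Complex.exp_nat_mul]
  push_cast
  ring_nf

theorem phase_ne_one {x : ℝ} (hx : Irrational x) : phase x ≠ 1 := by
  intro h
  obtain ⟨n, hn⟩ := Complex.exp_eq_one_iff.1 h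
  have h1 : ((2 * Real.pi * x : ℝ) : ℂ) = ((n * (2 * Real.pi) : ℝ) : ℂ) := by
    have := Complex.I_ne_zero
    refine mul_right_cancel₀ this ?_
    rw [hn]
    push_cast
    ring
  have h2 := Complex.ofReal_injective h1
  refine hx ⟨n, ?_⟩
  have := Real.pi_pos
  push_cast
  refine mul_left_cancel₀ (show 2 * Real.pi ≠ 0 by positivity) ?_
  linarith

theorem fwdDiff_eq_const_apply {q : ℕ → ℝ} {γ : ℝ} (hq : ∀ d, Δ_[1] q d = γ) (d : ℕ) :
    q d = q 0 + d * γ := by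
  induction d with
  | zero => simp
  | succ d ih =>
    have := hq d
    rw [fwdDiff] at this
    push_cast
    linarith

/-- Polynomial phases with irrational leading coefficient have vanishing averages. -/
theorem vanishingAverages_phase (k : ℕ) : ∀ {q : ℕ → ℝ} {γ : ℝ}, Irrational γ →
    (∀ d, (Δ_[1])^[k + 1] q d = γ) → VanishingAverages k fun d ↦ phase (q d) := by
  induction k with
  | zero =>
    intro q γ hγ hq ε hε
    have hne : phase γ - 1 ≠ 0 := sub_ne_zero.2 (phase_ne_one hγ)
    obtain ⟨L₀, hL₀⟩ := exists_nat_gt (2 / ‖phase γ - 1‖ / ε)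
    refine ⟨L₀, fun L hL ↦ ?_⟩
    have h1 : ∑ d ∈ Finset.range L, phase (q d) =
        phase (q 0) * ((phase γ ^ L - 1) / (phase γ - 1)) := by
      rw [← geom_sum_eq (phase_ne_one hγ), Finset.mul_sum]
      refine Finset.sum_congr rfl fun d _ ↦ ?_
      rw [fwdDiff_eq_const_apply hq d, phase_add, phase_natCast_mul]
    rw [h1, norm_mul, norm_phase, one_mul, norm_div]
    have h2 : ‖phase γ ^ L - 1‖ ≤ 2 := by
      refine (norm_sub_le _ _).trans ?_
      rw [norm_pow, norm_phase, one_pow, norm_one]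
      norm_num
    have h3 : 2 / ‖phase γ - 1‖ / ε ≤ L := hL₀.le.trans (by exact_mod_cast hL)
    rw [div_le_iff₀ hε] at h3
    rw [mul_comm]
    exact le_trans (by gcongr) h3
  | succ k ih =>
    intro q γ hγ hq h h' hne
    simp only [phase_mul_conj_phase]
    have hne' : (h : ℤ) - h' ≠ 0 := sub_ne_zero.2 (by exact_mod_cast hne)
    refine ih (hγ.intCast_mul hne') fun d ↦ ?_
    have h1 : (fun d ↦ q (d + h) - q (d + h')) =
        (fun d ↦ q (d + h)) + (-1 : ℝ) • fun d ↦ q (d + h') := by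
      funext d
      simp [sub_eq_add_neg]
    have h2 : ∀ d, (Δ_[1])^[k + 1] q d = (Δ_[1])^[k + 1] q 0 + d * γ :=
      fwdDiff_eq_const_apply fun d ↦
        (congrFun (Function.iterate_succ_apply' _ _ _) d).symm.trans (hq d)
    rw [h1, fwdDiff_iter_add, fwdDiff_iter_const_smul, Pi.add_apply, Pi.smul_apply,
      fwdDiff_iter_comp_add, fwdDiff_iter_comp_add, h2 (d + h), h2 (d + h'), smul_eq_mul]
    push_cast
    ring

theorem fwdDiff_iter_const_mul_pow (c : ℝ) (k d : ℕ) :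
    (Δ_[1])^[k] (fun d : ℕ ↦ c * (d : ℝ) ^ k) d = c * k.factorial := by
  have h := congrFun (fwdDiff_iter_eq_factorial (R := ℝ) (n := k)) d
  rw [fwdDiff_iter_eq_sum_shift] at h ⊢
  have h1 : (k.factorial : ℝ → ℝ) (d : ℝ) = k.factorial := rfl
  rw [h1] at h
  rw [← h, Finset.mul_sum]
  refine Finset.sum_congr rfl fun i _ ↦ ?_
  simp only [zsmul_eq_mul, smul_eq_mul, nsmul_eq_mul, mul_one]
  push_cast
  ring

namespace Combinatorics.Line

variable {k : ℕ} {ι : Type} [Fintype ι]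

/-- The number of variable coordinates of a line. -/
noncomputable def freeCard (l : Line (Fin k) ι) : ℕ :=
  (Finset.univ.filter fun j ↦ l.idxFun j = none).card

theorem freeCard_pos (l : Line (Fin k) ι) : 0 < l.freeCard := by
  obtain ⟨j, hj⟩ := l.proper
  exact Finset.card_pos.2 ⟨j, by simpa using hj⟩

theorem freeCard_le (l : Line (Fin k) ι) : l.freeCard ≤ Fintype.card ι := Finset.card_le_univ _

/-- The sum of the constant coordinates of a line. -/
noncomputable def fixedSum (l : Line (Fin k) ι) : ℕ :=
  ∑ j, (l.idxFun j).elim 0 fun b ↦ (b : ℕ)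

theorem sum_apply (l : Line (Fin k) ι) (i : Fin k) :
    ∑ j, (l i j : ℕ) = l.fixedSum + l.freeCard * i := by
  have h : l.freeCard * i = ∑ j, if l.idxFun j = none then (i : ℕ) else 0 := by
    rw [← Finset.sum_filter, Finset.sum_const, smul_eq_mul, freeCard]
  rw [h, fixedSum, ← Finset.sum_add_distrib]
  refine Finset.sum_congr rfl fun j _ ↦ ?_
  cases hj : l.idxFun j <;> simp [hj]

end Combinatorics.Line

theorem prod_range_ind (n : ℕ) (p : ℕ → Prop) :
    ∏ i ∈ Finset.range n, ind (p i) = ind (∀ i < n, p i) := by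
  simp [ind, Finset.prod_ite_zero]

/-- The density of the set of starting points of progressions of length `k` and difference `n • g`
in `A`. -/
noncomputable def progDensity {G : Type} [AddCommGroup G] [Finite G] (A : Set G) (g : G)
    (k n : ℕ) : ℝ :=
  avg fun t : G ↦ ind (∀ i < k, t + (i * n) • g ∈ A)

section progDensity

variable {G : Type} [AddCommGroup G] {A : Set G} {g : G}

theorem progDensity_nonneg [Finite G] (A : Set G) (g : G) (k n : ℕ) : 0 ≤ progDensity A g k n :=
  avg_nonneg fun _ ↦ ind_nonneg _

theorem half_le_sum_progDensity [Finite G] {k : ℕ} {ι : Type} [Fintype ι]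
    [Fintype (Line (Fin k) ι)] {δ : ℝ} (hδ : 0 < δ) (hk : 0 < k)
    (H : ∀ B : Set (ι → Fin k), δ / 2 ≤ avg (fun x ↦ ind (x ∈ B)) →
      ∃ l : Line (Fin k) ι, ∀ a, l a ∈ B)
    (hA : δ ≤ avg fun x ↦ ind (x ∈ A)) (d : ℕ) :
    δ / 2 ≤ ∑ l : Line (Fin k) ι, progDensity A g k (l.freeCard * d) := by
  have : NeZero k := ⟨hk.ne'⟩
  have h1 : δ ≤ avg fun t : G ↦ avg fun x : ι → Fin k ↦
      ind (t + ((∑ j, (x j : ℕ)) * d) • g ∈ A) := by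
    rw [avg_comm]
    refine (avg_const (X := ι → Fin k) δ).symm.le.trans (avg_mono fun x ↦ hA.trans_eq ?_)
    exact (avg_comp_equiv (Equiv.addRight (((∑ j, (x j : ℕ)) * d) • g)) fun x ↦ ind (x ∈ A)).symm
  have h2 : ∀ t : G, avg (fun x : ι → Fin k ↦ ind (t + ((∑ j, (x j : ℕ)) * d) • g ∈ A)) ≤
      δ / 2 + ∑ l : Line (Fin k) ι,
        ind (∀ i < k, t + (l.fixedSum * d) • g + (i * (l.freeCard * d)) • g ∈ A) := by
    intro t
    have h0 : 0 ≤ ∑ l : Line (Fin k) ι,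
        ind (∀ i < k, t + (l.fixedSum * d) • g + (i * (l.freeCard * d)) • g ∈ A) :=
      Finset.sum_nonneg fun _ _ ↦ ind_nonneg _
    rcases lt_or_ge (avg fun x : ι → Fin k ↦ ind (t + ((∑ j, (x j : ℕ)) * d) • g ∈ A))
      (δ / 2) with h | h
    · linarith
    obtain ⟨l, hl⟩ := H {x | t + ((∑ j, (x j : ℕ)) * d) • g ∈ A} h
    have h3 : ∀ i < k, t + (l.fixedSum * d) • g + (i * (l.freeCard * d)) • g ∈ A := by
      intro i hi
      have h4 : t + ((∑ j, (l ⟨i, hi⟩ j : ℕ)) * d) • g ∈ A := hl ⟨i, hi⟩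
      rw [Line.sum_apply, add_mul, add_smul, ← add_assoc] at h4
      convert! h4 using 3
      ring
    have h4 := Finset.single_le_sum (f := fun l : Line (Fin k) ι ↦
      ind (∀ i < k, t + (l.fixedSum * d) • g + (i * (l.freeCard * d)) • g ∈ A))
      (fun _ _ ↦ ind_nonneg _) (Finset.mem_univ l)
    have h5 := avg_ind_le_one fun x : ι → Fin k ↦ t + ((∑ j, (x j : ℕ)) * d) • g ∈ A
    simp only [ind_of_true h3] at h4
    linarith
  have h3 := h1.trans (avg_mono h2)
  rw [avg_add, avg_const, avg_sum] at h3
  have h4 : ∀ l : Line (Fin k) ι, avg (fun t : G ↦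
      ind (∀ i < k, t + (l.fixedSum * d) • g + (i * (l.freeCard * d)) • g ∈ A)) =
      progDensity A g k (l.freeCard * d) := fun l ↦
    avg_comp_equiv (Equiv.addRight ((l.fixedSum * d) • g)) fun t ↦
      ind (∀ i < k, t + (i * (l.freeCard * d)) • g ∈ A)
  simp only [h4] at h3
  linarith

theorem norm_sum_phase_mul_progDensity_le {k : ℕ} {c : ℝ} (hc : Irrational c) {r : ℕ} (hr : 0 < r)
    {ε : ℝ} (hε : 0 < ε) : ∃ L₀ : ℕ, ∀ L ≥ L₀, ∀ (G : Type) [AddCommGroup G] [Fintype G]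
      (A : Set G) (g : G), ‖∑ d ∈ Finset.range L, phase (c * ((r * d : ℕ) : ℝ) ^ (k + 1)) *
        progDensity A g (k + 1) (r * d)‖ ≤ ε * L := by
  have hirr : Irrational (c * r ^ (k + 1) * (k + 1).factorial) := by
    have := (hc.mul_natCast (pow_pos hr (k + 1)).ne').mul_natCast (k + 1).factorial_ne_zero
    exact_mod_cast this
  obtain ⟨L₀, h⟩ := (vanishingAverages_phase k hirr fun d ↦
    fwdDiff_iter_const_mul_pow (c * r ^ (k + 1)) (k + 1) d).norm_sum_le k
      (fun d ↦ (norm_phase _).le) hε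
  refine ⟨L₀, fun L hL G _ _ A g ↦ ?_⟩
  have h1 := h L hL G (r • g) (fun _ a ↦ (ind (a ∈ A) : ℂ)) fun _ a ↦ by
    rw [Complex.norm_real, Real.norm_eq_abs, abs_of_nonneg (ind_nonneg _)]
    exact ind_le_one _
  have hG : (0 : ℝ) < Fintype.card G := by exact_mod_cast Fintype.card_pos
  have h2 : ∑ d ∈ Finset.range L, ∑ a, phase (c * r ^ (k + 1) * (d : ℝ) ^ (k + 1)) *
      ∏ i ∈ Finset.range (k + 1), (ind (a + (i * d) • r • g ∈ A) : ℂ) =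
      (Fintype.card G : ℝ) * ∑ d ∈ Finset.range L, phase (c * ((r * d : ℕ) : ℝ) ^ (k + 1)) *
        progDensity A g (k + 1) (r * d) := by
    rw [Finset.mul_sum]
    refine Finset.sum_congr rfl fun d _ ↦ ?_
    rw [← Finset.mul_sum, mul_left_comm, progDensity, ← Complex.ofReal_mul, card_mul_avg,
      Complex.ofReal_sum]
    congr 2
    · push_cast
      ring_nf
    · funext a
      rw [← Complex.ofReal_prod, prod_range_ind]
      simp only [smul_smul, mul_right_comm, mul_assoc, mul_comm r]
  rw [h2, norm_mul, Complex.norm_real, Real.norm_eq_abs, abs_of_pos hG] at h1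
  refine le_of_mul_le_mul_left (h1.trans_eq ?_) hG
  ring

/-- Dense subsets of finite abelian groups contain progressions of length `k + 1` whose difference
is a multiple `n • g`, with `n` bounded and `c * n ^ (k + 1)` far from the integers. -/
theorem exists_progression_of_dense {k : ℕ} {c : ℝ} (hc : Irrational c) {δ : ℝ} (hδ : 0 < δ) :
    ∃ n₀ : ℕ, ∀ (G : Type) [AddCommGroup G] [Fintype G] (A : Set G) (g : G),
      δ ≤ avg (fun x ↦ ind (x ∈ A)) →
        ∃ n ≤ n₀, Real.cos (2 * Real.pi * (c * (n : ℝ) ^ (k + 1))) < 1 / 2 ∧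
          ∃ a, ∀ i < k + 1, a + (i * n) • g ∈ A := by
  obtain ⟨ι, hι, H⟩ := densityHalesJewett (Fin (k + 1)) (δ / 2) (half_pos hδ)
  let := Fintype.ofFinite ι
  let := Fintype.ofFinite (Line (Fin (k + 1)) ι)
  set m : ℝ := (Fintype.card (Line (Fin (k + 1)) ι) : ℝ) with hm
  have hε : 0 < δ / (8 * (m + 1)) := by positivity
  choose L₀ hL₀ using fun l : Line (Fin (k + 1)) ι ↦
    norm_sum_phase_mul_progDensity_le (k := k) hc l.freeCard_pos hε
  set L := Finset.univ.sup L₀ + 1 with hL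
  refine ⟨Fintype.card ι * L, fun G _ _ A g hA ↦ ?_⟩
  by_contra! hno
  have hsign : ∀ n ≤ Fintype.card ι * L,
      (1 / 2 - (phase (c * (n : ℝ) ^ (k + 1))).re) * progDensity A g (k + 1) n ≤ 0 := by
    intro n hn
    rw [phase_re]
    rcases lt_or_ge (Real.cos (2 * Real.pi * (c * (n : ℝ) ^ (k + 1)))) (1 / 2) with h | h
    · have h0 : progDensity A g (k + 1) n ≤ 0 := avg_le le_rfl fun t ↦ by
        obtain ⟨i, hi, hiA⟩ := hno n hn h t
        exact (ind_of_false fun hall ↦ hiA (hall i hi)).le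
      exact mul_nonpos_of_nonneg_of_nonpos (by linarith) h0
    · exact mul_nonpos_of_nonpos_of_nonneg (by linarith) (progDensity_nonneg _ _ _ _)
  have hmain : (L : ℝ) * (δ / 2) ≤
      ∑ l : Line (Fin (k + 1)) ι,
        ∑ d ∈ Finset.range L, progDensity A g (k + 1) (l.freeCard * d) := by
    rw [Finset.sum_comm]
    have := Finset.card_nsmul_le_sum (Finset.range L) (fun d ↦ ∑ l : Line (Fin (k + 1)) ι,
      progDensity A g (k + 1) (l.freeCard * d)) (δ / 2) fun d _ ↦
        half_le_sum_progDensity hδ k.succ_pos H hA d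
    simpa using this
  have hline : ∀ l : Line (Fin (k + 1)) ι, (1 / 2) * ∑ d ∈ Finset.range L,
      progDensity A g (k + 1) (l.freeCard * d) ≤ δ / (8 * (m + 1)) * L := by
    intro l
    have h1 := hL₀ l L ((Finset.le_sup (Finset.mem_univ l)).trans (Nat.le_succ _)) G A g
    have h2 := (Complex.re_le_norm _).trans h1
    rw [Complex.re_sum] at h2
    have h3 : ∑ d ∈ Finset.range L,
        (1 / 2 - (phase (c * ((l.freeCard * d : ℕ) : ℝ) ^ (k + 1))).re) *
        progDensity A g (k + 1) (l.freeCard * d) ≤ 0 := Finset.sum_nonpos fun d hd ↦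
      hsign _ (Nat.mul_le_mul l.freeCard_le (Finset.mem_range.1 hd).le)
    simp only [sub_mul, Finset.sum_sub_distrib, ← Finset.mul_sum] at h3
    simp only [Complex.re_mul_ofReal] at h2
    linarith
  have hsum := Finset.sum_le_card_nsmul Finset.univ _ _ fun l _ ↦ hline l
  rw [← Finset.mul_sum, nsmul_eq_mul, Finset.card_univ, ← hm] at hsum
  have hLpos : (0 : ℝ) < L := by rw [hL]; positivity
  have h1 : m * (δ / (8 * (m + 1)) * L) ≤ δ / 8 * L := by
    have : m / (m + 1) ≤ 1 := (div_le_one (by positivity)).2 (by linarith)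
    calc _ = m / (m + 1) * (δ / 8 * L) := by field_simp
      _ ≤ _ := mul_le_of_le_one_left (by positivity) this
  have : 0 < δ * L := by positivity
  nlinarith

end progDensity

/-- A set dense in a window `[M, M + L)` becomes a dense subset of `ZMod (2 * L)`. -/
theorem le_avg_window {Λ : Set ℤ} {δ : ℝ} {M : ℤ} {L : ℕ} [NeZero (2 * L)] (hL : 0 < L)
    (h : δ * L ≤ ((Finset.Ico M (M + L)).filter (fun x => x ∈ Λ)).card) :
    δ / 2 ≤ avg fun x : ZMod (2 * L) ↦
      ind (x ∈ {x : ZMod (2 * L) | x.val < L ∧ M + x.val ∈ Λ}) := by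
  set A : Set (ZMod (2 * L)) := {x : ZMod (2 * L) | x.val < L ∧ M + x.val ∈ Λ} with hA
  have h1 := card_mul_avg fun x : ZMod (2 * L) ↦ ind (x ∈ A)
  have h2 : ∑ x : ZMod (2 * L), ind (x ∈ A) = (Finset.univ.filter fun x ↦ x ∈ A).card := by
    rw [Finset.card_filter, Nat.cast_sum]
    refine Finset.sum_congr rfl fun x _ ↦ ?_
    simp [ind]
  have h3 : ((Finset.Ico M (M + L)).filter (fun x => x ∈ Λ)).card ≤
      (Finset.univ.filter fun x ↦ x ∈ A).card := by
    have hval : ∀ m ∈ Finset.Ico M (M + L),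
        ((m - M).toNat : ZMod (2 * L)).val = (m - M).toNat := by
      intro m hm
      rw [Finset.mem_Ico] at hm
      exact ZMod.val_natCast_of_lt (by omega)
    refine Finset.card_le_card_of_injOn (fun m ↦ ((m - M).toNat : ZMod (2 * L))) ?_ ?_
    · intro m hm
      have hm' := Finset.mem_filter.1 (Finset.mem_coe.1 hm)
      have hb := Finset.mem_Ico.1 hm'.1
      have hm2 : M + ((m - M).toNat : ℤ) = m := by omega
      simp only [Finset.coe_filter, Finset.mem_univ, true_and, hA, Set.mem_ofPred_eq,
        hval m hm'.1, hm2]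
      exact ⟨by omega, hm'.2⟩
    · intro m hm m' hm' he
      have hm := (Finset.mem_filter.1 (Finset.mem_coe.1 hm)).1
      have hm' := (Finset.mem_filter.1 (Finset.mem_coe.1 hm')).1
      have h := congrArg ZMod.val he
      simp only [hval m hm, hval m' hm'] at h
      rw [Finset.mem_Ico] at hm hm'
      omega
  have h4 : (((Finset.Ico M (M + L)).filter (fun x => x ∈ Λ)).card : ℝ) ≤
      (Finset.univ.filter fun x ↦ x ∈ A).card := by exact_mod_cast h3
  rw [h2, ZMod.card] at h1
  push_cast at h1
  have hL' : (0 : ℝ) < L := by exact_mod_cast hL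
  refine le_of_mul_le_mul_left ?_ (show (0 : ℝ) < 2 * L by positivity)
  linarith

theorem isKIntersective_cos_lt_half (k : ℕ) {c : ℝ} (hc : Irrational c) :
    IsKIntersective k {n | Real.cos (2 * Real.pi * (c * (n : ℝ) ^ (k + 1))) < 1 / 2} := by
  rintro Λ ⟨δ, hδ, hΛ⟩
  obtain ⟨n₀, hn₀⟩ := exists_progression_of_dense (k := k) hc (half_pos hδ)
  obtain ⟨M, N, hMN, h⟩ := hΛ (k * n₀ + 1)
  obtain ⟨L, rfl⟩ : ∃ L : ℕ, N = M + L :=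
    ⟨(N - M).toNat, by have := Int.natCast_nonneg (k * n₀ + 1); omega⟩
  have hL : k * n₀ + 1 ≤ L := by exact_mod_cast (add_le_add_iff_left M).1 hMN
  have : NeZero (2 * L) := ⟨by omega⟩
  obtain ⟨n, hn, hcos, a, ha⟩ := hn₀ (ZMod (2 * L)) _ 1
    (le_avg_window (Λ := Λ) (M := M) (L := L) (by omega) (by simpa using h))
  refine ⟨M + a.val, n, hcos, fun i hi ↦ ?_⟩
  have h0 : a.val < L := by simpa using (ha 0 (by omega)).1
  have hin : i * n ≤ k * n₀ := Nat.mul_le_mul hi hn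
  have hval : (a + (i * n) • (1 : ZMod (2 * L))).val = a.val + i * n := by
    have : a + (i * n) • (1 : ZMod (2 * L)) = ((a.val + i * n : ℕ) : ZMod (2 * L)) := by
      simp
    rw [this, ZMod.val_natCast_of_lt (by omega)]
  have := (ha i (by omega)).2
  rw [hval] at this
  push_cast at this
  rwa [add_assoc]

/-- One of the classes of a finite colouring of the integers has positive density. -/
theorem exists_hasPosUpperBanachDensity_fiber {T : ℕ} [NeZero T] (f : ℤ → Fin T) :
    ∃ t, HasPosUpperBanachDensity {m | f m = t} := by
  by_contra! hcon
  have hT : (0 : ℝ) < T := by exact_mod_cast NeZero.pos T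
  have h : ∀ t, ∃ K : ℕ, ∀ M N : ℤ, M + K ≤ N →
      (((Finset.Ico M N).filter fun x => x ∈ {m | f m = t}).card : ℝ) < 1 / T * ((N : ℝ) - M) := by
    intro t
    have := hcon t
    simp only [HasPosUpperBanachDensity] at this
    push Not at this
    obtain ⟨K, hK⟩ := this (1 / T) (by positivity)
    exact ⟨K, fun M N hMN ↦ by convert! hK M N hMN⟩
  choose K hK using h
  set L := ∑ t, K t
  have h1 : ∀ t, (((Finset.Ico 0 (L : ℤ)).filter fun x => x ∈ {m | f m = t}).card : ℝ) <
      1 / T * L := fun t ↦ by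
    have := hK t 0 L (by
      have := Finset.single_le_sum (f := K) (fun _ _ ↦ Nat.zero_le _) (Finset.mem_univ t)
      rw [zero_add]; exact_mod_cast this)
    simpa using this
  have h2 := Finset.sum_lt_sum_of_nonempty (s := (Finset.univ : Finset (Fin T)))
    Finset.univ_nonempty fun t _ ↦ h1 t
  have h3 := Finset.card_eq_sum_card_fiberwise (f := f) (s := Finset.Ico 0 (L : ℤ))
    (t := Finset.univ) fun _ _ ↦ Finset.mem_coe.2 (Finset.mem_univ _)
  simp only [Set.mem_ofPred_eq, Finset.sum_const, Finset.card_univ, Fintype.card_fin,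
    nsmul_eq_mul] at h2
  rw [← Nat.cast_sum, ← h3, Int.card_Ico, ← mul_assoc, mul_one_div_cancel hT.ne'] at h2
  simp at h2

theorem sum_alternating_choose_mul_pow (k : ℕ) (a : ℝ) {n : ℝ} (hn : n ≠ 0) :
    ∑ i ∈ Finset.range (k + 1), ((-1 : ℤ) ^ (k - i) * k.choose i : ℤ) * (a + i * n) ^ k =
      k.factorial * n ^ k := by
  have h := congrFun (fwdDiff_iter_eq_factorial (R := ℝ) (n := k)) (a / n)
  rw [fwdDiff_iter_eq_sum_shift] at h
  have h1 : (k.factorial : ℝ → ℝ) (a / n) = k.factorial := rfl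
  rw [← h1, ← h, Finset.sum_mul]
  refine Finset.sum_congr rfl fun i _ ↦ ?_
  rw [zsmul_eq_mul, nsmul_eq_mul, mul_one, mul_assoc, ← mul_pow, add_mul, div_mul_cancel₀ _ hn]

theorem sum_alternating_choose {k : ℕ} (hk : 0 < k) :
    ∑ i ∈ Finset.range (k + 1), (((-1 : ℤ) ^ (k - i) * k.choose i : ℤ) : ℝ) = 0 := by
  have h := congrFun (fwdDiff_iter_pow_eq_zero_of_lt (R := ℝ) hk) 0
  rw [fwdDiff_iter_eq_sum_shift] at h
  simpa using h

theorem sum_abs_alternating_choose (k : ℕ) :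
    ∑ i ∈ Finset.range (k + 1), |(((-1 : ℤ) ^ (k - i) * k.choose i : ℤ) : ℝ)| = 2 ^ k := by
  rw [← Nat.cast_ofNat (R := ℝ), ← Nat.cast_pow, ← Nat.sum_range_choose k, Nat.cast_sum]
  refine Finset.sum_congr rfl fun i _ ↦ ?_
  simp [abs_mul]

/-- If the values `b * (a + i * n) ^ k` have nearly equal fractional parts for all `i ≤ k`, then
`b * k! * n ^ k` is close to an integer. -/
theorem exists_abs_sub_intCast_le {k : ℕ} (hk : 0 < k) (b a : ℝ) {n : ℝ} (hn : n ≠ 0) {s ε : ℝ}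
    (h : ∀ i ≤ k, |Int.fract (b * (a + i * n) ^ k) - s| ≤ ε) :
    ∃ m : ℤ, |b * k.factorial * n ^ k - m| ≤ 2 ^ k * ε := by
  set w : ℕ → ℤ := fun i ↦ (-1) ^ (k - i) * k.choose i with hw
  refine ⟨∑ i ∈ Finset.range (k + 1), w i * ⌊b * (a + i * n) ^ k⌋, ?_⟩
  have h1 : b * k.factorial * n ^ k -
      ((∑ i ∈ Finset.range (k + 1), w i * ⌊b * (a + i * n) ^ k⌋ : ℤ) : ℝ) =
      ∑ i ∈ Finset.range (k + 1), w i * (Int.fract (b * (a + i * n) ^ k) - s) := by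
    have h2 : ∑ i ∈ Finset.range (k + 1), (w i : ℝ) * s = 0 := by
      rw [← Finset.sum_mul, sum_alternating_choose hk, zero_mul]
    rw [mul_assoc, ← sum_alternating_choose_mul_pow k a hn, Finset.mul_sum]
    simp only [mul_sub, Finset.sum_sub_distrib, h2, sub_zero]
    rw [Int.cast_sum, ← Finset.sum_sub_distrib]
    refine Finset.sum_congr rfl fun i _ ↦ ?_
    rw [Int.fract]
    simp only [hw]
    push_cast
    ring
  rw [h1, ← sum_abs_alternating_choose, Finset.sum_mul]
  refine (Finset.abs_sum_le_sum_abs _ _).trans (Finset.sum_le_sum fun i hi ↦ ?_)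
  rw [abs_mul]
  exact mul_le_mul_of_nonneg_left (h i (by simpa [Nat.lt_succ_iff] using hi)) (abs_nonneg _)

theorem half_le_cos_of_abs_sub_le {x : ℝ} {m : ℤ} (h : |x - m| ≤ 1 / 8) :
    1 / 2 ≤ Real.cos (2 * Real.pi * x) := by
  have hpi := Real.pi_pos
  have h1 : Real.cos (2 * Real.pi * x) = Real.cos |2 * Real.pi * (x - m)| := by
    rw [Real.cos_abs, ← Real.cos_sub_int_mul_two_pi _ m]
    ring_nf
  rw [h1, abs_mul, abs_of_pos (by positivity : 0 < 2 * Real.pi), ← Real.cos_pi_div_three]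
  refine Real.cos_le_cos_of_nonneg_of_le_pi (by positivity) (by linarith) ?_
  nlinarith

theorem not_isKIntersective_cos_lt_half {k : ℕ} (hk : 0 < k) (b : ℝ) :
    ¬ IsKIntersective k
      {n | Real.cos (2 * Real.pi * (b * k.factorial * (n : ℝ) ^ k)) < 1 / 2} := by
  intro hS
  set T : ℕ := 8 * 2 ^ k with hT
  have hT0 : (0 : ℝ) < T := by rw [hT]; positivity
  have : NeZero T := ⟨by positivity⟩
  have hlt (x : ℝ) : ⌊T * Int.fract x⌋₊ < T := by
    rw [Nat.floor_lt (mul_nonneg hT0.le (Int.fract_nonneg x))]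
    have := Int.fract_lt_one x
    nlinarith
  obtain ⟨t, ht⟩ := exists_hasPosUpperBanachDensity_fiber
    fun m : ℤ ↦ (⟨⌊T * Int.fract (b * (m : ℝ) ^ k)⌋₊, hlt _⟩ : Fin T)
  obtain ⟨a, n, hn, ha⟩ := hS _ ht
  rw [Set.mem_ofPred_eq] at hn
  have hn0 : (n : ℝ) ≠ 0 := by
    intro h0
    rw [h0, zero_pow hk.ne', mul_zero, mul_zero, Real.cos_zero] at hn
    norm_num at hn
  have hfract : ∀ i ≤ k, |Int.fract (b * ((a : ℝ) + i * n) ^ k) - (t : ℕ) / T| ≤ 1 / T := by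
    intro i hi
    have h := congrArg Fin.val (ha i hi)
    push_cast at h
    set x := Int.fract (b * ((a : ℝ) + i * n) ^ k)
    have h1 := Nat.floor_le (mul_nonneg hT0.le (Int.fract_nonneg (b * ((a : ℝ) + i * n) ^ k)))
    have h2 := Nat.lt_floor_add_one (T * x)
    rw [h] at h1 h2
    have h3 : x - (t : ℕ) / T = (T * x - (t : ℕ)) / T := by field_simp
    rw [h3, abs_div, abs_of_pos hT0]
    refine div_le_div_of_nonneg_right (abs_le.2 ⟨?_, ?_⟩) hT0.le <;> linarith
  obtain ⟨m, hm⟩ := exists_abs_sub_intCast_le hk b a hn0 hfract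
  refine hn.not_ge (half_le_cos_of_abs_sub_le (hm.trans (le_of_eq ?_)))
  rw [hT]
  push_cast
  field_simp

/-- For every integer `k ≥ 2` there exists a set `S ⊆ ℕ` that is `(k-1)`-intersective
but not `k`-intersective. -/
theorem exists_intersective_not_intersective (k : ℕ) (hk : 2 ≤ k) :
    ∃ S : Set ℕ, IsKIntersective (k - 1) S ∧ ¬ IsKIntersective k S := by
  obtain ⟨j, rfl⟩ : ∃ j, k = j + 1 := ⟨k - 1, by omega⟩
  exact ⟨_, isKIntersective_cos_lt_half j
    (irrational_sqrt_two.mul_natCast (Nat.factorial_ne_zero (j + 1))),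
    not_isKIntersective_cos_lt_half j.succ_pos _⟩
end

section
/- For every integer k ≥ 2 there exists a set S ⊆ ℕ that is a set of (k−1)-recurrence but not a set of k-recurrence. -/
open MeasureTheory

/-- `S` is a set of `k`-recurrence: for every probability measure-preserving system
`(X, 𝒳, μ, T)` and every measurable `A` with `μ A > 0`, there is `n ∈ S` with
`μ (A ∩ T⁻ⁿA ∩ ⋯ ∩ T⁻ᵏⁿA) > 0`. -/
def IsSetOfKRecurrence (k : ℕ) (S : Set ℕ) : Prop :=
  ∀ (X : Type) (_ : MeasurableSpace X) (μ : Measure X), IsProbabilityMeasure μ →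
    ∀ T : X → X, MeasurePreserving T μ μ →
      ∀ A : Set X, MeasurableSet A → 0 < μ A →
        ∃ n ∈ S, 0 < μ (⋂ i ∈ Finset.range (k + 1), T^[i * n] ⁻¹' A)

namespace DensityHalesJewett

open Combinatorics
open scoped BigOperators

section Average

/-- The average of a real function on a finite type. -/
noncomputable def avg {Ω : Type*} [Finite Ω] (f : Ω → ℝ) : ℝ :=
  letI := Fintype.ofFinite Ω
  (∑ x, f x) / Nat.card Ω

variable {Ω Ω' : Type*} [Finite Ω] [Finite Ω']

lemma avg_eq_sum_div [Fintype Ω] (f : Ω → ℝ) : avg f = (∑ x, f x) / Nat.card Ω := by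
  unfold avg
  congr!

lemma avg_mono {f g : Ω → ℝ} (h : ∀ x, f x ≤ g x) : avg f ≤ avg g := by
  have := Fintype.ofFinite Ω
  rw [avg_eq_sum_div, avg_eq_sum_div]
  gcongr with x
  exact h x

lemma avg_nonneg {f : Ω → ℝ} (h : ∀ x, 0 ≤ f x) : 0 ≤ avg f := by
  have := Fintype.ofFinite Ω
  rw [avg_eq_sum_div]
  exact div_nonneg (Finset.sum_nonneg fun x _ => h x) (by positivity)

lemma avg_add (f g : Ω → ℝ) : avg (fun x => f x + g x) = avg f + avg g := by
  have := Fintype.ofFinite Ω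
  simp only [avg_eq_sum_div, Finset.sum_add_distrib, add_div]

lemma avg_sub (f g : Ω → ℝ) : avg (fun x => f x - g x) = avg f - avg g := by
  have := Fintype.ofFinite Ω
  simp only [avg_eq_sum_div, Finset.sum_sub_distrib, sub_div]

lemma avg_const_mul (c : ℝ) (f : Ω → ℝ) : avg (fun x => c * f x) = c * avg f := by
  have := Fintype.ofFinite Ω
  simp only [avg_eq_sum_div, ← Finset.mul_sum, mul_div_assoc]

lemma avg_sum {J : Type*} (s : Finset J) (f : J → Ω → ℝ) :
    avg (fun x => ∑ j ∈ s, f j x) = ∑ j ∈ s, avg (f j) := by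
  have := Fintype.ofFinite Ω
  simp only [avg_eq_sum_div, ← Finset.sum_div]
  rw [Finset.sum_comm]

lemma avg_const [Nonempty Ω] (c : ℝ) : avg (fun _ : Ω => c) = c := by
  have := Fintype.ofFinite Ω
  rw [avg_eq_sum_div]
  simp

lemma avg_le_of_le [Nonempty Ω] {f : Ω → ℝ} {c : ℝ} (h : ∀ x, f x ≤ c) : avg f ≤ c :=
  (avg_mono h).trans_eq (avg_const c)

lemma le_avg_of_le [Nonempty Ω] {f : Ω → ℝ} {c : ℝ} (h : ∀ x, c ≤ f x) : c ≤ avg f :=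
  (avg_const c).symm.trans_le (avg_mono h)

lemma avg_of_isEmpty [IsEmpty Ω] (f : Ω → ℝ) : avg f = 0 := by
  have := Fintype.ofFinite Ω
  simp [avg_eq_sum_div]

lemma avg_unique [Unique Ω] (f : Ω → ℝ) : avg f = f default := by
  rw [avg_eq_sum_div]
  simp

lemma avg_equiv (e : Ω ≃ Ω') (f : Ω' → ℝ) : avg (fun x => f (e x)) = avg f := by
  have := Fintype.ofFinite Ω
  have := Fintype.ofFinite Ω'
  rw [avg_eq_sum_div, avg_eq_sum_div, e.sum_comp f, Nat.card_congr e]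

lemma avg_comm (f : Ω → Ω' → ℝ) :
    avg (fun x => avg (fun y => f x y)) = avg (fun y => avg (fun x => f x y)) := by
  have := Fintype.ofFinite Ω
  have := Fintype.ofFinite Ω'
  simp only [avg_eq_sum_div, ← Finset.sum_div]
  rw [Finset.sum_comm, div_right_comm]

lemma avg_prod (f : Ω × Ω' → ℝ) : avg f = avg (fun x => avg (fun y => f (x, y))) := by
  have := Fintype.ofFinite Ω
  have := Fintype.ofFinite Ω'
  simp only [avg_eq_sum_div, ← Finset.sum_div, Nat.card_prod]
  rw [Fintype.sum_prod_type, div_div, Nat.cast_mul, mul_comm]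

lemma avg_sumElim {ι κ β : Type*} [Finite ι] [Finite κ] [Finite β] (f : (ι ⊕ κ → β) → ℝ) :
    avg f = avg (fun x : ι → β => avg (fun y : κ → β => f (Sum.elim x y))) := by
  rw [← avg_equiv (Equiv.sumArrowEquivProdArrow ι κ β).symm f, avg_prod]
  rfl

lemma avg_indicator_range {j : Ω' → Ω} (hj : Function.Injective j) (f : Ω → ℝ) :
    avg ((Set.range j).indicator f) = (Nat.card Ω' / Nat.card Ω : ℝ) * avg (fun x => f (j x)) := by
  classical
  have := Fintype.ofFinite Ω
  have := Fintype.ofFinite Ω'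
  rcases isEmpty_or_nonempty Ω' with h | h
  · have : Set.range j = ∅ := Set.range_eq_empty j
    rw [this, Set.indicator_empty]
    simp [avg_eq_sum_div]
  have h1 : ∑ x, (Set.range j).indicator f x = ∑ x, f (j x) := by
    rw [← Finset.sum_subset (Finset.subset_univ (Finset.univ.image j))]
    · rw [Finset.sum_image fun a _ b _ h => hj h]
      simp
    · intro x _ hx
      refine Set.indicator_of_notMem (fun h => hx ?_) _
      simpa using h
  have h0 : (Nat.card Ω' : ℝ) ≠ 0 := by simp
  rw [avg_eq_sum_div, avg_eq_sum_div, h1]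
  field_simp

lemma mul_avg_comp_le {j : Ω' → Ω} (hj : Function.Injective j) {f : Ω → ℝ} (hf : ∀ x, 0 ≤ f x) :
    (Nat.card Ω' / Nat.card Ω : ℝ) * avg (fun x => f (j x)) ≤ avg f := by
  rw [← avg_indicator_range hj]
  exact avg_mono fun x => Set.indicator_le_self' (fun x _ => hf x) x

lemma inv_card_mul_le_avg {f : Ω → ℝ} (hf : ∀ x, 0 ≤ f x) (x : Ω) :
    (Nat.card Ω : ℝ)⁻¹ * f x ≤ avg f := by
  have := mul_avg_comp_le (j := fun _ : Unit => x) (fun _ _ _ => rfl) hf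
  simpa [avg_unique] using this

lemma exists_le_of_le_avg [Nonempty Ω] {f : Ω → ℝ} {c : ℝ} (h : c ≤ avg f) : ∃ x, c ≤ f x := by
  have := Fintype.ofFinite Ω
  by_contra! hc
  have h0 : (0 : ℝ) < Nat.card Ω := by exact_mod_cast Nat.card_pos
  rw [avg_eq_sum_div, le_div_iff₀ h0] at h
  have := Finset.sum_lt_sum_of_nonempty (Finset.univ_nonempty (α := Ω)) (fun x _ => hc x)
  simp at this
  linarith [mul_comm c (Nat.card Ω : ℝ), Nat.card_eq_fintype_card (α := Ω) ▸ this]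

/-- The density of a set in a finite type. -/
noncomputable def density (D : Set Ω) : ℝ := avg (D.indicator 1)

lemma indicator_one_nonneg {Γ : Type*} (D : Set Γ) (x : Γ) : 0 ≤ D.indicator (1 : Γ → ℝ) x :=
  Set.indicator_nonneg (fun _ _ => zero_le_one) x

lemma indicator_one_le_one {Γ : Type*} (D : Set Γ) (x : Γ) : D.indicator (1 : Γ → ℝ) x ≤ 1 :=
  Set.indicator_le_self' (fun _ _ => zero_le_one) x

lemma density_le_one (D : Set Ω) : density D ≤ 1 := by
  rcases isEmpty_or_nonempty Ω with h | h
  · rw [density, avg_of_isEmpty]; exact zero_le_one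
  · exact avg_le_of_le (indicator_one_le_one D)

lemma density_nonneg (D : Set Ω) : 0 ≤ density D := avg_nonneg (indicator_one_nonneg D)

lemma density_mono {D E : Set Ω} (h : D ⊆ E) : density D ≤ density E :=
  avg_mono fun x => Set.indicator_le_indicator_of_subset h (fun _ => zero_le_one) x

lemma nonempty_of_density_pos {D : Set Ω} (h : 0 < density D) : D.Nonempty := by
  by_contra hD
  rw [Set.not_nonempty_iff_eq_empty] at hD
  have := Fintype.ofFinite Ω
  simp [hD, density, avg_eq_sum_div] at h

lemma density_sumElim {ι κ β : Type*} [Finite ι] [Finite κ] [Finite β] (D : Set (ι ⊕ κ → β)) :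
    density D = avg (fun x : ι → β => density {y : κ → β | Sum.elim x y ∈ D}) :=
  avg_sumElim _

lemma density_sumElim' {ι κ β : Type*} [Finite ι] [Finite κ] [Finite β] (D : Set (ι ⊕ κ → β)) :
    density D = avg (fun y : κ → β => density {x : ι → β | Sum.elim x y ∈ D}) := by
  rw [density_sumElim]
  exact avg_comm _

/-- A reverse Markov inequality for averages of densities. -/
lemma le_density_setOf_le [Nonempty Ω] {f : Ω → ℝ} (hf : ∀ x, f x ≤ 1) {a b : ℝ} (ha : 0 ≤ a)
    (h : a + b ≤ avg f) : b ≤ density {x | a ≤ f x} := by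
  have : avg f ≤ a + density {x | a ≤ f x} := by
    rw [density, ← avg_const (Ω := Ω) a, ← avg_add, avg_const]
    refine avg_mono fun x => ?_
    by_cases hx : a ≤ f x
    · simp [Set.indicator, hx]; linarith [hf x]
    · simp [Set.indicator, hx]; linarith
  linarith

/-- If a set is covered by finitely many sets, one of them has large density. -/
lemma exists_density_ge {J : Type*} [Finite J] [Nonempty J] {D : Set Ω} {E : J → Set Ω}
    (h : D ⊆ ⋃ j, E j) {b : ℝ} (hb : b ≤ density D) : ∃ j, b / Nat.card J ≤ density (E j) := by
  have := Fintype.ofFinite J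
  refine exists_le_of_le_avg ?_
  rw [avg_eq_sum_div]
  gcongr
  refine hb.trans ?_
  simp only [density]
  rw [← avg_sum]
  refine avg_mono fun x => ?_
  by_cases hx : x ∈ D
  · obtain ⟨j, hj⟩ := Set.mem_iUnion.1 (h hx)
    calc D.indicator (1 : Ω → ℝ) x ≤ (E j).indicator 1 x := by simp [hx, hj]
      _ ≤ _ := Finset.single_le_sum (f := fun j => (E j).indicator (1 : Ω → ℝ) x)
          (fun i _ => indicator_one_nonneg _ _) (Finset.mem_univ j)
  · simpa [hx] using Finset.sum_nonneg fun i _ => indicator_one_nonneg _ _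

end Average

section Subspaces

variable {α β ι κ η ζ : Type*}

/-- Composition of combinatorial subspaces. -/
def comp (V : Subspace η β ι) (W : Subspace ζ β η) : Subspace ζ β ι where
  idxFun i := (V.idxFun i).elim Sum.inl W.idxFun
  proper e := by
    obtain ⟨j, hj⟩ := W.proper e
    obtain ⟨i, hi⟩ := V.proper j
    exact ⟨i, by simp [hi, hj]⟩

lemma comp_apply (V : Subspace η β ι) (W : Subspace ζ β η) (x : ζ → β) :
    comp V W x = V (W x) := by
  funext i
  cases h : V.idxFun i <;> simp [Subspace.apply_def, comp, h]

/-- The image of a combinatorial line under a combinatorial subspace. -/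
def compLine (V : Subspace η β ι) (l : Line β η) : Line β ι where
  idxFun i := (V.idxFun i).elim some l.idxFun
  proper := by
    obtain ⟨j, hj⟩ := l.proper
    obtain ⟨i, hi⟩ := V.proper j
    exact ⟨i, by simp [hi, hj]⟩

lemma compLine_apply (V : Subspace η β ι) (l : Line β η) (b : β) :
    compLine V l b = V (l b) := by
  funext i
  cases h : V.idxFun i <;> simp [Subspace.apply_def, compLine, h]

/-- A subspace over `α`, considered over the alphabet `Option α`. -/
def extend (V : Subspace η α ι) : Subspace η (Option α) ι where
  idxFun i := (V.idxFun i).map some id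
  proper e := by
    obtain ⟨i, hi⟩ := V.proper e
    exact ⟨i, by simp [hi]⟩

lemma extend_some (V : Subspace η α ι) (x : η → α) :
    extend V (fun j => some (x j)) = fun i => some (V x i) := by
  funext i
  cases h : V.idxFun i <;> simp [Subspace.apply_def, extend, h]

/-- Append constant coordinates to a subspace. -/
def sumConst (V : Subspace η β ι) (y : κ → β) : Subspace η β (ι ⊕ κ) where
  idxFun := Sum.elim V.idxFun (fun k => Sum.inl (y k))
  proper e := by
    obtain ⟨i, hi⟩ := V.proper e
    exact ⟨Sum.inl i, by simp [hi]⟩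

lemma sumConst_apply (V : Subspace η β ι) (y : κ → β) (x : η → β) :
    sumConst V y x = Sum.elim (V x) y := by
  funext i
  cases i <;> simp [Subspace.apply_def, sumConst]

/-- Prepend constant coordinates to a subspace. -/
def constSum (y : κ → β) (V : Subspace η β ι) : Subspace η β (κ ⊕ ι) where
  idxFun := Sum.elim (fun k => Sum.inl (y k)) V.idxFun
  proper e := by
    obtain ⟨i, hi⟩ := V.proper e
    exact ⟨Sum.inr i, by simp [hi]⟩

lemma constSum_apply (y : κ → β) (V : Subspace η β ι) (x : η → β) :
    constSum y V x = Sum.elim y (V x) := by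
  funext i
  cases i <;> simp [Subspace.apply_def, constSum]

lemma subspace_injective (V : Subspace η β ι) : Function.Injective (V : (η → β) → ι → β) := by
  intro x y h
  funext e
  obtain ⟨i, hi⟩ := V.proper e
  simpa [Subspace.apply_inr hi] using congrFun h i

/-- Replace the extra letter `none` by the letter `a`. -/
def fill (a : α) (u : ι → Option α) : ι → α := fun i => (u i).getD a

lemma fill_extend (V : Subspace η α ι) (a : α) (u : η → Option α) :
    fill a (extend V u) = V (fill a u) := by
  funext i
  cases h : V.idxFun i <;> simp [Subspace.apply_def, extend, fill, h]

lemma fill_subspace_congr (V : Subspace η (Option α) ι) {a : α} {u v : η → Option α}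
    (h : fill a u = fill a v) : fill a (V u) = fill a (V v) := by
  funext i
  cases hi : V.idxFun i with
  | inl b => simp [Subspace.apply_def, fill, hi]
  | inr e => simpa [Subspace.apply_def, fill, hi] using congrFun h e

/-- A set of words over `Option α` is insensitive with respect to `a` if membership does not change
when letters `none` are replaced by `a` and vice versa. -/
def Insensitive (a : α) (D : Set (ι → Option α)) : Prop :=
  ∀ ⦃u v : ι → Option α⦄, fill a u = fill a v → u ∈ D → v ∈ D

lemma Insensitive.mem_iff {a : α} {D : Set (ι → Option α)} (h : Insensitive a D)
    {u v : ι → Option α} (huv : fill a u = fill a v) : u ∈ D ↔ v ∈ D :=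
  ⟨h huv, h huv.symm⟩

lemma Insensitive.compl {a : α} {D : Set (ι → Option α)} (h : Insensitive a D) :
    Insensitive a Dᶜ := fun _ _ huv hu hv => hu (h huv.symm hv)

lemma Insensitive.preimage {a : α} {D : Set (ι → Option α)} (h : Insensitive a D)
    (V : Subspace η (Option α) ι) : Insensitive a {u | V u ∈ D} :=
  fun _ _ huv hu => h (fill_subspace_congr V huv) hu

end Subspaces

section Hypotheses

/-- Every set of words over `α` of density at least `δ` in some fixed dimension contains a
combinatorial line. -/
def DenseLineAt (α : Type) [Finite α] (δ : ℝ) : Prop :=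
  ∃ (ι : Type) (_ : Finite ι), ∀ A : Set (ι → α), δ ≤ density A → ∃ l : Line α ι, ∀ a, l a ∈ A

/-- The density Hales-Jewett property of an alphabet. -/
def DenseLine (α : Type) [Finite α] : Prop := ∀ δ > 0, DenseLineAt α δ

/-- The subspace spanned by a line and a subspace in complementary sets of coordinates. -/
def lineSum {α ι κ η : Type*} (l : Line α ι) (V : Subspace η α κ) :
    Subspace (Option η) α (ι ⊕ κ) where
  idxFun := Sum.elim (fun i => (l.idxFun i).elim (Sum.inr none) Sum.inl)
    (fun k => (V.idxFun k).map id some)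
  proper e := by
    cases e with
    | none => obtain ⟨i, hi⟩ := l.proper; exact ⟨Sum.inl i, by simp [hi]⟩
    | some e => obtain ⟨i, hi⟩ := V.proper e; exact ⟨Sum.inr i, by simp [hi]⟩

lemma lineSum_apply {α ι κ η : Type*} (l : Line α ι) (V : Subspace η α κ) (x : Option η → α) :
    lineSum l V x = Sum.elim (l (x none)) (V (fun e => x (some e))) := by
  funext i
  cases i with
  | inl i => cases h : l.idxFun i <;> simp [Subspace.apply_def, lineSum, h]
  | inr i => cases h : V.idxFun i <;> simp [Subspace.apply_def, lineSum, h]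

/-- The multidimensional density Hales-Jewett theorem follows from the one-dimensional one. -/
lemma DenseLine.exists_subspace {α : Type} [Finite α] [Nonempty α] (h : DenseLine α)
    (η : Type) [Finite η] :
    ∀ δ > 0, ∃ (ι : Type) (_ : Finite ι), ∀ A : Set (ι → α), δ ≤ density A →
      ∃ V : Subspace η α ι, ∀ x, V x ∈ A := by
  induction η using Finite.induction_empty_option with
  | of_equiv e ih =>
    intro δ hδ
    obtain ⟨ι, hι, H⟩ := ih δ hδ
    refine ⟨ι, hι, fun A hA => ?_⟩
    obtain ⟨V, hV⟩ := H A hA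
    refine ⟨V.reindex e (Equiv.refl _) (Equiv.refl _), fun x => ?_⟩
    have : V.reindex e (Equiv.refl _) (Equiv.refl _) x = V (x ∘ e) := by
      funext i
      simp [Function.comp_def]
    rw [this]
    exact hV _
  | h_empty =>
    intro δ hδ
    refine ⟨PEmpty, inferInstance, fun A hA => ?_⟩
    obtain ⟨x, hx⟩ := nonempty_of_density_pos (hδ.trans_le hA)
    exact ⟨⟨fun i => i.elim, fun e => e.elim⟩, fun y => by convert hx; exact Subsingleton.elim _ _⟩
  | h_option ih =>
    intro δ hδ
    obtain ⟨ι, hι, H⟩ := h (δ / 2) (by positivity)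
    have hfin : Finite (Line α ι) :=
      Finite.of_injective (fun l : Line α ι => l.idxFun) fun l m h => Line.ext h
    rcases isEmpty_or_nonempty (Line α ι) with hl | hl
    · refine ⟨ι, hι, fun A hA => ?_⟩
      obtain ⟨l, -⟩ := H A (by linarith)
      exact hl.elim l
    have hcard : (0 : ℝ) < Nat.card (Line α ι) := by exact_mod_cast Nat.card_pos
    obtain ⟨κ, hκ, K⟩ := ih (δ / 2 / Nat.card (Line α ι)) (by positivity)
    refine ⟨ι ⊕ κ, inferInstance, fun A hA => ?_⟩
    rw [density_sumElim'] at hA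
    have h1 := le_density_setOf_le (fun y => density_le_one _) (a := δ / 2) (b := δ / 2)
      (by positivity) ((add_halves δ).trans_le hA)
    obtain ⟨l, hl⟩ := exists_density_ge
      (E := fun l : Line α ι => {y : κ → α | ∀ a, Sum.elim (l a) y ∈ A})
      (by
        intro y hy
        obtain ⟨l, hl⟩ := H _ hy
        exact Set.mem_iUnion.2 ⟨l, hl⟩) h1
    obtain ⟨V, hV⟩ := K _ hl
    exact ⟨lineSum l V, fun x => by rw [lineSum_apply]; exact hV _ _⟩

end Hypotheses

section Ramsey

variable {α : Type}

/-- Replace the letter `none` by `some a` in the constant coordinates of a subspace. -/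
def fillConst {ι η : Type*} (a : α) (V : Subspace η (Option α) ι) : Subspace η (Option α) ι where
  idxFun i := (V.idxFun i).map (fun b => some (b.getD a)) id
  proper e := by
    obtain ⟨i, hi⟩ := V.proper e
    exact ⟨i, by simp [hi]⟩

/-- Prepend a constant letter to a subspace. -/
def cons {β ι η : Type*} (b : β) (V : Subspace η β ι) : Subspace η β (Option ι) where
  idxFun o := o.elim (Sum.inl b) V.idxFun
  proper e := by
    obtain ⟨i, hi⟩ := V.proper e
    exact ⟨some i, by simp [hi]⟩

lemma cons_apply {β ι η : Type*} (b : β) (V : Subspace η β ι) (x : η → β) :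
    cons b V x = fun o => o.elim b (V x) := by
  funext o
  cases o <;> simp [Subspace.apply_def, cons]

/-- Turn the letter `none` in the constant coordinates of a subspace over `Option α` into
a new variable, and restrict the old variables to a subspace over `α`. -/
def consVar {ι η ζ : Type*} (V : Subspace η (Option α) ι) (W : Subspace ζ α η) :
    Subspace (Option ζ) α (Option ι) where
  idxFun o := o.elim (Sum.inr none) fun i =>
    (V.idxFun i).elim (fun b => b.elim (Sum.inr none) Sum.inl) fun e => (W.idxFun e).map id some
  proper e := by
    cases e with
    | none => exact ⟨none, rfl⟩
    | some e =>
      obtain ⟨j, hj⟩ := W.proper e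
      obtain ⟨i, hi⟩ := V.proper j
      exact ⟨some i, by simp [hi, hj]⟩

lemma extend_consVar_none {ι η ζ : Type*} (V : Subspace η (Option α) ι) (W : Subspace ζ α η)
    {u : Option ζ → Option α} (hu : u none = none) :
    extend (consVar V W) u = fun o => o.elim none (V (extend W fun j => u (some j))) := by
  funext o
  cases o with
  | none => simp [Subspace.apply_def, extend, consVar, hu]
  | some i =>
    rcases h : V.idxFun i with b | e
    · cases b <;> simp [Subspace.apply_def, extend, consVar, hu, h]
    · cases h' : W.idxFun e <;> simp [Subspace.apply_def, extend, consVar, h, h']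

lemma extend_consVar_some {ι η ζ : Type*} (V : Subspace η (Option α) ι) (W : Subspace ζ α η)
    {u : Option ζ → Option α} {a : α} (hu : u none = some a) :
    extend (consVar V W) u =
      fun o => o.elim (some a) (fillConst a V (extend W fun j => u (some j))) := by
  funext o
  cases o with
  | none => simp [Subspace.apply_def, extend, consVar, hu]
  | some i =>
    rcases h : V.idxFun i with b | e
    · cases b <;> simp [Subspace.apply_def, extend, consVar, fillConst, hu, h]
    · cases hW : W.idxFun e <;> simp [Subspace.apply_def, extend, consVar, fillConst, h, hW]

/-- The restriction of a subspace where some of the variables are set to a constant. -/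
def restrictLeft {β ι η ζ : Type*} (V : Subspace (η ⊕ ζ) β ι) (b : β) : Subspace η β ι :=
  comp V ⟨Sum.elim Sum.inr fun _ => Sum.inl b, fun e => ⟨Sum.inl e, rfl⟩⟩

/-- The restriction of a subspace where some of the variables are set to a constant. -/
def restrictRight {β ι η ζ : Type*} (V : Subspace (η ⊕ ζ) β ι) (b : β) : Subspace ζ β ι :=
  comp V ⟨Sum.elim (fun _ => Sum.inl b) Sum.inr, fun e => ⟨Sum.inr e, rfl⟩⟩

/-- If every `M`-dimensional subspace contains a good line, then there is a large subspace of words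
having the letter `none` in a fixed position, all of which are good as lines. A word over `Option α`
containing the letter `none` is viewed as a line over `α`. -/
lemma exists_subspace_of_forall_exists_line [Finite α] (M : Type) [Finite M] :
    ∀ (Q d : Type) [Finite Q] [Finite d], ∃ (ι : Type) (_ : Finite ι),
      ∀ G : Q → (ι → Option α) → Prop,
        (∀ V : Subspace M α ι, ∃ q, ∃ u : M → Option α, (∃ j, u j = none) ∧ G q (extend V u)) →
        ∃ q, ∃ Z : Subspace d (Option α) ι, (∃ i, Z.idxFun i = Sum.inl none) ∧ ∀ v, G q (Z v) := by
  induction M using Finite.induction_empty_option with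
  | of_equiv e ih =>
    intro Q d _ _
    obtain ⟨ι, hι, H⟩ := ih Q d
    refine ⟨ι, hι, fun G hG => H G fun V => ?_⟩
    obtain ⟨q, u, ⟨j, hj⟩, hu⟩ := hG (V.reindex e (Equiv.refl _) (Equiv.refl _))
    refine ⟨q, u ∘ e, ⟨e.symm j, by simpa using hj⟩, ?_⟩
    convert hu using 1
    funext i
    cases h : V.idxFun i <;> simp [Subspace.apply_def, extend, Subspace.reindex, h]
  | h_empty =>
    intro Q d _ _
    refine ⟨PEmpty, inferInstance, fun G hG => ?_⟩
    obtain ⟨q, u, ⟨j, -⟩, -⟩ := hG ⟨fun i => i.elim, fun e => e.elim⟩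
    exact j.elim
  | @h_option M _ ih =>
    intro Q d _ _
    obtain ⟨ι₁, hι₁, H⟩ := ih (Q × α) d
    obtain ⟨ι', hι', K⟩ :=
      Subspace.exists_mono_in_high_dimension (Option α) (Set Q) (ι₁ ⊕ d)
    refine ⟨Option ι', inferInstance, fun G hG => ?_⟩
    obtain ⟨V, c, hV⟩ := K fun v => {q | G q fun o => o.elim none v}
    by_cases hc : ∃ q, q ∈ c
    · obtain ⟨q, hq⟩ := hc
      refine ⟨q, cons none (restrictRight V none), ⟨none, rfl⟩, fun v => ?_⟩
      rw [cons_apply, restrictRight, comp_apply]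
      rw [← hV] at hq
      exact hq
    push Not at hc
    set V₁ := restrictLeft V none with hV₁
    have hbad : ∀ q v, ¬ G q fun o => o.elim none (V₁ v) := by
      intro q v hq
      rw [hV₁, restrictLeft, comp_apply] at hq
      refine hc q ?_
      rw [← hV]
      exact hq
    obtain ⟨⟨q, a⟩, Z, ⟨e, he⟩, hZ⟩ :=
      H (fun p u => G p.1 fun o => o.elim (some p.2) (fillConst p.2 V₁ u)) (by
        intro W
        obtain ⟨q, u, ⟨j, hj⟩, hu⟩ := hG (consVar V₁ W)
        cases h : u none with
        | none =>
          rw [extend_consVar_none V₁ W h] at hu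
          exact absurd hu (hbad _ _)
        | some a =>
          rw [extend_consVar_some V₁ W h] at hu
          refine ⟨(q, a), fun j => u (some j), ?_, hu⟩
          cases j with
          | none => simp [h] at hj
          | some j => exact ⟨j, hj⟩)
    refine ⟨q, cons (some a) (comp (fillConst a V₁) Z), ?_, fun v => ?_⟩
    · obtain ⟨i, hi⟩ := V₁.proper e
      exact ⟨some i, by simp [cons, comp, fillConst, hi, he]⟩
    · rw [cons_apply, comp_apply]
      exact hZ v

end Ramsey

section Insensitive

variable {α : Type} [Finite α] [Nonempty α]

/-- The whole space of words as a combinatorial subspace. -/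
def fullSubspace (η β : Type*) : Subspace η β η := ⟨Sum.inr, fun e => ⟨e, rfl⟩⟩

lemma fullSubspace_apply {η β : Type*} (x : η → β) : fullSubspace η β x = x := rfl

/-- A function on words over `Option α` with large average also has large average on the words over
`α` of some subspace of prescribed dimension. -/
lemma exists_subspace_avg_ge (ι₀ : Type) [Finite ι₀] {b : ℝ} (hb : 0 ≤ b) (n : ℕ) :
    ∃ (ι : Type) (_ : Finite ι), ∀ f : (ι → Option α) → ℝ, (∀ x, f x ≤ 1) →
      (∀ W : Subspace ι₀ (Option α) ι, avg (fun x : ι₀ → α => f (W fun j => some (x j))) ≤ b) →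
      avg f ≤ b + (1 - Nat.card (ι₀ → α) / Nat.card (ι₀ → Option α) : ℝ) ^ n := by
  have hinj : Function.Injective fun (x : ι₀ → α) (j : ι₀) => some (x j) :=
    (Option.some_injective α).comp_left
  have hp0 : (0 : ℝ) ≤ Nat.card (ι₀ → α) / Nat.card (ι₀ → Option α) := by positivity
  have hp1 : (Nat.card (ι₀ → α) / Nat.card (ι₀ → Option α) : ℝ) ≤ 1 :=
    div_le_one_of_le₀ (by exact_mod_cast Nat.card_le_card_of_injective _ hinj) (by positivity)
  set p : ℝ := Nat.card (ι₀ → α) / Nat.card (ι₀ → Option α) with hp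
  induction n with
  | zero =>
    refine ⟨PEmpty, inferInstance, fun f hf _ => ?_⟩
    have := avg_le_of_le hf
    simp only [pow_zero]
    linarith
  | succ n ih =>
    obtain ⟨ι, hι, H⟩ := ih
    refine ⟨ι₀ ⊕ ι, inferInstance, fun f hf hW => ?_⟩
    set c := b + (1 - p) ^ n with hc
    have h1 : ∀ z : ι₀ → Option α, avg (fun y : ι → Option α => f (Sum.elim z y)) ≤ c := by
      refine fun z => H _ (fun y => hf _) fun W => ?_
      simpa only [constSum_apply] using hW (constSum z W)
    have h2 : avg (fun x : ι₀ → α => avg fun y : ι → Option α =>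
        f (Sum.elim (fun j => some (x j)) y)) ≤ b := by
      rw [avg_comm]
      refine avg_le_of_le fun y => ?_
      simpa only [sumConst_apply, fullSubspace_apply] using hW (sumConst (fullSubspace _ _) y)
    have h3 := mul_avg_comp_le hinj
      (f := fun z => c - avg (fun y : ι → Option α => f (Sum.elim z y)))
      fun z => sub_nonneg.2 (h1 z)
    rw [avg_sub, avg_sub, avg_const, avg_const, ← avg_sumElim, ← hp] at h3
    have h4 := mul_le_mul_of_nonneg_left h2 hp0
    rw [pow_succ]
    nlinarith

/-- A dense insensitive set contains a subspace of prescribed dimension. -/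
lemma DenseLine.exists_subspace_of_insensitive (h : DenseLine α) (a : α) (η : Type) [Finite η]
    {δ : ℝ} (hδ : 0 < δ) :
    ∃ (ι : Type) (_ : Finite ι), ∀ D : Set (ι → Option α), Insensitive a D → δ ≤ density D →
      ∃ U : Subspace η (Option α) ι, ∀ v, U v ∈ D := by
  obtain ⟨ι₀, hι₀, H⟩ := h.exists_subspace η (δ / 2) (by positivity)
  have hp0 : (0 : ℝ) < Nat.card (ι₀ → α) / Nat.card (ι₀ → Option α) := by
    have h1 : 0 < Nat.card (ι₀ → α) := Nat.card_pos
    have h2 : 0 < Nat.card (ι₀ → Option α) := Nat.card_pos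
    positivity
  obtain ⟨n, hn⟩ := exists_pow_lt_of_lt_one (half_pos hδ) (sub_lt_self 1 hp0)
  obtain ⟨ι, hι, K⟩ := exists_subspace_avg_ge (α := α) ι₀ (half_pos hδ).le n
  refine ⟨ι, hι, fun D hD hδD => ?_⟩
  have : ∃ W : Subspace ι₀ (Option α) ι,
      δ / 2 ≤ avg fun x : ι₀ → α =>
        D.indicator (1 : (ι → Option α) → ℝ) (W fun j => some (x j)) := by
    by_contra! hcon
    have := K (D.indicator 1) (indicator_one_le_one D) fun W => (hcon W).le
    rw [density] at hδD
    linarith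
  obtain ⟨W, hW⟩ := this
  obtain ⟨V, hV⟩ := H {x | (W fun j => some (x j)) ∈ D} hW
  refine ⟨comp W (extend V), fun v => ?_⟩
  rw [comp_apply]
  refine hD ?_ (hV (fill a v))
  refine fill_subspace_congr W ?_
  rw [fill_extend, ← extend_some, fill_extend]
  rfl

/-- An insensitive set contains a disjoint union of subspaces of positive density, which is only
seen through averages of functions that are nonpositive on subspaces. -/
lemma exists_subset_of_insensitive {ι η : Type} [Finite ι] [Finite η] {a : α} {b : ℝ}
    (hb : 0 ≤ b)
    (H : ∀ D : Set (ι → Option α), Insensitive a D → b ≤ density D →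
      ∃ U : Subspace η (Option α) ι, ∀ v, U v ∈ D)
    (D : Set (ι → Option α)) (hD : Insensitive a D) :
    ∃ R ⊆ D, (Nat.card (ι → Option α) : ℝ)⁻¹ * (density D - b) ≤ density R ∧
      ∀ g : (ι → Option α) → ℝ, (∀ U : Subspace η (Option α) ι, avg (fun v => g (U v)) ≤ 0) →
        avg (R.indicator g) ≤ 0 := by
  by_cases hDb : b ≤ density D
  · obtain ⟨U, hU⟩ := H D hD hDb
    refine ⟨Set.range U, Set.range_subset_iff.2 hU, ?_, fun g hg => ?_⟩
    · have h1 := inv_card_mul_le_avg (indicator_one_nonneg (Set.range U)) (U fun _ => none)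
      rw [Set.indicator_of_mem (Set.mem_range_self _)] at h1
      refine le_trans ?_ h1
      gcongr
      have := density_le_one D
      simp only [Pi.one_apply]
      linarith
    · rw [avg_indicator_range (subspace_injective U)]
      exact mul_nonpos_of_nonneg_of_nonpos (by positivity) (hg U)
  · refine ⟨∅, Set.empty_subset _, ?_, fun g _ => ?_⟩
    · refine le_trans (mul_nonpos_of_nonneg_of_nonpos (by positivity) ?_) (density_nonneg _)
      linarith
    · rw [Set.indicator_empty]
      exact (avg_const (Ω := ι → Option α) (0 : ℝ)).le

/-- A function that is nonpositive on average on all subspaces of dimension `η` is almost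
nonpositive on average on every insensitive set: the version for families, under a density
assumption. -/
lemma avg_indicator_le_of_insensitive_family {ι₀ η : Type} [Finite ι₀] [Finite η] {a : α} {b : ℝ}
    (hb : 0 < b)
    (H : ∀ D : Set (ι₀ → Option α), Insensitive a D → b / 2 ≤ density D →
      ∃ U : Subspace η (Option α) ι₀, ∀ v, U v ∈ D) (n : ℕ) :
    ∃ (ι : Type) (_ : Finite ι), ∀ (X : Type) [Finite X] [Nonempty X]
      (f : X → (ι → Option α) → ℝ), (∀ x y, f x y ≤ 1) →
      (∀ x, ∀ U : Subspace η (Option α) ι, avg (fun v => f x (U v)) ≤ 0) →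
      ∀ D : X → Set (ι → Option α), (∀ x, Insensitive a (D x)) →
        avg (fun x => density (D x)) ≤ b + n * ((Nat.card (ι₀ → Option α) : ℝ)⁻¹ * (b / 2)) →
        avg (fun x => avg ((D x).indicator (f x))) ≤ b := by
  have hsmall : ∀ (ι X : Type) [Finite ι] [Finite X] (f : X → (ι → Option α) → ℝ)
      (D : X → Set (ι → Option α)), (∀ x y, f x y ≤ 1) → avg (fun x => density (D x)) ≤ b →
      avg (fun x => avg ((D x).indicator (f x))) ≤ b := by
    intro ι X _ _ f D hf hD
    exact (avg_mono fun x => avg_mono fun y => Set.indicator_le_indicator (hf x y)).trans hD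
  choose! R hRD hR hRg using exists_subset_of_insensitive (half_pos hb).le H
  induction n with
  | zero =>
    refine ⟨PEmpty, inferInstance, fun X _ _ f hf _ D _ hdens => hsmall _ _ f D hf ?_⟩
    simpa using hdens
  | succ n ih =>
    obtain ⟨ι, hι, K⟩ := ih
    refine ⟨ι₀ ⊕ ι, inferInstance, fun X _ _ f hf hU D hD hdens => ?_⟩
    rcases le_or_gt (avg fun x => density (D x)) b with hle | hgt
    · exact hsmall _ _ f D hf hle
    set s : X → (ι → Option α) → Set (ι₀ → Option α) := fun x y => {z | Sum.elim z y ∈ D x} with hs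
    have hsD : ∀ x y, Insensitive a (s x y) := by
      intro x y u v huv hu
      refine hD x ?_ hu
      funext i
      cases i with
      | inl i => exact congrFun huv i
      | inr i => rfl
    have hscongr : ∀ x y y', fill a y = fill a y' → s x y = s x y' := by
      intro x y y' hyy
      ext z
      refine (hD x).mem_iff ?_
      funext i
      cases i with
      | inl i => rfl
      | inr i => exact congrFun hyy i
    set D' : X × (ι₀ → Option α) → Set (ι → Option α) :=
      fun p => {y | p.2 ∈ s p.1 y ∧ p.2 ∉ R (s p.1 y)} with hD'
    have hD'ins : ∀ p, Insensitive a (D' p) := by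
      intro p y y' hyy hy
      simpa only [hD', Set.mem_ofPred_eq, hscongr p.1 y y' hyy] using hy
    have hsplit : ∀ g : X → (ι₀ ⊕ ι → Option α) → ℝ,
        avg (fun x => avg ((D x).indicator (g x))) =
          avg (fun x => avg fun y => avg ((R (s x y)).indicator fun z => g x (Sum.elim z y))) +
          avg (fun p : X × (ι₀ → Option α) =>
            avg ((D' p).indicator fun y => g p.1 (Sum.elim p.2 y))) := by
      intro g
      rw [avg_prod, ← avg_add]
      congr 1
      funext x
      rw [avg_sumElim, avg_comm (fun z y => (D' (x, z)).indicator (fun y => g x (Sum.elim z y)) y),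
        avg_comm, ← avg_add]
      congr 1
      funext y
      rw [← avg_add]
      congr 1
      funext z
      by_cases h1 : z ∈ s x y
      · by_cases h2 : z ∈ R (s x y) <;>
          simp [Set.indicator, hD', h1, h2, show Sum.elim z y ∈ D x from h1]
      · have h2 : z ∉ R (s x y) := fun h => h1 (hRD _ (hsD x y) h)
        simp [Set.indicator, hD', h1, h2, show Sum.elim z y ∉ D x from h1]
    have hRdens : (Nat.card (ι₀ → Option α) : ℝ)⁻¹ * (b / 2) ≤
        avg (fun x => avg fun y => density (R (s x y))) := by
      refine le_trans ?_ (avg_mono fun x => avg_mono fun y => hR _ (hsD x y))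
      simp only [avg_const_mul, avg_sub, avg_const]
      gcongr
      have : avg (fun x => avg fun y => density (s x y)) = avg fun x => density (D x) := by
        congr 1
        funext x
        rw [density_sumElim']
      rw [this]
      linarith
    have hdens' : avg (fun p => density (D' p)) ≤
        b + n * ((Nat.card (ι₀ → Option α) : ℝ)⁻¹ * (b / 2)) := by
      have := hsplit fun _ => 1
      change avg (fun x => density (D x)) = avg (fun x => avg fun y => density (R (s x y))) +
        avg (fun p => density (D' p)) at this
      push_cast at hdens
      linarith
    have hmain := K (X × (ι₀ → Option α)) (fun p y => f p.1 (Sum.elim p.2 y)) (fun _ _ => hf _ _)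
      (fun p U => by simpa only [constSum_apply] using hU p.1 (constSum p.2 U)) D' hD'ins hdens'
    have hneg : avg (fun x => avg fun y =>
        avg ((R (s x y)).indicator fun z => f x (Sum.elim z y))) ≤ 0 := by
      refine avg_le_of_le fun x => avg_le_of_le fun y => hRg _ (hsD x y) _ fun U => ?_
      simpa only [sumConst_apply] using hU x (sumConst U y)
    rw [hsplit f]
    linarith

/-- A function that is nonpositive on average on all subspaces of dimension `η` is almost
nonpositive on average on every insensitive set. -/
lemma DenseLine.avg_indicator_le_of_insensitive (h : DenseLine α) (a : α) (η : Type) [Finite η]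
    {b : ℝ} (hb : 0 < b) :
    ∃ (ι : Type) (_ : Finite ι), ∀ f : (ι → Option α) → ℝ, (∀ x, f x ≤ 1) →
      (∀ U : Subspace η (Option α) ι, avg (fun v => f (U v)) ≤ 0) →
      ∀ D : Set (ι → Option α), Insensitive a D → avg (D.indicator f) ≤ b := by
  obtain ⟨ι₀, hι₀, H⟩ := h.exists_subspace_of_insensitive a η (half_pos hb)
  have hc : 0 < (Nat.card (ι₀ → Option α) : ℝ)⁻¹ * (b / 2) := by
    have h2 : 0 < Nat.card (ι₀ → Option α) := Nat.card_pos
    positivity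
  obtain ⟨n, hn⟩ := exists_nat_ge (1 / ((Nat.card (ι₀ → Option α) : ℝ)⁻¹ * (b / 2)))
  obtain ⟨ι, hι, K⟩ := avg_indicator_le_of_insensitive_family hb H n
  refine ⟨ι, hι, fun f hf hU D hD => ?_⟩
  have := K Unit (fun _ => f) (fun _ => hf) (fun _ => hU) (fun _ => D) (fun _ => hD) ?_
  · simpa only [avg_const] using this
  · rw [avg_const]
    rw [div_le_iff₀ hc] at hn
    linarith [density_le_one D]

/-- A function that is nonpositive on average on all subspaces of dimension `η` is almost
nonpositive on average on every intersection of insensitive sets. -/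
lemma DenseLine.avg_indicator_iInter_le (h : DenseLine α) (s : Finset α) :
    ∀ (η : Type) [Finite η] {b : ℝ}, 0 < b →
    ∃ (ι : Type) (_ : Finite ι), ∀ f : (ι → Option α) → ℝ, (∀ x, f x ≤ 1) →
      (∀ U : Subspace η (Option α) ι, avg (fun v => f (U v)) ≤ 0) →
      ∀ D : α → Set (ι → Option α), (∀ a ∈ s, Insensitive a (D a)) →
        avg ((⋂ a ∈ s, D a).indicator f) ≤ b := by
  classical
  induction s using Finset.induction_on with
  | empty =>
    intro η _ b hb
    refine ⟨η, inferInstance, fun f hf hU D _ => ?_⟩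
    have h1 : avg f ≤ 0 := hU (fullSubspace _ _)
    simp only [Finset.notMem_empty, Set.iInter_of_empty, Set.iInter_univ, Set.indicator_univ]
    linarith
  | insert a s ha ih =>
    intro η _ b hb
    obtain ⟨ι₁, hι₁, H⟩ := ih η (half_pos hb)
    obtain ⟨ι, hι, K⟩ := h.avg_indicator_le_of_insensitive a ι₁ (half_pos hb)
    refine ⟨ι, hι, fun f hf hU D hD => ?_⟩
    have hle : ∀ x, (⋂ a ∈ s, D a).indicator f x ≤ 1 := fun x =>
      Set.indicator_apply_le' (fun _ => hf x) fun _ => zero_le_one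
    have h1 := K (fun x => (⋂ a ∈ s, D a).indicator f x - b / 2)
      (fun x => by linarith [hle x]) (fun V => ?_) (D a) (hD a (Finset.mem_insert_self _ _))
    · have h2 : avg ((⋂ c ∈ insert a s, D c).indicator f) ≤
          avg (fun x => (D a).indicator (fun x => (⋂ a ∈ s, D a).indicator f x - b / 2) x
            + b / 2) := by
        refine avg_mono fun x => ?_
        rw [Finset.set_biInter_insert]
        by_cases hx : x ∈ D a
        · by_cases hx' : x ∈ ⋂ a ∈ s, D a
          · rw [Set.indicator_of_mem (Set.mem_inter hx hx'), Set.indicator_of_mem hx,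
              Set.indicator_of_mem hx']
            linarith
          · rw [Set.indicator_of_notMem fun h => hx' (Set.mem_of_mem_inter_right h),
              Set.indicator_of_mem hx, Set.indicator_of_notMem hx']
            linarith
        · rw [Set.indicator_of_notMem fun h => hx (Set.mem_of_mem_inter_left h),
            Set.indicator_of_notMem hx]
          linarith
      rw [avg_add, avg_const] at h2
      linarith
    · rw [avg_sub, avg_const]
      have := H (fun v => f (V v)) (fun v => hf _)
        (fun U => by simpa only [comp_apply] using hU (comp V U))
        (fun c => {u | V u ∈ D c})
        fun c hc => (hD c (Finset.mem_insert_of_mem hc)).preimage V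
      have h3 : (⋂ c ∈ s, {u | V u ∈ D c}).indicator (fun v => f (V v)) =
          fun v => (⋂ a ∈ s, D a).indicator f (V v) := by
        funext v
        simp only [Set.indicator, Set.mem_iInter, Set.mem_ofPred_eq]
      rw [h3] at this
      linarith

end Insensitive

section Induction

lemma DenseLineAt.mono {α : Type} [Finite α] {δ δ' : ℝ} (h : DenseLineAt α δ) (hδ : δ ≤ δ') :
    DenseLineAt α δ' := by
  obtain ⟨ι, hι, H⟩ := h
  exact ⟨ι, hι, fun A hA => H A (hδ.trans hA)⟩

/-- If all sections of `A` are dense, then every subspace of dimension `M` contains a line all of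
whose points over `α` have a dense set of common extensions in `A`. -/
lemma exists_dense_common_extension {α M κ ι : Type} [Finite α] [Nonempty α] [Finite M] [Finite κ]
    [Finite ι] {c : ℝ} (hc : 0 < c)
    (hM : ∀ A : Set (M → α), c ≤ density A → ∃ l : Line α M, ∀ a, l a ∈ A)
    {A : Set (ι ⊕ κ → Option α)}
    (hA : ∀ x, c + c ≤ density {y : κ → Option α | Sum.elim x y ∈ A}) (V : Subspace M α ι) :
    ∃ u : M → Option α, (∃ j, u j = none) ∧ c / Nat.card (M → Option α) ≤
      density {y : κ → Option α | ∀ a : α,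
        Sum.elim (fun i => some (fill a (extend V u) i)) y ∈ A} := by
  have h1 : c + c ≤ avg fun y : κ → Option α =>
      density {x : M → α | Sum.elim (fun i => some (V x i)) y ∈ A} := by
    have : (avg fun y : κ → Option α =>
          density {x : M → α | Sum.elim (fun i => some (V x i)) y ∈ A})
        = avg fun x : M → α =>
          density {y : κ → Option α | Sum.elim (fun i => some (V x i)) y ∈ A} :=
      avg_comm _
    rw [this]
    exact le_avg_of_le fun x => hA _
  have h2 := le_density_setOf_le (fun y => density_le_one _) hc.le h1
  have hcover : {y : κ → Option α |
        c ≤ density {x : M → α | Sum.elim (fun i => some (V x i)) y ∈ A}}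
      ⊆ ⋃ u : M → Option α, {y | (∃ j, u j = none) ∧
        ∀ a : α, Sum.elim (fun i => some (fill a (extend V u) i)) y ∈ A} := by
    intro y hy
    obtain ⟨l, hl⟩ := hM _ hy
    refine Set.mem_iUnion.2 ⟨l.idxFun, l.proper, fun a => ?_⟩
    rw [fill_extend]
    exact hl a
  obtain ⟨u, hu⟩ := exists_density_ge hcover h2
  have hpos : 0 < c / Nat.card (M → Option α) := div_pos hc (by exact_mod_cast Nat.card_pos)
  obtain ⟨y, hy, -⟩ := nonempty_of_density_pos (hpos.trans_le hu)
  exact ⟨u, hy, hu.trans (density_mono fun y hy => hy.2)⟩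

lemma notMem_of_forall_fill_mem {α ι κ : Type} {A : Set (ι ⊕ κ → Option α)}
    (hA : ¬ ∃ l : Line (Option α) (ι ⊕ κ), ∀ b, l b ∈ A) {w : ι → Option α} (hw : ∃ i, w i = none)
    {y : κ → Option α} (h : ∀ a : α, Sum.elim (fun i => some (fill a w i)) y ∈ A) :
    Sum.elim w y ∉ A := by
  intro hmem
  obtain ⟨i, hi⟩ := hw
  refine hA ⟨⟨Sum.elim (fun i => (w i).map some) fun k => some (y k), Sum.inl i, by simp [hi]⟩, ?_⟩
  rintro (_ | a)
  · convert hmem using 1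
    funext j
    rcases j with j | j
    · cases h : w j <;> simp [h]
    · simp
  · convert h a using 1
    funext j
    rcases j with j | j
    · cases h : w j <;> simp [h, fill]
    · simp

/-- Averages over the complement of an intersection of insensitive sets are controlled by averages
over intersections of insensitive sets. -/
lemma avg_indicator_compl_iInter_le {α ι : Type} [Fintype α] [Finite ι] {b : ℝ} (hb : 0 ≤ b)
    {f : (ι → Option α) → ℝ}
    (H : ∀ D : α → Set (ι → Option α), (∀ a ∈ Finset.univ, Insensitive a (D a)) →
      avg ((⋂ a ∈ (Finset.univ : Finset α), D a).indicator f) ≤ b)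
    {D : α → Set (ι → Option α)} (hD : ∀ a, Insensitive a (D a)) :
    avg ({v | ∀ a, v ∈ D a}ᶜ.indicator f) ≤ 2 ^ Fintype.card α * b := by
  classical
  set E : Finset α → α → Set (ι → Option α) := fun J a => if a ∈ J then D a else (D a)ᶜ with hE
  have hmem : ∀ J v, v ∈ ⋂ a ∈ (Finset.univ : Finset α), E J a ↔
      J = Finset.univ.filter fun a => v ∈ D a := by
    intro J v
    simp only [Finset.mem_univ, Set.iInter_true, Set.mem_iInter, Finset.ext_iff, Finset.mem_filter,
      true_and]
    refine forall_congr' fun a => ?_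
    by_cases ha : a ∈ J <;> simp [hE, ha]
  have hsum : ∀ v, {v | ∀ a, v ∈ D a}ᶜ.indicator f v =
      ∑ J ∈ (Finset.univ : Finset (Finset α)).erase Finset.univ,
        (⋂ a ∈ (Finset.univ : Finset α), E J a).indicator f v := by
    intro v
    simp only [Set.indicator, hmem]
    rw [Finset.sum_ite_eq']
    congr 1
    simp [Finset.ext_iff]
  have : avg ({v | ∀ a, v ∈ D a}ᶜ.indicator f) =
      avg fun v => ∑ J ∈ (Finset.univ : Finset (Finset α)).erase Finset.univ,
        (⋂ a ∈ (Finset.univ : Finset α), E J a).indicator f v := by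
    congr 1
    exact funext hsum
  rw [this, avg_sum]
  refine (Finset.sum_le_card_nsmul _ _ b fun J _ => H (E J) fun a _ => ?_).trans ?_
  · by_cases ha : a ∈ J
    · simpa [hE, ha] using hD a
    · simpa [hE, ha] using (hD a).compl
  · rw [nsmul_eq_mul]
    gcongr
    calc ((((Finset.univ : Finset (Finset α)).erase Finset.univ).card : ℕ) : ℝ)
        ≤ ((Finset.univ : Finset (Finset α)).card : ℕ) := by
          exact_mod_cast Finset.card_le_card (Finset.erase_subset _ _)
      _ = 2 ^ Fintype.card α := by simp

lemma DenseLine.option_of_nonempty {α : Type} [Finite α] [Nonempty α] (h : DenseLine α) :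
    DenseLine (Option α) := by
  have := Fintype.ofFinite α
  by_contra hcon
  simp only [DenseLine, not_forall] at hcon
  obtain ⟨δ, hδ, hcon⟩ := hcon
  set good : Set ℝ := {c | DenseLineAt (Option α) c} with hgood
  have hbdd : δ ∈ lowerBounds good := fun c hc => le_of_not_gt fun hlt => hcon (hc.mono hlt.le)
  have hne : good.Nonempty := ⟨2, Unit, inferInstance, fun A hA => by
    linarith [density_le_one A]⟩
  set δ₀ := sInf good with hδ₀
  have hδ₀pos : 0 < δ₀ := hδ.trans_le (le_csInf hne hbdd)
  have hup : ∀ ε > 0, DenseLineAt (Option α) (δ₀ + ε) := by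
    intro ε hε
    obtain ⟨c, hc, hlt⟩ := exists_lt_of_csInf_lt hne (lt_add_of_pos_right δ₀ hε)
    exact DenseLineAt.mono hc hlt.le
  have hlow : ∀ ε > 0, ¬ DenseLineAt (Option α) (δ₀ - ε) := by
    intro ε hε hd
    have : δ₀ ≤ δ₀ - ε := csInf_le ⟨δ, hbdd⟩ hd
    linarith
  obtain ⟨M, hMfin, hM⟩ := h (δ₀ / 4) (by positivity)
  have hcardM : (0 : ℝ) < Nat.card (M → Option α) := by exact_mod_cast Nat.card_pos
  set θ : ℝ := δ₀ / 4 / Nat.card (M → Option α) with hθ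
  have hθpos : 0 < θ := by positivity
  set γ : ℝ := θ * δ₀ / 4 with hγ
  have hγpos : 0 < γ := by positivity
  obtain ⟨η, hηfin, hη⟩ := hup γ hγpos
  obtain ⟨d, hdfin, hd⟩ := h.avg_indicator_iInter_le Finset.univ η
    (b := γ / 2 ^ Fintype.card α) (by positivity)
  obtain ⟨ι, hιfin, hι⟩ := exists_subspace_of_forall_exists_line (α := α) M Unit d
  have hcardι : (0 : ℝ) < Nat.card (ι → Option α) := by exact_mod_cast Nat.card_pos
  set ε : ℝ := min γ (δ₀ / 2) with hε
  have hεpos : 0 < ε := by positivity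
  set ε' : ℝ := ε / (2 * Nat.card (ι → Option α)) with hε'
  have hε'pos : 0 < ε' := by positivity
  obtain ⟨κ, hκfin, hκ⟩ := hup ε' hε'pos
  refine hlow ε' hε'pos ⟨ι ⊕ κ, inferInstance, fun A hA => ?_⟩
  by_contra hline
  have hsec_lt : ∀ x : ι → Option α, density {y : κ → Option α | Sum.elim x y ∈ A} ≤ δ₀ + ε' := by
    intro x
    by_contra! hlt
    obtain ⟨l, hl⟩ := hκ _ hlt.le
    refine hline ⟨compLine (constSum x (fullSubspace κ (Option α))) l, fun b => ?_⟩
    rw [compLine_apply, constSum_apply, fullSubspace_apply]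
    exact hl b
  have hsec : ∀ x : ι → Option α, δ₀ - ε ≤ density {y : κ → Option α | Sum.elim x y ∈ A} := by
    intro x
    have h1 := inv_card_mul_le_avg (fun x => sub_nonneg.2 (hsec_lt x)) x
    rw [avg_sub, avg_const, ← density_sumElim, inv_mul_le_iff₀ hcardι] at h1
    have h2 : Nat.card (ι → Option α) * (δ₀ + ε' - density A) ≤
        Nat.card (ι → Option α) * (2 * ε') := by gcongr; linarith
    have h3 : Nat.card (ι → Option α) * (2 * ε') = ε := by rw [hε']; field_simp
    linarith
  have hεle : ε ≤ δ₀ / 2 := min_le_right _ _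
  have hεγ : ε ≤ γ := min_le_left _ _
  obtain ⟨-, Z, hZnone, hZ⟩ := hι (fun _ w => θ ≤ density {y : κ → Option α | ∀ a : α,
    Sum.elim (fun i => some (fill a w i)) y ∈ A}) fun V => ⟨(), exists_dense_common_extension
      (by positivity) hM (fun x => by linarith [hsec x]) V⟩
  obtain ⟨i₀, hi₀⟩ := hZnone
  have hZi₀ : ∀ v, Z v i₀ = none := fun v => Subspace.apply_inl hi₀
  set D : (κ → Option α) → α → Set (d → Option α) :=
    fun y a => {v | Sum.elim (fun i => some (fill a (Z v) i)) y ∈ A} with hD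
  have hDins : ∀ y a, Insensitive a (D y a) := by
    intro y a u v huv hu
    simpa only [hD, Set.mem_ofPred_eq, fill_subspace_congr Z huv] using hu
  set f : (κ → Option α) → (d → Option α) → ℝ :=
    fun y v => A.indicator 1 (Sum.elim (Z v) y) - (δ₀ + γ) with hf
  have hkey : ∀ y, avg ({v | ∀ a, v ∈ D y a}ᶜ.indicator (f y)) ≤ γ := by
    intro y
    refine (avg_indicator_compl_iInter_le (b := γ / 2 ^ Fintype.card α) (by positivity)
      (fun E hE => hd (f y) (fun v => ?_) (fun U => ?_) E hE) (hDins y)).trans_eq ?_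
    · simp only [hf]
      linarith [indicator_one_le_one A (Sum.elim (Z v) y)]
    · by_contra! hlt
      simp only [hf] at hlt
      rw [avg_sub, avg_const, sub_pos] at hlt
      obtain ⟨l, hl⟩ := hη {v | Sum.elim (Z (U v)) y ∈ A} hlt.le
      refine hline ⟨compLine (sumConst (comp Z U) y) l, fun b => ?_⟩
      rw [compLine_apply, sumConst_apply, comp_apply]
      exact hl b
    · field_simp
  have hpoint : ∀ y v, {v | ∀ a, v ∈ D y a}ᶜ.indicator (f y) v =
      A.indicator 1 (Sum.elim (Z v) y) -
        (δ₀ + γ) * (1 - {y : κ → Option α | ∀ a : α,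
          Sum.elim (fun i => some (fill a (Z v) i)) y ∈ A}.indicator 1 y) := by
    intro y v
    by_cases hv : ∀ a, v ∈ D y a
    · have hA' : Sum.elim (Z v) y ∉ A := notMem_of_forall_fill_mem hline ⟨i₀, hZi₀ v⟩ hv
      rw [Set.indicator_of_notMem (show v ∉ {v | ∀ a, v ∈ D y a}ᶜ from fun h => h hv),
        Set.indicator_of_notMem hA',
        Set.indicator_of_mem (show y ∈ {y : κ → Option α | ∀ a : α,
          Sum.elim (fun i => some (fill a (Z v) i)) y ∈ A} from hv)]
      simp
    · rw [Set.indicator_of_mem (show v ∈ {v | ∀ a, v ∈ D y a}ᶜ from hv),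
        Set.indicator_of_notMem (show y ∉ {y : κ → Option α | ∀ a : α,
          Sum.elim (fun i => some (fill a (Z v) i)) y ∈ A} from hv)]
      simp [hf]
  have htotal := avg_le_of_le hkey
  have hswap : (avg fun y => avg ({v | ∀ a, v ∈ D y a}ᶜ.indicator (f y))) =
      avg fun v => avg fun y => A.indicator 1 (Sum.elim (Z v) y) -
        (δ₀ + γ) * (1 - {y : κ → Option α | ∀ a : α,
          Sum.elim (fun i => some (fill a (Z v) i)) y ∈ A}.indicator 1 y) := by
    rw [avg_comm]
    simp only [hpoint]
  have hge : δ₀ - ε - (δ₀ + γ) * (1 - θ) ≤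
      avg fun y => avg ({v | ∀ a, v ∈ D y a}ᶜ.indicator (f y)) := by
    rw [hswap]
    refine le_avg_of_le fun v => ?_
    rw [avg_sub, avg_const_mul, avg_sub, avg_const]
    have h1 := hsec (Z v)
    have h2 := hZ v
    gcongr
    · exact h1
    · exact h2
  have : θ * δ₀ = 4 * γ := by rw [hγ]; ring
  nlinarith [mul_pos hθpos hγpos]

lemma DenseLine.option {α : Type} [Finite α] (h : DenseLine α) : DenseLine (Option α) := by
  rcases isEmpty_or_nonempty α with hα | hα
  · refine fun δ hδ => ⟨Unit, inferInstance, fun A hA => ?_⟩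
    obtain ⟨x, hx⟩ := nonempty_of_density_pos (hδ.trans_le hA)
    refine ⟨Line.diagonal _ _, fun a => ?_⟩
    convert hx
    exact Subsingleton.elim _ _
  · exact h.option_of_nonempty

/-- The density Hales–Jewett theorem, for alphabets of every finite size. -/
theorem exists_denseLine (k : ℕ) :
    ∃ (α : Type) (_ : Finite α), Nat.card α = k ∧ DenseLine α := by
  induction k with
  | zero =>
    refine ⟨PEmpty, inferInstance, by simp, fun δ hδ => ⟨Unit, inferInstance, fun A hA => ?_⟩⟩
    rw [density, avg_of_isEmpty] at hA
    linarith
  | succ k ih =>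
    obtain ⟨α, hα, hk, h⟩ := ih
    have := Fintype.ofFinite α
    exact ⟨Option α, inferInstance, by simp [← hk], h.option⟩

end Induction

section Recurrence

lemma sum_fill {α ι : Type*} [Fintype ι] [DecidableEq α] (e : α → ℕ) (u : ι → Option α) (a : α) :
    ∑ i, e (fill a u i) =
      ∑ i, (u i).elim 0 e + (Finset.univ.filter fun i => u i = none).card * e a := by
  rw [Finset.card_filter, Finset.sum_mul, ← Finset.sum_add_distrib]
  refine Finset.sum_congr rfl fun i _ => ?_
  cases h : u i <;> simp [fill, h]

/-- A uniform form of multiple recurrence. -/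
theorem exists_le_measureReal_iInter {X : Type*} [MeasurableSpace X] {μ : Measure X}
    [IsProbabilityMeasure μ] {T : X → X} (hT : MeasurePreserving T μ μ) {A : Set X}
    (hA : MeasurableSet A) (hμA : 0 < μ A) {k : ℕ} (hk : 0 < k) :
    ∃ (n : ℕ) (c : ℝ), 0 < c ∧ ∀ d : ℕ, ∃ r, 1 ≤ r ∧ r ≤ n ∧
      c ≤ μ.real (⋂ i ∈ Finset.range k, T^[i * (d * r)] ⁻¹' A) := by
  classical
  obtain ⟨α, hα, hcard, h⟩ := exists_denseLine k
  have hαne : Nonempty α := (Nat.card_pos_iff.1 (hcard ▸ hk)).1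
  have := Fintype.ofFinite α
  set e : α ≃ Fin k := Finite.equivFinOfCardEq hcard with he
  set δ : ℝ := μ.real A with hδ
  have hδpos : 0 < δ := ENNReal.toReal_pos hμA.ne' (measure_ne_top _ _)
  obtain ⟨ι, hι, H⟩ := h (δ / 2) (half_pos hδpos)
  have := Fintype.ofFinite ι
  have hcardpos : (0 : ℝ) < Nat.card (ι → Option α) := by exact_mod_cast Nat.card_pos
  refine ⟨Fintype.card ι, δ / 2 / Nat.card (ι → Option α), by positivity, fun d => ?_⟩
  set s : (ι → α) → ℕ := fun x => d * ∑ i, (e (x i) : ℕ) with hs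
  have hTm : ∀ m, MeasurableSet (T^[m] ⁻¹' A) := fun m => (hT.iterate m).measurable hA
  set E : (ι → Option α) → Set X :=
    fun u => {ω | (∃ j, u j = none) ∧ ∀ a, ω ∈ T^[s (fill a u)] ⁻¹' A} with hE
  have hEm : ∀ u, MeasurableSet (E u) := by
    intro u
    by_cases hu : ∃ j, u j = none
    · have : E u = ⋂ a, T^[s (fill a u)] ⁻¹' A := by
        ext ω
        simp [hE, hu]
      rw [this]
      exact MeasurableSet.iInter fun a => hTm _
    · have : E u = ∅ := by
        ext ω
        simp only [hE, hu, false_and]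
        rfl
      rw [this]
      exact MeasurableSet.empty
  have hpoint : ∀ ω, avg (fun x => (T^[s x] ⁻¹' A).indicator (1 : X → ℝ) ω) ≤
      δ / 2 + ∑ u, (E u).indicator (1 : X → ℝ) ω := by
    intro ω
    have hnonneg : ∀ u, 0 ≤ (E u).indicator (1 : X → ℝ) ω := fun u => indicator_one_nonneg _ _
    rcases lt_or_ge (density {x | ω ∈ T^[s x] ⁻¹' A}) (δ / 2) with hlt | hge
    · have h2 := Finset.sum_nonneg fun u (_ : u ∈ Finset.univ) => hnonneg u
      have h3 : avg (fun x => (T^[s x] ⁻¹' A).indicator (1 : X → ℝ) ω) < δ / 2 := hlt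
      linarith
    · obtain ⟨l, hl⟩ := H _ hge
      have hmem : ω ∈ E l.idxFun := ⟨l.proper, hl⟩
      have h1 := Finset.single_le_sum (fun u _ => hnonneg u) (Finset.mem_univ l.idxFun)
      rw [Set.indicator_of_mem hmem, Pi.one_apply] at h1
      have h3 := avg_le_of_le fun x => indicator_one_le_one (T^[s x] ⁻¹' A) ω
      linarith
  have hInt : ∀ B : Set X, MeasurableSet B → Integrable (B.indicator (1 : X → ℝ)) μ :=
    fun B hB => (integrable_const (1 : ℝ)).indicator hB
  have hInt_avg : ∫ ω, avg (fun x => (T^[s x] ⁻¹' A).indicator (1 : X → ℝ) ω) ∂μ = δ := by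
    simp only [avg_eq_sum_div]
    rw [integral_div, integral_finsetSum _ fun x _ => hInt _ (hTm _)]
    have : ∀ x, ∫ ω, (T^[s x] ⁻¹' A).indicator (1 : X → ℝ) ω ∂μ = δ := by
      intro x
      rw [integral_indicator_one (hTm _), (hT.iterate _).measureReal_preimage hA.nullMeasurableSet]
    simp [this]
  have hle : δ ≤ δ / 2 + ∑ u, μ.real (E u) := by
    calc δ = ∫ ω, avg (fun x => (T^[s x] ⁻¹' A).indicator (1 : X → ℝ) ω) ∂μ := hInt_avg.symm
      _ ≤ ∫ ω, (δ / 2 + ∑ u, (E u).indicator (1 : X → ℝ) ω) ∂μ := by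
        refine integral_mono ?_ ?_ hpoint
        · simp only [avg_eq_sum_div]
          exact (integrable_finsetSum _ fun x _ => hInt _ (hTm _)).div_const _
        · exact (integrable_const _).add (integrable_finsetSum _ fun u _ => hInt _ (hEm u))
      _ = δ / 2 + ∑ u, μ.real (E u) := by
        rw [integral_add (integrable_const _) (integrable_finsetSum _ fun u _ => hInt _ (hEm u)),
          integral_finsetSum _ fun u _ => hInt _ (hEm u)]
        simp [integral_indicator_one (hEm _)]
  obtain ⟨u, hu⟩ := exists_le_of_le_avg (f := fun u => μ.real (E u))
    (c := δ / 2 / Nat.card (ι → Option α)) (by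
      rw [avg_eq_sum_div]
      gcongr
      linarith)
  have hpos : 0 < μ.real (E u) := lt_of_lt_of_le (by positivity) hu
  have hEne : (E u).Nonempty := by
    by_contra hne
    rw [Set.not_nonempty_iff_eq_empty] at hne
    simp [hne] at hpos
  obtain ⟨-, ⟨j, hj⟩, -⟩ := hEne
  refine ⟨(Finset.univ.filter fun i => u i = none).card, ?_, Finset.card_le_univ _, ?_⟩
  · exact Finset.card_pos.2 ⟨j, by simp [hj]⟩
  · set r := (Finset.univ.filter fun i => u i = none).card with hr
    refine hu.trans_eq ?_
    have hB : MeasurableSet (⋂ i ∈ Finset.range k, T^[i * (d * r)] ⁻¹' A) :=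
      Finset.measurableSet_biInter _ fun i _ => hTm _
    rw [← (hT.iterate (d * ∑ i, (u i).elim 0 fun a => (e a : ℕ))).measureReal_preimage
      hB.nullMeasurableSet]
    congr 1
    ext ω
    have hiff : (∀ a : α, ω ∈ T^[s (fill a u)] ⁻¹' A) ↔
        ∀ i < k, T^[i * (d * r)] (T^[d * ∑ i, (u i).elim 0 fun a => (e a : ℕ)] ω) ∈ A := by
      have hsum : ∀ a, s (fill a u) =
          (e a : ℕ) * (d * r) + d * ∑ i, (u i).elim 0 fun a => (e a : ℕ) := by
        intro a
        simp only [hs]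
        rw [sum_fill (fun a => (e a : ℕ)) u a]
        ring
      constructor
      · intro h i hi
        have := h (e.symm ⟨i, hi⟩)
        rw [hsum, Set.mem_preimage, Function.iterate_add_apply] at this
        simpa using this
      · intro h a
        rw [hsum, Set.mem_preimage, Function.iterate_add_apply]
        exact h _ (e a).2
    simpa [hE, show ∃ j, u j = none from ⟨j, hj⟩] using hiff

/-- A nonnegative sequence that is bounded below along some bounded multiple of every natural
number does not have averages tending to zero. -/
lemma not_tendsto_average_zero {a : ℕ → ℝ} (ha : ∀ n, 0 ≤ a n) {n : ℕ} {c : ℝ} (hc : 0 < c)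
    (h : ∀ d : ℕ, ∃ r, 1 ≤ r ∧ r ≤ n ∧ c ≤ a (d * r)) :
    ¬ Filter.Tendsto (fun N : ℕ => (∑ m ∈ Finset.range N, a m) / N) Filter.atTop (nhds 0) := by
  intro hlim
  have hn : 1 ≤ n := by
    obtain ⟨r, h1, h2, -⟩ := h 0
    exact h1.trans h2
  choose r hr1 hrn hr using h
  have hbound : ∀ N : ℕ, c * N ≤ n * ∑ m ∈ Finset.range (n * N), a m := by
    intro N
    calc c * N = ∑ d ∈ Finset.range N, c := by simp [mul_comm]
      _ ≤ ∑ d ∈ Finset.range N, a (d * r d) := Finset.sum_le_sum fun d _ => hr d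
      _ ≤ ∑ d ∈ Finset.range N, ∑ q ∈ Finset.Icc 1 n, a (d * q) := by
        refine Finset.sum_le_sum fun d _ => ?_
        exact Finset.single_le_sum (f := fun q => a (d * q)) (fun q _ => ha _)
          (Finset.mem_Icc.2 ⟨hr1 d, hrn d⟩)
      _ = ∑ q ∈ Finset.Icc 1 n, ∑ d ∈ Finset.range N, a (d * q) := Finset.sum_comm
      _ ≤ ∑ q ∈ Finset.Icc 1 n, ∑ m ∈ Finset.range (n * N), a m := by
        refine Finset.sum_le_sum fun q hq => ?_
        rw [Finset.mem_Icc] at hq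
        rw [← Finset.sum_image (f := a) (g := fun d => d * q)
          fun x _ y _ hxy => Nat.eq_of_mul_eq_mul_right hq.1 hxy]
        refine Finset.sum_le_sum_of_subset_of_nonneg ?_ fun m _ _ => ha m
        intro m hm
        obtain ⟨d, hd, rfl⟩ := Finset.mem_image.1 hm
        rw [Finset.mem_range] at hd ⊢
        nlinarith
      _ = n * ∑ m ∈ Finset.range (n * N), a m := by simp
  have hn0 : (0 : ℝ) < n := by exact_mod_cast hn
  have hev := (hlim.eventually (gt_mem_nhds (show 0 < c / (n * n) by positivity)))
  obtain ⟨N₀, hN₀⟩ := Filter.eventually_atTop.1 hev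
  have h1 := hN₀ (n * (N₀ + 1)) (by nlinarith)
  have h2 := hbound (N₀ + 1)
  have hpos : (0 : ℝ) < (n * (N₀ + 1) : ℕ) := by push_cast; positivity
  rw [div_lt_div_iff₀ hpos (by positivity)] at h1
  push_cast at h1 h2
  have h3 := mul_le_mul_of_nonneg_left h2 hn0.le
  linarith

end Recurrence

section VanDerCorput

open Filter Topology ComplexConjugate

/-- The averages of the sequence tend to zero. -/
def NullAverages {E : Type*} [SeminormedAddCommGroup E] (x : ℕ → E) : Prop :=
  Tendsto (fun N : ℕ => ‖∑ n ∈ Finset.range N, x n‖ / N) atTop (𝓝 0)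

lemma norm_sum_shift_sub_le {E : Type*} [SeminormedAddCommGroup E] {x : ℕ → E}
    (hx : ∀ n, ‖x n‖ ≤ 1) (h N : ℕ) :
    ‖∑ n ∈ Finset.range N, x (n + h) - ∑ n ∈ Finset.range N, x n‖ ≤ 2 * h := by
  have h1 := Finset.sum_range_add x h N
  rw [add_comm h N, Finset.sum_range_add] at h1
  have h2 : ∑ n ∈ Finset.range N, x (n + h) - ∑ n ∈ Finset.range N, x n =
      ∑ n ∈ Finset.range h, x (N + n) - ∑ n ∈ Finset.range h, x n := by
    simp only [add_comm _ h]
    rw [sub_eq_sub_iff_add_eq_add, add_comm, ← h1, add_comm]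
  have h3 : ∀ y : ℕ → E, (∀ n, ‖y n‖ ≤ 1) → ‖∑ n ∈ Finset.range h, y n‖ ≤ h := by
    intro y hy
    simpa using norm_sum_le_of_le (Finset.range h) fun n _ => hy n
  rw [h2, two_mul]
  exact (norm_sub_le _ _).trans (add_le_add (h3 _ fun n => hx _) (h3 _ hx))

lemma NullAverages.shift {E : Type*} [SeminormedAddCommGroup E] {x : ℕ → E}
    (hx : ∀ n, ‖x n‖ ≤ 1) (h0 : NullAverages x) (h : ℕ) : NullAverages fun n => x (n + h) := by
  have h1 : Tendsto (fun N : ℕ => ‖∑ n ∈ Finset.range N, x n‖ / N + (2 * h : ℝ) / N) atTop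
      (𝓝 (0 + 0)) := h0.add (tendsto_const_div_atTop_nhds_zero_nat _)
  rw [add_zero] at h1
  refine squeeze_zero (fun N => by positivity) (fun N => ?_) h1
  rw [← add_div]
  gcongr
  have := norm_sum_shift_sub_le hx h N
  have h2 := norm_sub_norm_le (∑ n ∈ Finset.range N, x (n + h)) (∑ n ∈ Finset.range N, x n)
  linarith

/-- The van der Corput lemma. -/
lemma nullAverages_of_inner {E : Type*} [SeminormedAddCommGroup E] [InnerProductSpace ℂ E]
    {u : ℕ → E} (hu : ∀ n, ‖u n‖ ≤ 1)
    (h : ∀ h : ℕ, 1 ≤ h → NullAverages fun n => inner ℂ (u n) (u (n + h))) : NullAverages u := by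
  have hle : ∀ m n, ‖inner ℂ (u m) (u n)‖ ≤ 1 := fun m n =>
    (norm_inner_le_norm _ _).trans (mul_le_one₀ (hu m) (norm_nonneg _) (hu n))
  have hcorr : ∀ i j : ℕ, i ≠ j → NullAverages fun n => inner ℂ (u (n + i)) (u (n + j)) := by
    have hlt : ∀ i j : ℕ, i < j → NullAverages fun n => inner ℂ (u (n + i)) (u (n + j)) := by
      intro i j hij
      obtain ⟨d, rfl⟩ := Nat.exists_eq_add_of_lt hij
      have := (h (d + 1) (by omega)).shift (fun n => hle _ _) i
      have heq : ∀ n, n + i + (d + 1) = n + (i + d + 1) := fun n => by omega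
      simpa only [heq] using this
    intro i j hij
    rcases lt_or_gt_of_ne hij with hij | hij
    · exact hlt i j hij
    · have := hlt j i hij
      unfold NullAverages at this ⊢
      convert this using 3 with N
      rw [← RCLike.norm_conj, map_sum]
      simp only [inner_conj_symm]
  refine Metric.tendsto_atTop.2 fun ε hε => ?_
  obtain ⟨K, hK⟩ := exists_nat_gt (8 / ε ^ 2)
  have hKpos : (0 : ℝ) < K := lt_trans (by positivity) hK
  have hpair : ∀ᶠ N : ℕ in atTop, ∀ i ∈ Finset.range K, ∀ j ∈ Finset.range K,
      ‖∑ n ∈ Finset.range N, inner ℂ (u (n + i)) (u (n + j))‖ / N ≤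
        (if i = j then 1 else 0) + 1 / (K : ℝ) := by
    refine (Finset.eventually_all _).2 fun i _ => (Finset.eventually_all _).2 fun j _ => ?_
    split_ifs with hij
    · refine Eventually.of_forall fun N => ?_
      have : ‖∑ n ∈ Finset.range N, inner ℂ (u (n + i)) (u (n + j))‖ ≤ N := by
        simpa using norm_sum_le_of_le (Finset.range N) fun n _ => hle (n + i) (n + j)
      have h2 := div_le_one_of_le₀ this (Nat.cast_nonneg N)
      have h3 : 0 ≤ 1 / (K : ℝ) := by positivity
      linarith
    · rw [zero_add]
      exact (hcorr i j hij).eventually (ge_mem_nhds (by positivity))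
  obtain ⟨N₀, hN₀⟩ := eventually_atTop.1 hpair
  obtain ⟨N₁, hN₁⟩ := exists_nat_gt (4 * K / ε)
  refine ⟨max N₀ (N₁ + 1), fun N hN => ?_⟩
  have hNN₀ : N₀ ≤ N := (le_max_left _ _).trans hN
  have hNN₁ : N₁ + 1 ≤ N := (le_max_right _ _).trans hN
  have hNpos : (0 : ℝ) < N := by exact_mod_cast (Nat.succ_pos _).trans_le hNN₁
  have hNbig : 4 * K / ε < N := hN₁.trans (by exact_mod_cast hNN₁)
  set v : ℕ → E := fun n => ∑ i ∈ Finset.range K, u (n + i) with hv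
  have hdiff : ‖∑ n ∈ Finset.range N, v n - (K : ℂ) • ∑ n ∈ Finset.range N, u n‖ ≤
      K * (2 * K) := by
    have : ∑ n ∈ Finset.range N, v n - (K : ℂ) • ∑ n ∈ Finset.range N, u n =
        ∑ i ∈ Finset.range K,
          (∑ n ∈ Finset.range N, u (n + i) - ∑ n ∈ Finset.range N, u n) := by
      rw [Finset.sum_sub_distrib, Finset.sum_comm, Nat.cast_smul_eq_nsmul]
      simp
    rw [this]
    refine (norm_sum_le_of_le _ fun i hi => (norm_sum_shift_sub_le hu i N).trans
      (show (2 * i : ℝ) ≤ 2 * K from ?_)).trans_eq (by simp)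
    rw [Finset.mem_range] at hi
    gcongr
  have hnormv : ∑ n ∈ Finset.range N, ‖v n‖ ^ 2 ≤ 2 * K * N := by
    calc ∑ n ∈ Finset.range N, ‖v n‖ ^ 2
        = RCLike.re (∑ i ∈ Finset.range K, ∑ j ∈ Finset.range K, ∑ n ∈ Finset.range N,
            inner ℂ (u (n + i)) (u (n + j))) := by
          simp only [← inner_self_eq_norm_sq (𝕜 := ℂ), hv, sum_inner, inner_sum, map_sum]
          rw [Finset.sum_comm]
          refine Finset.sum_congr rfl fun i _ => ?_
          rw [Finset.sum_comm]
          simp only [inner_re_symm (𝕜 := ℂ) _ (u (_ + i))]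
      _ ≤ ‖∑ i ∈ Finset.range K, ∑ j ∈ Finset.range K, ∑ n ∈ Finset.range N,
            inner ℂ (u (n + i)) (u (n + j))‖ := RCLike.re_le_norm _
      _ ≤ ∑ i ∈ Finset.range K, ∑ j ∈ Finset.range K,
            ((if i = j then 1 else 0) + 1 / (K : ℝ)) * N := by
          refine norm_sum_le_of_le _ fun i hi => norm_sum_le_of_le _ fun j hj => ?_
          exact (div_le_iff₀ hNpos).1 (hN₀ N hNN₀ i hi j hj)
      _ = 2 * K * N := by
          simp only [← Finset.sum_mul, Finset.sum_add_distrib]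
          congr 1
          have : ∑ i ∈ Finset.range K, ∑ j ∈ Finset.range K,
              (if i = j then (1 : ℝ) else 0) = K := by
            simp only [Finset.sum_ite_eq]
            rw [Finset.sum_congr rfl fun i hi => if_pos hi]
            simp
          rw [this]
          simp
          field_simp
          ring
  have hsumv : ‖∑ n ∈ Finset.range N, v n‖ ^ 2 ≤ N * (2 * K * N) := by
    calc ‖∑ n ∈ Finset.range N, v n‖ ^ 2 ≤ (∑ n ∈ Finset.range N, ‖v n‖) ^ 2 := by
          gcongr
          exact norm_sum_le _ _
      _ ≤ (Finset.range N).card * ∑ n ∈ Finset.range N, ‖v n‖ ^ 2 := sq_sum_le_card_mul_sum_sq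
      _ ≤ N * (2 * K * N) := by
          rw [Finset.card_range]
          gcongr
  have hsumv' : ‖∑ n ∈ Finset.range N, v n‖ ≤ K * N * ε / 2 := by
    refine abs_le_of_sq_le_sq' (hsumv.trans ?_) (by positivity) |>.2
    rw [div_lt_iff₀ (by positivity)] at hK
    have : 0 ≤ K * N ^ 2 * (K * ε ^ 2 - 8) := mul_nonneg (by positivity) (by linarith)
    nlinarith
  have hfinal : K * ‖∑ n ∈ Finset.range N, u n‖ ≤ K * (2 * K) + K * N * ε / 2 := by
    have h1 := norm_sub_norm_le ((K : ℂ) • ∑ n ∈ Finset.range N, u n) (∑ n ∈ Finset.range N, v n)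
    rw [norm_sub_rev, norm_smul, Complex.norm_natCast] at h1
    linarith
  rw [div_lt_iff₀ hε] at hNbig
  rw [dist_zero_right, Real.norm_of_nonneg (by positivity), div_lt_iff₀ hNpos]
  have h4 : K * ‖∑ n ∈ Finset.range N, u n‖ < K * (ε * N) := by nlinarith
  exact lt_of_mul_lt_mul_left h4 hKpos.le

/-- A weak form of the van der Corput lemma for bounded functions. -/
lemma nullAverages_integral_mul {X : Type*} [MeasurableSpace X] {μ : Measure X}
    [IsProbabilityMeasure μ] {u : ℕ → X → ℂ} (hum : ∀ n, Measurable (u n))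
    (hu : ∀ n x, ‖u n x‖ ≤ 1)
    (h : ∀ h : ℕ, 1 ≤ h → NullAverages fun n => ∫ x, conj (u n x) * u (n + h) x ∂μ)
    {g : X → ℂ} (hgm : Measurable g) (hg : ∀ x, ‖g x‖ ≤ 1) :
    NullAverages fun n => ∫ x, g x * u n x ∂μ := by
  have hmem : ∀ w : X → ℂ, Measurable w → (∀ x, ‖w x‖ ≤ 1) → MemLp w 2 μ := fun w hw hb =>
    MemLp.of_bound hw.aestronglyMeasurable 1 (Eventually.of_forall hb)
  have hnorm : ∀ (w : X → ℂ) (hw : Measurable w) (hb : ∀ x, ‖w x‖ ≤ 1),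
      ‖(hmem w hw hb).toLp w‖ ≤ 1 := by
    intro w hw hb
    rw [Lp.norm_toLp]
    refine ENNReal.toReal_le_of_le_ofReal zero_le_one
      ((eLpNorm_le_of_ae_bound (Eventually.of_forall hb)).trans_eq ?_)
    simp
  have hinner : ∀ (w z : X → ℂ) (hw : MemLp w 2 μ) (hz : MemLp z 2 μ),
      inner ℂ (hw.toLp w) (hz.toLp z) = ∫ x, conj (w x) * z x ∂μ := by
    intro w z hw hz
    rw [L2.inner_def]
    refine integral_congr_ae ?_
    filter_upwards [hw.coeFn_toLp, hz.coeFn_toLp] with x h1 h2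
    rw [h1, h2, RCLike.inner_apply, mul_comm]
  set U : ℕ → Lp ℂ 2 μ := fun n => (hmem (u n) (hum n) (hu n)).toLp (u n) with hU
  have hgcm : Measurable fun x => conj (g x) := Complex.continuous_conj.measurable.comp hgm
  have hgc : ∀ x, ‖conj (g x)‖ ≤ 1 := fun x => by rw [RCLike.norm_conj]; exact hg x
  set G : Lp ℂ 2 μ := (hmem _ hgcm hgc).toLp _ with hG
  have hUnull : NullAverages U := by
    refine nullAverages_of_inner (fun n => hnorm _ (hum n) (hu n)) fun j hj => ?_
    simpa only [hU, hinner] using h j hj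
  refine squeeze_zero (fun N => by positivity) (fun N => ?_) hUnull
  gcongr
  have h1 : ∑ n ∈ Finset.range N, ∫ x, g x * u n x ∂μ = inner ℂ G (∑ n ∈ Finset.range N, U n) := by
    rw [inner_sum]
    refine Finset.sum_congr rfl fun n _ => ?_
    rw [hG, hU, hinner]
    simp only [RCLike.conj_conj]
  rw [h1]
  refine (norm_inner_le_norm _ _).trans ?_
  exact mul_le_of_le_one_left (norm_nonneg _) (hnorm _ hgcm hgc)

end VanDerCorput

section Weights

open Filter Topology ComplexConjugate Polynomial

/-- The character `t ↦ exp (2πit)`. -/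
noncomputable def phase (t : ℝ) : ℂ := Complex.exp ((2 * Real.pi * t : ℝ) * Complex.I)

lemma norm_phase (t : ℝ) : ‖phase t‖ = 1 := Complex.norm_exp_ofReal_mul_I _

lemma phase_add (s t : ℝ) : phase (s + t) = phase s * phase t := by
  rw [phase, phase, phase, ← Complex.exp_add]
  congr 1
  push_cast
  ring

lemma phase_natCast_mul (n : ℕ) (t : ℝ) : phase (n * t) = phase t ^ n := by
  rw [phase, phase, ← Complex.exp_nat_mul]
  congr 1
  push_cast
  ring

lemma conj_phase_mul (s t : ℝ) : conj (phase s) * phase t = phase (t - s) := by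
  rw [phase, phase, phase, ← Complex.exp_conj, ← Complex.exp_add]
  congr 1
  rw [map_mul, Complex.conj_ofReal, Complex.conj_I]
  push_cast
  ring

lemma phase_re (t : ℝ) : (phase t).re = Real.cos (2 * Real.pi * t) :=
  Complex.exp_ofReal_mul_I_re _

lemma phase_ne_one {t : ℝ} (ht : Irrational t) : phase t ≠ 1 := by
  intro h
  obtain ⟨n, hn⟩ := Complex.exp_eq_one_iff.1 h
  have h1 : ((2 * Real.pi * t : ℝ) : ℂ) = ((n * (2 * Real.pi) : ℝ) : ℂ) := by
    apply mul_right_cancel₀ Complex.I_ne_zero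
    rw [hn]
    push_cast
    ring
  have h2 : 2 * Real.pi * t = n * (2 * Real.pi) := by exact_mod_cast h1
  have h3 : t = n := by
    have := Real.pi_pos
    apply mul_left_cancel₀ (show 2 * Real.pi ≠ 0 by positivity)
    linarith
  exact ht ⟨n, by simp [h3]⟩

lemma coeff_taylor_sub {p : ℝ[X]} {d : ℕ} (hp : p.natDegree ≤ d + 1) (r : ℝ) :
    (taylor r p - p).coeff d = (d + 1) * r * p.coeff (d + 1) := by
  have h1 : (hasseDeriv d p).natDegree < 2 := by
    have := natDegree_hasseDeriv_le p d
    omega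
  rw [coeff_sub, taylor_coeff, eval_eq_sum_range' h1]
  simp [Finset.sum_range_succ, hasseDeriv_coeff, add_comm 1 d]
  ring

lemma natDegree_taylor_sub_le {p : ℝ[X]} {d : ℕ} (hp : p.natDegree ≤ d + 1) (r : ℝ) :
    (taylor r p - p).natDegree ≤ d := by
  rw [natDegree_le_iff_coeff_eq_zero]
  intro m hm
  have h1 : (hasseDeriv m p).natDegree < 1 := by
    have := natDegree_hasseDeriv_le p m
    omega
  rw [coeff_sub, taylor_coeff, eval_eq_sum_range' h1]
  simp [hasseDeriv_coeff]

lemma nullAverages_phase_of_natDegree_le_one {p : ℝ[X]} (hp : p.natDegree ≤ 1)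
    (hirr : Irrational (p.coeff 1)) (c : ℂ) :
    NullAverages fun n : ℕ => phase (p.eval (n : ℝ)) * c := by
  have heval : ∀ n : ℕ, phase (p.eval (n : ℝ)) = phase (p.coeff 0) * phase (p.coeff 1) ^ n := by
    intro n
    rw [eval_eq_sum_range' (Nat.lt_succ_of_le hp), ← phase_natCast_mul, ← phase_add]
    simp [Finset.sum_range_succ, mul_comm]
  refine squeeze_zero (fun N => by positivity) (fun N => ?_)
    (tendsto_const_div_atTop_nhds_zero_nat (2 / ‖phase (p.coeff 1) - 1‖ * ‖c‖))
  gcongr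
  simp only [heval]
  rw [← Finset.sum_mul, ← Finset.mul_sum, geom_sum_eq (phase_ne_one hirr), norm_mul, norm_mul,
    norm_phase, one_mul, norm_div]
  gcongr
  refine (norm_sub_le _ _).trans ?_
  rw [norm_pow, norm_phase, one_pow, norm_one]
  norm_num

/-- Multiple correlation sequences do not correlate with polynomial phases of large degree. -/
theorem nullAverages_phase_mul_integral {X : Type*} [MeasurableSpace X] {μ : Measure X}
    [IsProbabilityMeasure μ] {T : X → X} (hT : MeasurePreserving T μ μ) (l : ℕ) :
    ∀ (p : ℝ[X]), p.natDegree ≤ l + 1 → Irrational (p.coeff (l + 1)) →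
    ∀ f : ℕ → X → ℂ, (∀ j, Measurable (f j)) → (∀ j x, ‖f j x‖ ≤ 1) →
    NullAverages fun n : ℕ => phase (p.eval (n : ℝ)) *
      ∫ x, ∏ j ∈ Finset.range (l + 1), f j (T^[j * n] x) ∂μ := by
  induction l with
  | zero =>
    intro p hp hirr f _ _
    simpa using nullAverages_phase_of_natDegree_le_one hp hirr (∫ x, f 0 x ∂μ)
  | succ l ih =>
    intro p hp hirr f hfm hf
    have hTm : ∀ m, Measurable (T^[m]) := fun m => (hT.iterate m).measurable
    set u : ℕ → X → ℂ := fun n x =>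
      phase (p.eval (n : ℝ)) * ∏ j ∈ Finset.range (l + 1), f (j + 1) (T^[(j + 1) * n] x) with hu
    have hum : ∀ n, Measurable (u n) := fun n =>
      (Finset.measurable_prod _ fun j _ => (hfm _).comp (hTm _)).const_mul _
    have hub : ∀ n x, ‖u n x‖ ≤ 1 := by
      intro n x
      rw [hu, norm_mul, norm_phase, one_mul, norm_prod]
      exact Finset.prod_le_one (fun _ _ => norm_nonneg _) fun _ _ => hf _ _
    have heq : ∀ n : ℕ, phase (p.eval (n : ℝ)) *
        ∫ x, ∏ j ∈ Finset.range (l + 1 + 1), f j (T^[j * n] x) ∂μ = ∫ x, f 0 x * u n x ∂μ := by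
      intro n
      rw [← integral_const_mul]
      congr 1
      funext x
      rw [Finset.prod_range_succ', hu]
      simp only [zero_mul, Function.iterate_zero, id]
      ring
    simp only [heq]
    refine nullAverages_integral_mul hum hub (fun h hh => ?_) (hfm 0) (hf 0)
    have hq := ih (taylor (h : ℝ) p - p) (natDegree_taylor_sub_le hp _) (by
        rw [coeff_taylor_sub hp]
        have : Irrational ((((l + 1 + 1) * h : ℕ) : ℝ) * p.coeff (l + 1 + 1)) :=
          hirr.natCast_mul (by positivity)
        exact_mod_cast this)
      (fun j x => conj (f (j + 1) x) * f (j + 1) (T^[(j + 1) * h] x))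
      (fun j => (Complex.continuous_conj.measurable.comp (hfm _)).mul ((hfm _).comp (hTm _)))
      (fun j x => by
        rw [norm_mul, RCLike.norm_conj]
        exact mul_le_one₀ (hf _ _) (norm_nonneg _) (hf _ _))
    convert hq using 2 with n
    set G : X → ℂ := fun x => ∏ j ∈ Finset.range (l + 1),
      conj (f (j + 1) (T^[j * n] x)) * f (j + 1) (T^[(j + 1) * h] (T^[j * n] x)) with hG
    have hGm : Measurable G := Finset.measurable_prod _ fun j _ =>
      (Complex.continuous_conj.measurable.comp ((hfm _).comp (hTm _))).mul
        ((hfm _).comp ((hTm _).comp (hTm _)))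
    have hinv : ∫ x, G (T^[n] x) ∂μ = ∫ x, G x ∂μ := by
      have := integral_map (hTm n).aemeasurable (μ := μ) (f := G)
        (hGm.aestronglyMeasurable)
      rw [(hT.iterate n).map_eq] at this
      exact this.symm
    rw [← hinv, ← integral_const_mul]
    congr 1
    funext x
    rw [eval_sub, taylor_eval, ← conj_phase_mul]
    simp only [hu, hG, map_mul, map_prod, Finset.prod_mul_distrib]
    have h1 : ∀ j, T^[j * n] (T^[n] x) = T^[(j + 1) * n] x := by
      intro j
      rw [← Function.iterate_add_apply]
      congr 2
      ring
    have h2 : ∀ j, T^[(j + 1) * h] (T^[(j + 1) * n] x) = T^[(j + 1) * (n + h)] x := by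
      intro j
      rw [← Function.iterate_add_apply]
      congr 2
      ring
    simp only [h1, h2]
    rw [Nat.cast_add]
    exact mul_mul_mul_comm _ _ _ _

end Weights

section SkewProducts

/-- The `k`-th difference of the sequence is constant, equal to `c`. -/
def IsPolySeq {G : Type*} [AddCommGroup G] : ℕ → G → (ℕ → G) → Prop
  | 0, c, g => ∀ m, g m = c
  | k + 1, c, g => IsPolySeq k c fun m => g (m + 1) - g m

variable {G : Type*} [AddCommGroup G]

lemma isPolySeq_zero (k : ℕ) : IsPolySeq k (0 : G) fun _ => 0 := by
  induction k with
  | zero => exact fun _ => rfl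
  | succ k ih => simpa only [IsPolySeq, sub_self] using ih

lemma IsPolySeq.add {k : ℕ} {c d : G} {f g : ℕ → G} (hf : IsPolySeq k c f)
    (hg : IsPolySeq k d g) : IsPolySeq k (c + d) fun m => f m + g m := by
  induction k generalizing f g with
  | zero => exact fun m => congrArg₂ _ (hf m) (hg m)
  | succ k ih => simpa only [IsPolySeq, add_sub_add_comm] using ih hf hg

lemma IsPolySeq.shift {k : ℕ} {c : G} {f : ℕ → G} (hf : IsPolySeq k c f) (i : ℕ) :
    IsPolySeq k c fun m => f (m + i) := by
  induction k generalizing f with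
  | zero => exact fun m => hf _
  | succ k ih => simpa only [IsPolySeq, add_right_comm] using ih hf

lemma IsPolySeq.step {k : ℕ} {c : G} {f : ℕ → G} (hf : IsPolySeq (k + 1) c f) (n : ℕ) :
    IsPolySeq k (n • c) fun m => f (m + n) - f m := by
  induction n with
  | zero => simpa only [zero_smul, add_zero, sub_self] using isPolySeq_zero k
  | succ n ih =>
    have h := ih.add (IsPolySeq.shift (k := k) hf n)
    rw [succ_nsmul]
    convert h using 2 with m
    change f (m + n + 1) - f m = f (m + n) - f m + (f (m + n + 1) - f (m + n))
    abel

lemma norm_le_of_isPolySeq {G : Type*} [SeminormedAddCommGroup G] {k : ℕ} {c : G} {f : ℕ → G}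
    (hf : IsPolySeq k c f) (n : ℕ) {ε : ℝ} (h : ∀ j ≤ k, ‖f (j * n)‖ ≤ ε) :
    ‖n ^ k • c‖ ≤ 2 ^ k * ε := by
  induction k generalizing f c ε with
  | zero => simpa [show f 0 = c from hf 0] using h 0 le_rfl
  | succ k ih =>
    have := ih (hf.step n) (ε := 2 * ε) fun j hj => by
      have h1 := h (j + 1) (by omega)
      have h2 := h j (by omega)
      rw [add_one_mul] at h1
      exact (norm_sub_le _ _).trans (by linarith)
    rw [smul_smul, ← pow_succ] at this
    rw [pow_succ 2]
    linarith

/-- Iterated skew products over a rotation of the circle. -/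
lemma exists_measurePreserving_isPolySeq (θ : UnitAddCircle) (k : ℕ) :
    ∃ (X : Type) (_ : MeasurableSpace X) (μ : Measure X) (T : X → X) (φ : X → UnitAddCircle),
      IsProbabilityMeasure μ ∧ MeasurePreserving T μ μ ∧ Measurable φ ∧
      (1 ≤ k → MeasurePreserving φ μ volume) ∧ ∀ x, IsPolySeq k θ fun m => φ (T^[m] x) := by
  induction k with
  | zero =>
    exact ⟨Unit, inferInstance, Measure.dirac (), id, fun _ => θ, inferInstance,
      MeasurePreserving.id _, measurable_const, by omega, fun _ _ => rfl⟩
  | succ k ih =>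
    obtain ⟨X, _, μ, T, φ, hμ, hT, hφ, -, hpoly⟩ := ih
    have : IsProbabilityMeasure (volume : Measure UnitAddCircle) := ⟨UnitAddCircle.measure_univ⟩
    refine ⟨X × UnitAddCircle, inferInstance, μ.prod volume, fun z => (T z.1, z.2 + φ z.1),
      Prod.snd, inferInstance, ?_, measurable_snd, fun _ => measurePreserving_snd, fun z => ?_⟩
    · refine hT.skew_product (g := fun x t => t + φ x) ?_ ?_
      · exact measurable_snd.add (hφ.comp measurable_fst)
      · exact Filter.Eventually.of_forall fun x =>
          (measurePreserving_add_right volume (φ x)).map_eq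
    · have hfst : ∀ m, ((fun z : X × UnitAddCircle => (T z.1, z.2 + φ z.1))^[m] z).1 =
          T^[m] z.1 := by
        intro m
        induction m with
        | zero => rfl
        | succ m ih => rw [Function.iterate_succ_apply', Function.iterate_succ_apply', ih]
      change IsPolySeq k θ _
      convert hpoly z.1 using 2 with m
      beta_reduce
      rw [Function.iterate_succ_apply', hfst, add_sub_cancel_left]

/-- The set of `n` such that `nᵏ θ` is far from zero in the circle. -/
def farSet (θ : UnitAddCircle) (k : ℕ) : Set ℕ := {n | 1 / 6 < ‖n ^ k • θ‖}

lemma not_isSetOfKRecurrence_farSet (θ : UnitAddCircle) {k : ℕ} (hk : 1 ≤ k) :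
    ¬ IsSetOfKRecurrence k (farSet θ k) := by
  intro h
  obtain ⟨X, _, μ, T, φ, hμ, hT, hφ, hφμ, hpoly⟩ := exists_measurePreserving_isPolySeq θ k
  set ε : ℝ := 1 / 6 / 2 ^ k with hε
  have hεpos : 0 < ε := by positivity
  obtain ⟨n, hn, hpos⟩ := h X _ μ hμ T hT (φ ⁻¹' Metric.closedBall 0 ε)
    (hφ Metric.isClosed_closedBall.measurableSet) (by
      rw [(hφμ hk).measure_preimage Metric.isClosed_closedBall.measurableSet.nullMeasurableSet]
      exact Metric.measure_closedBall_pos _ _ hεpos)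
  obtain ⟨x, hx⟩ := nonempty_of_measure_ne_zero hpos.ne'
  have hle : ‖n ^ k • θ‖ ≤ 2 ^ k * ε := by
    refine norm_le_of_isPolySeq (hpoly x) n fun j hj => ?_
    have := Set.mem_iInter₂.1 hx j (Finset.mem_range.2 (by omega))
    simpa using this
  have heq : 2 ^ k * ε = 1 / 6 := by rw [hε]; field_simp
  rw [heq] at hle
  exact absurd hn (not_lt.2 hle)

end SkewProducts

section Main

open Filter Topology Polynomial

lemma one_half_le_cos {t : ℝ} (ht : ‖(t : UnitAddCircle)‖ ≤ 1 / 6) :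
    1 / 2 ≤ Real.cos (2 * Real.pi * t) := by
  rw [UnitAddCircle.norm_eq] at ht
  have h1 : Real.cos (2 * Real.pi * t) = Real.cos |2 * Real.pi * (t - round t)| := by
    rw [Real.cos_abs, mul_sub, mul_comm (2 * Real.pi) (round t : ℝ), Real.cos_sub_int_mul_two_pi]
  rw [h1, ← Real.cos_pi_div_three, abs_mul, abs_of_pos Real.two_pi_pos]
  have := Real.pi_pos
  exact Real.cos_le_cos_of_nonneg_of_le_pi (by positivity) (by linarith) (by nlinarith)

lemma isSetOfKRecurrence_farSet {θ : ℝ} (hθ : Irrational θ) (l : ℕ) :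
    IsSetOfKRecurrence l (farSet (θ : UnitAddCircle) (l + 1)) := by
  intro Ω _ μ hμ T hT A hA hμA
  by_contra! hcon
  set a : ℕ → ℝ := fun n => μ.real (⋂ i ∈ Finset.range (l + 1), T^[i * n] ⁻¹' A) with ha
  obtain ⟨n, c, hc, hr⟩ := exists_le_measureReal_iInter hT hA hμA (Nat.succ_pos l)
  refine not_tendsto_average_zero (a := a) (fun n => measureReal_nonneg) hc hr ?_
  have hnull := nullAverages_phase_mul_integral hT l (C θ * X ^ (l + 1))
    (natDegree_C_mul_X_pow_le _ _) (by simpa using hθ) (fun _ => A.indicator 1)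
    (fun _ => measurable_one.indicator hA) (fun _ x => by by_cases hx : x ∈ A <;> simp [hx])
  have hInt : ∀ n : ℕ, ∫ x, ∏ j ∈ Finset.range (l + 1), A.indicator (1 : Ω → ℂ) (T^[j * n] x) ∂μ =
      (a n : ℂ) := by
    intro n
    have hm : MeasurableSet (⋂ i ∈ Finset.range (l + 1), T^[i * n] ⁻¹' A) :=
      Finset.measurableSet_biInter _ fun i _ => (hT.iterate _).measurable hA
    have : ∀ x, ∏ j ∈ Finset.range (l + 1), A.indicator (1 : Ω → ℂ) (T^[j * n] x) =
        (⋂ i ∈ Finset.range (l + 1), T^[i * n] ⁻¹' A).indicator (fun _ => (1 : ℂ)) x := by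
      classical
      intro x
      simp only [Set.indicator_apply, Set.mem_iInter, Set.mem_preimage, Pi.one_apply]
      rw [Finset.prod_ite_zero]
      simp
    simp only [this]
    rw [integral_indicator_const _ hm]
    simp [ha]
  simp only [hInt] at hnull
  have hcos : ∀ n : ℕ, a n / 2 ≤
      (phase (((C θ * X ^ (l + 1) : ℝ[X])).eval (n : ℝ)) * (a n : ℂ)).re := by
    intro n
    have hnonneg : 0 ≤ a n := measureReal_nonneg
    rw [Complex.re_mul_ofReal, phase_re]
    by_cases hn : n ∈ farSet (θ : UnitAddCircle) (l + 1)
    · have : a n = 0 := by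
        have := hcon n hn
        simp only [ha, measureReal_def]
        rw [le_antisymm this zero_le, ENNReal.toReal_zero]
      simp [this]
    · have hle : ‖n ^ (l + 1) • (θ : UnitAddCircle)‖ ≤ 1 / 6 := le_of_not_gt hn
      rw [← AddCircle.coe_nsmul] at hle
      have h1 := one_half_le_cos hle
      have h2 : (C θ * X ^ (l + 1) : ℝ[X]).eval (n : ℝ) = n ^ (l + 1) • θ := by
        rw [eval_C_mul, eval_X_pow, nsmul_eq_mul, Nat.cast_pow, mul_comm]
      rw [h2]
      nlinarith
  have hlim := hnull.const_mul 2
  rw [mul_zero] at hlim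
  refine squeeze_zero (fun N => div_nonneg (Finset.sum_nonneg fun n _ => measureReal_nonneg)
    (by positivity)) (fun N => ?_) hlim
  rw [← mul_div_assoc]
  gcongr
  have h1 := Finset.sum_le_sum fun n (_ : n ∈ Finset.range N) => hcos n
  rw [← Finset.sum_div, ← Complex.re_sum] at h1
  have h2 := h1.trans (Complex.re_le_norm _)
  linarith

end Main

end DensityHalesJewett

/-- For every integer `k ≥ 2` there exists a set `S ⊆ ℕ` that is a set of
`(k-1)`-recurrence but not a set of `k`-recurrence. -/
theorem exists_recurrence_not_recurrence (k : ℕ) (hk : 2 ≤ k) :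
    ∃ S : Set ℕ, IsSetOfKRecurrence (k - 1) S ∧ ¬ IsSetOfKRecurrence k S := by
  obtain ⟨l, rfl⟩ : ∃ l, k = l + 1 := ⟨k - 1, by omega⟩
  exact ⟨DensityHalesJewett.farSet (Real.sqrt 2 : ℝ) (l + 1),
    DensityHalesJewett.isSetOfKRecurrence_farSet irrational_sqrt_two l,
    DensityHalesJewett.not_isSetOfKRecurrence_farSet _ (by omega)⟩
end
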